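/- Let M be a closed oriented hyperbolic m-manifold, m ≥ 3, with π₁(M) ≅ Γ ⊂ SO°(m,1). Then for any n ≥ m the Teichmüller variety 𝒯^{n-1}(Γ) has a natural compactification cl(𝒯^{n-1}(Γ)) such that each of its points corresponds to a faithful discrete representation ρ: Γ → SO°(n,1) belonging to the compact variety ℋⁿ(Γ). -/

import Mathlib

noncomputable section
open Set Filter Topology Metric

/-- Euclidean `n`-space. -/
abbrev Euc (n : ℕ) : Type := EuclideanSpace ℝ (Fin n)

/-- The round unit `n`-sphere `Sⁿ ⊂ ℝ^{n+1}`. -/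
def Sph (n : ℕ) : Set (Euc (n + 1)) := {x | ‖x‖ = 1}

/-- The closed unit ball in `ℝⁿ` (the conformal ball model of `ℍⁿ` together with its
sphere at infinity). -/
def CBall (n : ℕ) : Set (Euc n) := {x | ‖x‖ ≤ 1}

/-- The group structure on self-homeomorphisms of a space. -/
instance homeoGroup (X : Type*) [TopologicalSpace X] : Group (X ≃ₜ X) where
  mul f g := g.trans f
  one := Homeomorph.refl X
  inv := Homeomorph.symm
  mul_assoc _ _ _ := rfl
  one_mul _ := Homeomorph.ext fun _ => rfl
  mul_one _ := Homeomorph.ext fun _ => rfl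
  inv_mul_cancel f := Homeomorph.ext fun x => f.symm_apply_apply x

@[simp] lemma homeo_mul_apply {X : Type*} [TopologicalSpace X] (f g : X ≃ₜ X) (x : X) :
    (f * g) x = f (g x) := rfl

@[simp] lemma homeo_one_apply {X : Type*} [TopologicalSpace X] (x : X) :
    (1 : X ≃ₜ X) x = x := rfl

/-- The absolute cross ratio `[x,y;z,w]` of four points in a metric space. -/
def crossRatio {X : Type*} [MetricSpace X] (x y z w : X) : ℝ :=
  (dist x z * dist y w) / (dist x w * dist y z)

/-- A map between metric spaces preserves absolute cross-ratios.  For self-maps of the round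
sphere `Sⁿ` (with its chordal metric) this characterizes Möbius transformations. -/
def PreservesCR {X Y : Type*} [MetricSpace X] [MetricSpace Y] (f : X → Y) : Prop :=
  ∀ x y z w : X, crossRatio (f x) (f y) (f z) (f w) = crossRatio x y z w

/-- The Möbius group `Möb(n)` of the sphere `Sⁿ`, realized as the group of
cross-ratio-preserving self-homeomorphisms of `Sⁿ`.  Via the standard identification it is
isomorphic to `SO°(n+1,1) = Isom₊ ℍ^{n+1}`. -/
def MobiusGrp (n : ℕ) : Subgroup (↥(Sph n) ≃ₜ ↥(Sph n)) where
  carrier := {f | PreservesCR f}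
  one_mem' := fun _ _ _ _ => rfl
  mul_mem' := by
    intro f g hf hg x y z w
    have : ∀ u, (f * g) u = f (g u) := fun _ => rfl
    simp only [this]
    exact (hf (g x) (g y) (g z) (g w)).trans (hg x y z w)
  inv_mem' := by
    intro f hf x y z w
    have h := hf (f.symm x) (f.symm y) (f.symm z) (f.symm w)
    simp only [Homeomorph.apply_symm_apply] at h
    exact h.symm

/-- A subgroup of the homeomorphism group of a space is discrete if no sequence of
pairwise distinct elements converges pointwise to the identity. -/
def IsDiscreteSubgroup {X : Type*} [TopologicalSpace X] (G : Subgroup (X ≃ₜ X)) : Prop :=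
  ¬ ∃ u : ℕ → G, Function.Injective u ∧
      ∀ x : X, Tendsto (fun k => ((u k : X ≃ₜ X) x)) atTop (nhds x)

/-- The limit set of a group of homeomorphisms: all accumulation points of orbits. -/
def limitSet {X : Type*} [TopologicalSpace X] (G : Subgroup (X ≃ₜ X)) : Set X :=
  {p | ∃ x : X, ∃ u : ℕ → G, Function.Injective u ∧
      Tendsto (fun k => ((u k : X ≃ₜ X) x)) atTop (nhds p)}

/-- The discontinuity set (ordinary set) `Ω(G)`, the complement of the limit set. -/
def ordinarySet {X : Type*} [TopologicalSpace X] (G : Subgroup (X ≃ₜ X)) : Set X :=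
  (limitSet G)ᶜ

/-- `P` is a fundamental domain (fundamental polyhedron) for the action of `G` on `Ω`. -/
def IsFundamentalDom {X : Type*} [TopologicalSpace X] (G : Subgroup (X ≃ₜ X))
    (Ω P : Set X) : Prop :=
  P ⊆ Ω ∧ (∀ x ∈ Ω, ∃ g ∈ G, (g : X ≃ₜ X) x ∈ P) ∧
    ∀ g ∈ G, g ≠ (1 : X ≃ₜ X) → Disjoint (interior P) ((g : X ≃ₜ X) '' interior P)

/-- A Kleinian group `G ⊂ Möb(n)` is geometrically finite if it admits a finitely-sided
fundamental polyhedron, i.e. one bounded by finitely many round spheres. -/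
def GeometricallyFinite {n : ℕ} (G : Subgroup (↥(Sph n) ≃ₜ ↥(Sph n))) : Prop :=
  ∃ s : Finset (↥(Sph n) × ℝ),
    IsFundamentalDom G (ordinarySet G) (univ \ ⋃ p ∈ s, Metric.ball p.1 p.2)

/-- A group of homeomorphisms of the closed unit ball acts cocompactly on the open ball. -/
def IsCocompactOnBall {n : ℕ} (G : Subgroup (↥(CBall n) ≃ₜ ↥(CBall n))) : Prop :=
  ∃ K : Set ↥(CBall n), IsCompact K ∧ (∀ x ∈ K, ‖(x : Euc n)‖ < 1) ∧
    ∀ x : ↥(CBall n), ‖(x : Euc n)‖ < 1 → ∃ g ∈ G, (g : _ ≃ₜ _) x ∈ K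

/-- A uniform hyperbolic lattice `Γ ⊂ Isom ℍⁿ ≅ O(n,1)`: a discrete cocompact group of
isometries of hyperbolic `n`-space, realized in the conformal ball model as a group of
cross-ratio-preserving (Möbius) self-homeomorphisms of the closed unit ball preserving
the boundary sphere. -/
structure UniformHypLattice (n : ℕ) where
  grp : Subgroup (↥(CBall n) ≃ₜ ↥(CBall n))
  mobius : ∀ g ∈ grp, PreservesCR ((g : ↥(CBall n) ≃ₜ ↥(CBall n)) : _ → _)
  sphere_inv : ∀ g ∈ grp, ∀ x : ↥(CBall n), ‖(x : Euc n)‖ = 1 →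
      ‖(((g : _ ≃ₜ _) x : ↥(CBall n)) : Euc n)‖ = 1
  discrete : IsDiscreteSubgroup grp
  cocompact : IsCocompactOnBall grp

/-- The boundary action of a hyperbolic lattice `Γ ⊂ Isom ℍ^{m+1}` on the sphere at
infinity `Sᵐ = ∂ℍ^{m+1}`. -/
def UniformHypLattice.bdry {m : ℕ} (Γ : UniformHypLattice (m + 1)) (g : Γ.grp) :
    ↥(Sph m) → ↥(Sph m) :=
  fun x =>
    ⟨((g : ↥(CBall (m+1)) ≃ₜ ↥(CBall (m+1)))
        ⟨(x : Euc (m+1)), le_of_eq (x.2 : ‖(x : Euc (m+1))‖ = 1)⟩ : ↥(CBall (m+1))),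
      Γ.sphere_inv g g.2 _ (x.2 : ‖(x : Euc (m+1))‖ = 1)⟩

/-- A representation into the Möbius group of `Sⁿ`. -/
def IsMobiusRep {Γ : Type*} [Group Γ] {n : ℕ} (ρ : Γ →* (↥(Sph n) ≃ₜ ↥(Sph n))) : Prop :=
  ∀ g : Γ, PreservesCR ((ρ g : ↥(Sph n) ≃ₜ ↥(Sph n)) : ↥(Sph n) → ↥(Sph n))

/-- A quasisymmetric map between metric spaces: there is a distortion homeomorphism
`η : [0,∞) → [0,∞)` controlling relative distances. -/
def IsQuasisymmetric {X Y : Type*} [MetricSpace X] [MetricSpace Y] (f : X → Y) : Prop :=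
  ∃ η : ℝ → ℝ, ContinuousOn η (Ici 0) ∧ StrictMonoOn η (Ici 0) ∧ η 0 = 0 ∧
    (∀ M : ℝ, ∃ t : ℝ, 0 ≤ t ∧ M ≤ η t) ∧
    ∀ x y z : X, x ≠ z →
      dist (f x) (f y) ≤ η (dist x y / dist x z) * dist (f x) (f z)

/-- `K ⊂ Sⁿ` is an `m`-knot: the image of a topological embedding of `Sᵐ`. -/
def IsKnot (m n : ℕ) (K : Set ↥(Sph n)) : Prop :=
  ∃ e : ↥(Sph m) → ↥(Sph n), Topology.IsEmbedding e ∧ range e = K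

/-- A self-homeomorphism of the sphere is orientation preserving iff it is homotopic to the
identity. -/
def OrientationPreserving {n : ℕ} (h : ↥(Sph n) ≃ₜ ↥(Sph n)) : Prop :=
  ContinuousMap.Homotopic ⟨h, h.continuous⟩ (ContinuousMap.id _)

/-- The standard (unknotted) great `m`-subsphere `Sᵐ ⊂ Sⁿ`. -/
def stdSubSph (m n : ℕ) : Set ↥(Sph n) :=
  {x | ∀ i : Fin (n + 1), m < (i : ℕ) → (x : Euc (n + 1)) i = 0}

/-- Two subsets of `Sⁿ` (e.g. two knots) are equivalent if an orientation-preserving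
homeomorphism of `Sⁿ` carries one onto the other. -/
def KnotEquiv {n : ℕ} (K L : Set ↥(Sph n)) : Prop :=
  ∃ h : ↥(Sph n) ≃ₜ ↥(Sph n), OrientationPreserving h ∧ h '' K = L

/-- An `m`-knot in `Sⁿ` is trivial (unknotted) if it is equivalent to the standard
inclusion `Sᵐ ⊂ Sⁿ`. -/
def IsTrivialKnot (m n : ℕ) (K : Set ↥(Sph n)) : Prop :=
  KnotEquiv K (stdSubSph m n)

/-- An `m`-dimensional subset `K ⊂ Sⁿ` is locally flat at `p ∈ K` if some neighborhood of
`p` in `Sⁿ` is homeomorphic to `ℝⁿ` by a homeomorphism carrying `K` to `ℝᵐ ⊂ ℝⁿ`. -/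
def LocallyFlatAt (m n : ℕ) (K : Set ↥(Sph n)) (p : ↥(Sph n)) : Prop :=
  ∃ U : Set ↥(Sph n), IsOpen U ∧ p ∈ U ∧
    ∃ h : ↥U ≃ₜ Euc n,
      h '' {x : ↥U | (x : ↥(Sph n)) ∈ K} = {y : Euc n | ∀ i : Fin n, m ≤ (i : ℕ) → y i = 0}

/-- A knot is wild at `p` if it is not locally flat there; it is everywhere wild if it is
wild at every point. -/
def EverywhereWild (m n : ℕ) (K : Set ↥(Sph n)) : Prop :=
  ∀ p ∈ K, ¬ LocallyFlatAt m n K p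

/-- `N` is an open regular neighborhood of the `m`-knot `K ⊂ Sⁿ`, i.e. `N ≅ Sᵐ × B²`
with `K` corresponding to `Sᵐ × {0}`. -/
def IsRegularNbhd (m n : ℕ) (K N : Set ↥(Sph n)) : Prop :=
  IsOpen N ∧ K ⊆ N ∧ ∃ h : ↥N ≃ₜ ↥(Sph m) × Euc 2,
    ∀ x : ↥N, ((x : ↥(Sph n)) ∈ K ↔ (h x).2 = 0)

/-- The closed upper hemisphere of `Sⁿ`. -/
def upperHS (n : ℕ) : Set ↥(Sph n) := {x | 0 ≤ (x : Euc (n + 1)) (Fin.last n)}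

/-- The closed lower hemisphere of `Sⁿ`. -/
def lowerHS (n : ℕ) : Set ↥(Sph n) := {x | (x : Euc (n + 1)) (Fin.last n) ≤ 0}

/-- `J` is a connected sum `K₁ # K₂` of the `m`-knots `K₁, K₂ ⊂ Sⁿ`: after isotoping
`K₁` (resp. `K₂`) so that it is standard in the lower (resp. upper) closed hemisphere,
`J` is assembled from the upper part of `K₁` and the lower part of `K₂`. -/
def IsConnectedSumOf (m n : ℕ) (J K₁ K₂ : Set ↥(Sph n)) : Prop :=
  ∃ L₁ L₂ : Set ↥(Sph n), KnotEquiv K₁ L₁ ∧ KnotEquiv K₂ L₂ ∧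
    L₁ ∩ lowerHS n = stdSubSph m n ∩ lowerHS n ∧
    L₂ ∩ upperHS n = stdSubSph m n ∩ upperHS n ∧
    J = (L₁ ∩ upperHS n) ∪ (L₂ ∩ lowerHS n)

/-- `L` is the infinite compounding `⋯ # K # K # K # ⋯` of the `m`-knot `K ⊂ Sⁿ`:
the intersection of a decreasing sequence of closed regular neighborhoods of the knots
`K₀ = K`, `K_{i+1} = K_i # K_i`. -/
def IsInfiniteCompounding (m n : ℕ) (K L : Set ↥(Sph n)) : Prop :=
  ∃ Ks N : ℕ → Set ↥(Sph n),
    KnotEquiv (Ks 0) K ∧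
    (∀ i, IsConnectedSumOf m n (Ks (i + 1)) (Ks i) (Ks i)) ∧
    (∀ i, IsRegularNbhd m n (Ks i) (N i)) ∧
    (∀ i, closure (N (i + 1)) ⊆ N i) ∧
    L = ⋂ i, closure (N i)

/-- A round `m`-subsphere of `Sⁿ`: a Möbius image of the standard great subsphere. -/
def IsRoundSubsphere (m n : ℕ) (S : Set ↥(Sph n)) : Prop :=
  ∃ g ∈ MobiusGrp n, (g : ↥(Sph n) ≃ₜ ↥(Sph n)) '' stdSubSph m n = S

/-- A trivial `m`-link in `Sⁿ`: finitely many disjoint `m`-spheres which can be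
simultaneously carried by a homeomorphism of `Sⁿ` onto disjoint round subspheres. -/
def IsTrivialLink (m n : ℕ) {k : ℕ} (S : Fin k → Set ↥(Sph n)) : Prop :=
  (∀ i, IsKnot m n (S i)) ∧ Pairwise (Function.onFun Disjoint S) ∧
    ∃ h : ↥(Sph n) ≃ₜ ↥(Sph n), ∀ i, IsRoundSubsphere m n (h '' S i)

/-- A ribbon `m`-knot in `Sⁿ` (with `k` fusions): obtained from a trivial `m`-link with
`k+1` components by `k` fusions along disjointly embedded `(m+1)`-balls
`F i : [0,1] × Bᵐ ↪ Sⁿ` which meet the link precisely in their end disks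
`F i ({0,1} × Bᵐ)`, the two end disks lying on different components. -/
def IsRibbonKnot (m n : ℕ) (K : Set ↥(Sph n)) : Prop :=
  IsKnot m n K ∧
  ∃ k : ℕ, ∃ S : Fin (k + 1) → Set ↥(Sph n), IsTrivialLink m n S ∧
    ∃ F : Fin k → (↥unitInterval × ↥(CBall m)) → ↥(Sph n),
      (∀ i, Topology.IsEmbedding (F i)) ∧
      (Pairwise fun i j => Disjoint (range (F i)) (range (F j))) ∧
      (∀ i, range (F i) ∩ (⋃ j, S j) =
        F i '' {p | (p.1 : ℝ) = 0 ∨ (p.1 : ℝ) = 1}) ∧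
      (∀ i, ∃ j₀ j₁ : Fin (k + 1), j₀ ≠ j₁ ∧
        F i '' {p | (p.1 : ℝ) = 0} ⊆ S j₀ ∧ F i '' {p | (p.1 : ℝ) = 1} ⊆ S j₁) ∧
      K = ((⋃ j, S j) \
            ⋃ i, F i '' {p | ((p.1 : ℝ) = 0 ∨ (p.1 : ℝ) = 1) ∧ ‖(p.2 : Euc m)‖ < 1}) ∪
          ⋃ i, F i '' {p | ‖(p.2 : Euc m)‖ = 1}

/-- Conservative/ergodic dynamics of `G` on an invariant set `Λ`, in the topological
sense: every pair of relatively open nonempty subsets of `Λ` is mixed by some element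
of `G`. -/
def ActsErgodicallyOn {X : Type*} [TopologicalSpace X] (G : Subgroup (X ≃ₜ X))
    (Λ : Set X) : Prop :=
  (∀ g ∈ G, (g : X ≃ₜ X) '' Λ = Λ) ∧
  ∀ U V : Set X, IsOpen U → IsOpen V → (U ∩ Λ).Nonempty → (V ∩ Λ).Nonempty →
    ∃ g ∈ G, ((g : X ≃ₜ X) '' (U ∩ Λ) ∩ (V ∩ Λ)).Nonempty

/-- The compact-open-type topology on the group of self-homeomorphisms. -/
instance homeoTopology (X : Type*) [TopologicalSpace X] : TopologicalSpace (X ≃ₜ X) :=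
  TopologicalSpace.induced
    (fun f : X ≃ₜ X => ((⟨f, f.continuous⟩ : C(X, X)), (⟨f.symm, f.symm.continuous⟩ : C(X, X))))
    inferInstance

/-- The space of Möbius representations of a group `Γ` in `Möb(n) ≅ SO°(n+1,1)`, with the
topology of algebraic convergence. -/
def MobRepSp (Γ : Type*) [Group Γ] (n : ℕ) : Type _ :=
  {ρ : Γ →* (↥(Sph n) ≃ₜ ↥(Sph n)) // IsMobiusRep ρ}

instance (Γ : Type*) [Group Γ] (n : ℕ) : TopologicalSpace (MobRepSp Γ n) :=
  TopologicalSpace.induced (fun ρ : MobRepSp Γ n => fun g : Γ => ρ.1 g) inferInstance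

/-- Conjugacy of representations by a Möbius transformation. -/
def conjRel (Γ : Type*) [Group Γ] (n : ℕ) : MobRepSp Γ n → MobRepSp Γ n → Prop :=
  fun ρ σ => ∃ h ∈ MobiusGrp n, ∀ g : Γ, σ.1 g = h * ρ.1 g * h⁻¹

/-- The variety `Hom(Γ, SO°(n+1,1))/SO°(n+1,1)` of conjugacy classes of Möbius
representations, with the algebraic convergence (quotient) topology. -/
def RepVariety (Γ : Type*) [Group Γ] (n : ℕ) : Type _ := Quot (conjRel Γ n)

instance (Γ : Type*) [Group Γ] (n : ℕ) : TopologicalSpace (RepVariety Γ n) := by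
  unfold RepVariety; infer_instance

/-- The subvariety `ℋ^{n+1}(Γ) ⊂ Hom(Γ,SO°(n+1,1))/SO°(n+1,1)` of conjugacy classes of
faithful discrete representations; equivalently, the variety of hyperbolic
`(n+1)`-structures on `Γ`. -/
def HypVariety (Γ : Type*) [Group Γ] (n : ℕ) : Set (RepVariety Γ n) :=
  {c | ∃ ρ : MobRepSp Γ n, Quot.mk _ ρ = c ∧ Function.Injective ρ.1 ∧
        IsDiscreteSubgroup ρ.1.range}

/-- The Teichmüller subvariety `𝒯ⁿ(Γ) ⊂ ℋ^{n+1}(Γ)` of classes of geometrically finite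
faithful discrete representations with nonempty discontinuity set; equivalently, the
space of uniformizable conformal `n`-structures on `Γ`. -/
def TeichVariety (Γ : Type*) [Group Γ] (n : ℕ) : Set (RepVariety Γ n) :=
  {c | ∃ ρ : MobRepSp Γ n, Quot.mk _ ρ = c ∧ Function.Injective ρ.1 ∧
        IsDiscreteSubgroup ρ.1.range ∧ GeometricallyFinite ρ.1.range ∧
        (ordinarySet ρ.1.range).Nonempty}

open CategoryTheory

universe u

/-- The homomorphism of fundamental groups induced by a continuous map. -/
def pi1Map {X Y : Type u} [TopologicalSpace X] [TopologicalSpace Y] (f : C(X, Y)) (x : X) :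
    FundamentalGroup X x →* FundamentalGroup Y (f x) :=
  CategoryTheory.Functor.mapEnd (FundamentalGroupoid.mk x)
    (show FundamentalGroupoid X ⥤ FundamentalGroupoid Y from
      FundamentalGroupoid.fundamentalGroupoidFunctor.map
        (X := TopCat.of X) (Y := TopCat.of Y) (TopCat.ofHom f))

/-- The first singular homology group `H₁(X;ℤ)` of a (path-connected) space, realized as
the abelianization of the fundamental group. -/
def H1 (X : Type u) [TopologicalSpace X] (x : X) : Type u :=
  Abelianization (FundamentalGroup X x)

instance (X : Type u) [TopologicalSpace X] (x : X) : CommGroup (H1 X x) := by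
  unfold H1; infer_instance

/-- The map induced on `H₁` by a continuous map. -/
def H1Map {X Y : Type u} [TopologicalSpace X] [TopologicalSpace Y] (f : C(X, Y)) (x : X) :
    H1 X x →* H1 Y (f x) :=
  Abelianization.map (pi1Map f x)

/-- An infinite cyclic covering of `X`: a connected regular covering space with deck
transformation group `ℤ` (for a space with `H₁(X;ℤ) ≅ ℤ`, this is the covering determined
by the epimorphism `π₁(X) → H₁(X;ℤ) ≅ ℤ`). -/
structure InfCyclicCover (X : Type*) [TopologicalSpace X] where
  total : Type u
  [ts : TopologicalSpace total]
  conn : ConnectedSpace total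
  proj : total → X
  cov : ∀ x, DiscreteTopology (proj ⁻¹' {x}) ∧
    ∃ t : Bundle.Trivialization (proj ⁻¹' {x}) proj, x ∈ t.baseSet
  deck : Multiplicative ℤ →* (total ≃ₜ total)
  deck_proj : ∀ (k : Multiplicative ℤ) (z : total), proj (deck k z) = proj z
  deck_trans : ∀ z w : total, proj z = proj w → ∃ k : Multiplicative ℤ, deck k z = w
  deck_free : ∀ (k : Multiplicative ℤ) (z : total), deck k z = z → k = 1

attribute [instance] InfCyclicCover.ts InfCyclicCover.conn

set_option linter.all false

namespace TV

/-! ### Lorentz space -/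

abbrev LV (k : ℕ) : Type := Euc k × ℝ

variable {k : ℕ}

/-- the Lorentz form -/
def lB (x y : LV k) : ℝ := x.2 * y.2 - inner ℝ x.1 y.1

lemma lB_comm (x y : LV k) : lB x y = lB y x := by
  simp only [lB, real_inner_comm, mul_comm]

lemma lB_add_left (x y z : LV k) : lB (x + y) z = lB x z + lB y z := by
  simp only [lB, Prod.snd_add, Prod.fst_add, inner_add_left]; ring

lemma lB_sub_left (x y z : LV k) : lB (x - y) z = lB x z - lB y z := by
  simp only [lB, Prod.snd_sub, Prod.fst_sub, inner_sub_left]; ring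

lemma lB_smul_left (c : ℝ) (x z : LV k) : lB (c • x) z = c * lB x z := by
  simp only [lB, Prod.smul_snd, Prod.smul_fst, real_inner_smul_left, smul_eq_mul]; ring

lemma lB_neg_left (x z : LV k) : lB (-x) z = - lB x z := by
  simp only [lB, Prod.snd_neg, Prod.fst_neg, inner_neg_left]; ring

lemma lB_add_right (x y z : LV k) : lB z (x + y) = lB z x + lB z y := by
  simp only [lB_comm z, lB_add_left]

lemma lB_sub_right (x y z : LV k) : lB z (x - y) = lB z x - lB z y := by
  simp only [lB_comm z, lB_sub_left]

lemma lB_smul_right (c : ℝ) (x z : LV k) : lB z (c • x) = c * lB z x := by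
  simp only [lB_comm z, lB_smul_left]

lemma lB_neg_right (x z : LV k) : lB z (-x) = - lB z x := by
  simp only [lB_comm z, lB_neg_left]

lemma lB_zero_left (z : LV k) : lB 0 z = 0 := by
  simp [lB]

lemma lB_zero_right (z : LV k) : lB z 0 = 0 := by
  simp [lB]

lemma lB_self (x : LV k) : lB x x = x.2 ^ 2 - ‖x.1‖ ^ 2 := by
  simp only [lB, real_inner_self_eq_norm_sq]; ring

lemma lB_continuous : Continuous (fun p : LV k × LV k => lB p.1 p.2) := by
  unfold lB; fun_prop

/-- the form as a linear functional -/
def lBlin (w : LV k) : LV k →ₗ[ℝ] ℝ where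
  toFun v := lB v w
  map_add' x y := lB_add_left x y w
  map_smul' c x := lB_smul_left c x w

/-- base point -/
def lo : LV k := (0, 1)

@[simp] lemma lo_snd : (lo : LV k).2 = 1 := rfl
@[simp] lemma lo_fst : (lo : LV k).1 = 0 := rfl

@[simp] lemma lB_lo (x : LV k) : lB x lo = x.2 := by simp [lB]
@[simp] lemma lB_lo' (x : LV k) : lB lo x = x.2 := by simp [lB]

/-- nondegeneracy -/
lemma lB_nondeg {v : LV k} (h : ∀ w, lB v w = 0) : v = 0 := by
  have h1 := h (-v.1, v.2)
  simp only [lB, inner_neg_right, real_inner_self_eq_norm_sq] at h1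
  have h2 : v.2 = 0 := by nlinarith [sq_nonneg ‖v.1‖]
  have h3 : ‖v.1‖ = 0 := by nlinarith
  exact Prod.ext (norm_eq_zero.1 h3) h2

/-- hyperboloid -/
def hyp (k : ℕ) : Set (LV k) := {x | lB x x = 1 ∧ 0 < x.2}

lemma lo_mem : (lo : LV k) ∈ hyp k := ⟨by simp, by simp⟩

lemma hyp_norm {x : LV k} (hx : x ∈ hyp k) : ‖x.1‖ ^ 2 = x.2 ^ 2 - 1 := by
  have := hx.1; rw [lB_self] at this; linarith

lemma abs_inner_bound (x y : LV k) : |inner ℝ x.1 y.1| ≤ ‖x.1‖ * ‖y.1‖ := abs_real_inner_le_norm _ _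

lemma one_le_lB {x y : LV k} (hx : x ∈ hyp k) (hy : y ∈ hyp k) : 1 ≤ lB x y := by
  have h1 := hyp_norm hx
  have h2 := hyp_norm hy
  have h3 := real_inner_le_norm x.1 y.1
  have hx2 := hx.2
  have hy2 := hy.2
  have h4 : 1 ≤ x.2 := by nlinarith [sq_nonneg ‖x.1‖]
  have h5 : 1 ≤ y.2 := by nlinarith [sq_nonneg ‖y.1‖]
  have h6 : ‖x.1‖ * ‖y.1‖ ≤ x.2 * y.2 - 1 := by
    apply abs_le_of_sq_le_sq' _ (by nlinarith) |>.2
    rw [mul_pow, h1, h2]; nlinarith [sq_nonneg (x.2 - y.2)]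
  unfold lB; linarith

lemma one_le_snd {x : LV k} (hx : x ∈ hyp k) : 1 ≤ x.2 := by
  simpa using one_le_lB hx lo_mem

/-- orthocomplement of a timelike vector is negative definite -/
lemma lB_orth {x v : LV k} (h : lB v x = 0) :
    lB v v * x.2 ^ 2 ≤ - (lB x x * ‖v.1‖ ^ 2) := by
  have h3 := abs_real_inner_le_norm v.1 x.1
  rw [lB_self x]
  rw [lB_self v]
  have h4 : v.2 * x.2 = inner ℝ v.1 x.1 := by unfold lB at h; linarith
  rw [← h4] at h3
  have h5 : (v.2 * x.2) ^ 2 ≤ (‖v.1‖ * ‖x.1‖) ^ 2 := sq_le_sq.2 (by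
    rw [abs_of_nonneg (a := ‖v.1‖ * ‖x.1‖) (by positivity)]; exact h3)
  nlinarith

lemma snd_ne_zero_of_timelike {x : LV k} (hx : 0 < lB x x) : x.2 ≠ 0 := by
  intro h; rw [lB_self, h] at hx; nlinarith [sq_nonneg ‖x.1‖]

lemma lB_orth_nonpos {x v : LV k} (hx : 0 < lB x x) (h : lB v x = 0) : lB v v ≤ 0 := by
  have h1 := lB_orth h
  have h2 := snd_ne_zero_of_timelike hx
  have h3 : 0 < x.2 ^ 2 := by positivity
  have : 0 ≤ lB x x * ‖v.1‖ ^ 2 := by positivity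
  by_contra! h4
  nlinarith [mul_pos h4 h3]

lemma lB_orth_eq {x v : LV k} (hx : 0 < lB x x) (h : lB v x = 0) (h0 : 0 ≤ lB v v) : v = 0 := by
  have h1 := lB_orth h
  have h2 := snd_ne_zero_of_timelike hx
  have h3 : 0 ≤ lB v v * x.2 ^ 2 := by positivity
  have h4 : ‖v.1‖ ^ 2 = 0 := by
    by_contra h5
    have : 0 < ‖v.1‖ ^ 2 := lt_of_le_of_ne (by positivity) (Ne.symm h5)
    nlinarith [mul_pos hx this]
  have h5 : v.1 = 0 := by simpa using h4
  have h6 : v.2 * x.2 = 0 := by unfold lB at h; rw [h5] at h; simpa using h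
  exact Prod.ext h5 (by simpa [h2] using h6)

lemma eq_of_lB_one {x y : LV k} (hx : x ∈ hyp k) (hy : y ∈ hyp k) (h : lB x y = 1) : x = y := by
  have : x - y = 0 := by
    apply lB_orth_eq (x := x) (by rw [hx.1]; norm_num)
    · rw [lB_sub_left, hx.1, lB_comm, h]; ring
    · simp only [lB_sub_left, lB_sub_right, hx.1, hy.1, lB_comm y x, h]; norm_num
  exact sub_eq_zero.1 this

lemma mem_hyp_of {x b : LV k} (hx : lB x x = 1) (hb : b ∈ hyp k) (h : 0 < lB x b) : x ∈ hyp k := by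
  refine ⟨hx, ?_⟩
  by_contra! h2
  have h3 : x.2 ≠ 0 := snd_ne_zero_of_timelike (by rw [hx]; norm_num)
  have h4 : -x ∈ hyp k := ⟨by rw [lB_neg_left, lB_neg_right, hx]; ring, by
    simp only [Prod.snd_neg]; exact neg_pos.2 (lt_of_le_of_ne h2 h3)⟩
  have := one_le_lB h4 hb
  rw [lB_neg_left] at this; linarith

lemma quasi_triangle {x y z : LV k} (hx : x ∈ hyp k) (hy : y ∈ hyp k) (hz : z ∈ hyp k) :
    lB x z ≤ 2 * lB x y * lB y z := by
  have h1 := one_le_lB hx hy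
  have h2 : (2 * lB x y) • y - x ∈ hyp k := by
    apply mem_hyp_of (b := y) _ hy
    · simp only [lB_sub_left, lB_smul_left, hy.1]; linarith
    · simp only [lB_sub_left, lB_sub_right, lB_smul_left, lB_smul_right, hy.1, hx.1, lB_comm y x]
      ring
  have h3 := one_le_lB h2 hz
  simp only [lB_sub_left, lB_smul_left] at h3
  linarith

/-- hyperbolic midpoint -/
def mid (p q : LV k) : LV k := (1 / Real.sqrt (2 + 2 * lB p q)) • (p + q)

lemma mid_mem {p q : LV k} (hp : p ∈ hyp k) (hq : q ∈ hyp k) : mid p q ∈ hyp k := by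
  have h1 := one_le_lB hp hq
  have h2 : 0 < Real.sqrt (2 + 2 * lB p q) := Real.sqrt_pos.2 (by linarith)
  have h3 := Real.sq_sqrt (show 0 ≤ 2 + 2 * lB p q by linarith)
  refine ⟨?_, ?_⟩
  · simp only [mid, lB_smul_left, lB_smul_right, lB_add_left, lB_add_right, hp.1, hq.1, lB_comm q p]
    generalize Real.sqrt (2 + 2 * lB p q) = r at *
    field_simp
    linarith
  · simp only [mid, Prod.smul_snd, Prod.snd_add, smul_eq_mul]
    have := hp.2; have := hq.2; positivity

lemma lB_mid_le {a p q : LV k} {M : ℝ} (hp : p ∈ hyp k) (hq : q ∈ hyp k)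
    (h1 : lB a p ≤ M) (h2 : lB a q ≤ M) :
    lB a (mid p q) ≤ M / Real.sqrt ((1 + lB p q) / 2) := by
  have h3 := one_le_lB hp hq
  have h4 : Real.sqrt (2 + 2 * lB p q) = 2 * Real.sqrt ((1 + lB p q) / 2) := by
    rw [show 2 + 2 * lB p q = 2 ^ 2 * ((1 + lB p q) / 2) by ring, Real.sqrt_mul (by norm_num),
      Real.sqrt_sq (by norm_num)]
  have h5 : 0 < Real.sqrt ((1 + lB p q) / 2) := Real.sqrt_pos.2 (by linarith)
  simp only [mid, lB_smul_right, lB_add_right, h4]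
  rw [div_mul_eq_mul_div, div_le_div_iff₀ (by positivity) h5]
  nlinarith

/-! ### The Lorentz group -/

/-- form-preserving units preserving the hyperboloid -/
def lG (k : ℕ) : Subgroup (LV k →L[ℝ] LV k)ˣ where
  carrier := {A | (∀ x y : LV k, lB (A.1 x) (A.1 y) = lB x y) ∧
    ∀ x : LV k, x ∈ hyp k ↔ A.1 x ∈ hyp k}
  one_mem' := ⟨fun x y => rfl, fun x => Iff.rfl⟩
  mul_mem' := by
    intro a b ha hb
    refine ⟨fun x y => ?_, fun x => ?_⟩
    · exact (ha.1 (b.1 x) (b.1 y)).trans (hb.1 x y)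
    · exact (hb.2 x).trans (ha.2 (b.1 x))
  inv_mem' := by
    intro a ha
    have h : ∀ x, a.1 ((a⁻¹ : (LV k →L[ℝ] LV k)ˣ).1 x) = x := fun x =>
      congrArg (fun f : LV k →L[ℝ] LV k => f x) a.mul_inv
    refine ⟨fun x y => ?_, fun x => ?_⟩
    · rw [← ha.1, h, h]
    · rw [ha.2 ((a⁻¹ : (LV k →L[ℝ] LV k)ˣ).1 x), h]

/-- the underlying operator -/
def opr (A : lG k) : LV k →L[ℝ] LV k := A.1.1

/-- action -/
def act (A : lG k) (x : LV k) : LV k := opr A x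

notation:73 A:74 "⊙" x:73 => act A x

@[simp] lemma act_mul (A B : lG k) (x : LV k) : (A * B) ⊙ x = A ⊙ (B ⊙ x) := rfl
@[simp] lemma act_one (x : LV k) : (1 : lG k) ⊙ x = x := rfl
@[simp] lemma act_inv_act (A : lG k) (x : LV k) : A ⊙ (A⁻¹ ⊙ x) = x := by
  rw [← act_mul, mul_inv_cancel, act_one]
@[simp] lemma inv_act_act (A : lG k) (x : LV k) : A⁻¹ ⊙ (A ⊙ x) = x := by
  rw [← act_mul, inv_mul_cancel, act_one]
lemma act_add (A : lG k) (x y : LV k) : A ⊙ (x + y) = A ⊙ x + A ⊙ y := map_add _ _ _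
lemma act_sub (A : lG k) (x y : LV k) : A ⊙ (x - y) = A ⊙ x - A ⊙ y := map_sub _ _ _
lemma act_smul (A : lG k) (c : ℝ) (x : LV k) : A ⊙ (c • x) = c • (A ⊙ x) := map_smul _ _ _
lemma act_inj (A : lG k) {x y : LV k} (h : A ⊙ x = A ⊙ y) : x = y := by
  rw [← inv_act_act A x, h, inv_act_act]

@[simp] lemma lB_act (A : lG k) (x y : LV k) : lB (A ⊙ x) (A ⊙ y) = lB x y := A.2.1 x y
lemma act_mem (A : lG k) {x : LV k} (hx : x ∈ hyp k) : A ⊙ x ∈ hyp k := (A.2.2 x).1 hx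

lemma lB_act_inv (A : lG k) (x y : LV k) : lB (A ⊙ x) y = lB x (A⁻¹ ⊙ y) := by
  rw [← lB_act A x, act_inv_act]
lemma lB_inv_act (A : lG k) (x y : LV k) : lB (A⁻¹ ⊙ x) y = lB x (A ⊙ y) := by
  rw [← lB_act A (A⁻¹ ⊙ x), act_inv_act]

lemma opr_mul (A B : lG k) : opr (A * B) = opr A * opr B := rfl
lemma opr_one : opr (1 : lG k) = 1 := rfl
lemma opr_inj {A B : lG k} (h : opr A = opr B) : A = B := Subtype.ext (Units.ext h)

lemma lG_ext {A B : lG k} (h : ∀ x : LV k, A ⊙ x = B ⊙ x) : A = B :=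
  opr_inj (ContinuousLinearMap.ext h)

lemma exists_lG (A : LV k →ₗ[ℝ] LV k) (h : ∀ x y, lB (A x) (A y) = lB x y) {a : LV k}
    (ha : a ∈ hyp k) (hA : A a ∈ hyp k) : ∃ g : lG k, ∀ x, g ⊙ x = A x := by
  have inj : Function.Injective A := by
    rw [← LinearMap.ker_eq_bot, LinearMap.ker_eq_bot']
    intro v hv
    apply lB_nondeg
    intro w
    rw [← h, hv, lB_zero_left]
  let e := (LinearEquiv.ofInjectiveEndo A inj).toContinuousLinearEquiv
  have he : ∀ x, e x = A x := fun x => rfl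
  let u : (LV k →L[ℝ] LV k)ˣ :=
    ⟨e, e.symm, ContinuousLinearMap.ext fun x => e.apply_symm_apply x,
      ContinuousLinearMap.ext fun x => e.symm_apply_apply x⟩
  have hu : ∀ x, u.1 x = A x := fun x => rfl
  refine ⟨⟨u, fun x y => by rw [hu, hu, h], fun x => ?_⟩, fun x => rfl⟩
  rw [hu]
  constructor
  · intro hx
    apply mem_hyp_of (b := A a) (by rw [h]; exact hx.1) hA
    rw [h]; linarith [one_le_lB hx ha]
  · intro hx
    apply mem_hyp_of (b := a) (by rw [← h]; exact hx.1) ha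
    rw [← h]; linarith [one_le_lB hx hA]

lemma lG_ext_orth {v w : LV k} (h : ∀ z, lB v z = lB w z) : v = w := by
  rw [← sub_eq_zero]; apply lB_nondeg; intro z; rw [lB_sub_left, h, sub_self]

lemma exists_refl {a b : LV k} (ha : a ∈ hyp k) (hb : b ∈ hyp k) :
    ∃ g : lG k, g ⊙ a = b ∧ ∀ p, lB p a = lB p b → g ⊙ p = p := by
  by_cases hab : a = b
  · exact ⟨1, by simpa using hab, fun p _ => rfl⟩
  set w := a - b with hw
  have h1 : lB w w = 2 - 2 * lB a b := by
    simp only [hw, lB_sub_left, lB_sub_right, ha.1, hb.1, lB_comm b a]; ring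
  have h2 : lB w w ≠ 0 := by
    intro h; rw [h1] at h; exact hab (eq_of_lB_one ha hb (by linarith))
  let A : LV k →ₗ[ℝ] LV k := LinearMap.id - (lBlin w).smulRight ((2 / lB w w) • w)
  have hA : ∀ v, A v = v - (lB v w * (2 / lB w w)) • w := fun v => by
    change v - (lB v w) • ((2 / lB w w) • w) = _
    rw [smul_smul]
  have hAa : A a = b := by
    rw [hA]
    have : lB a w * (2 / lB w w) = 1 := by
      have : lB a w = 1 - lB a b := by rw [hw, lB_sub_right, ha.1]
      rw [this]; field_simp; rw [h1]; ring
    rw [this, one_smul, hw]; abel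
  obtain ⟨g, hg⟩ := exists_lG A (fun x y => by
    rw [hA, hA]
    simp only [lB_sub_left, lB_sub_right, lB_smul_left, lB_smul_right, lB_comm w y]
    field_simp; ring) ha (by rw [hAa]; exact hb)
  refine ⟨g, by rw [hg, hAa], fun p hp => ?_⟩
  rw [hg, hA, hw, lB_sub_right, hp, sub_self, zero_mul, zero_smul, sub_zero]

/-- unit vector -/
def e0 (k : ℕ) : Euc (k + 1) := EuclideanSpace.single 0 1

lemma inner_e0 (x : Euc (k + 1)) : inner ℝ x (e0 k) = x 0 := by
  simp [e0, EuclideanSpace.inner_single_right]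

lemma inner_e0' (x : Euc (k + 1)) : inner ℝ (e0 k) x = x 0 := by
  rw [real_inner_comm, inner_e0]

lemma e0_zero : (e0 k) 0 = 1 := by simp [e0]

lemma norm_e0 : ‖e0 k‖ = 1 := by simp [e0]

/-- the standard geodesic -/
def geo (s : ℝ) : LV (k + 1) := (Real.sinh s • e0 k, Real.cosh s)

lemma geo_mem (s : ℝ) : (geo s : LV (k + 1)) ∈ hyp (k + 1) := by
  refine ⟨?_, Real.cosh_pos s⟩
  rw [lB_self]; simp only [geo, norm_smul, norm_e0, mul_one, Real.norm_eq_abs, sq_abs]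
  exact Real.cosh_sq_sub_sinh_sq s

lemma geo_zero : (geo 0 : LV (k + 1)) = lo := by
  simp [geo, lo]

lemma exists_transl {x : LV k} (hx : x ∈ hyp k) : ∃ g : lG k, g ⊙ x = lo := by
  obtain ⟨g, hg, -⟩ := exists_refl hx lo_mem
  exact ⟨g, hg⟩

lemma exists_geo {x y : LV (k + 1)} (hx : x ∈ hyp (k + 1)) (hy : y ∈ hyp (k + 1)) :
    ∃ (g : lG (k + 1)) (D : ℝ), 0 ≤ D ∧ g ⊙ x = geo 0 ∧ g ⊙ y = geo D ∧ lB x y = Real.cosh D := by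
  obtain ⟨g, hg, -⟩ := exists_refl hx lo_mem
  have h1 := act_mem g hy
  have h2 := one_le_snd h1
  set D := Real.arcosh ((g ⊙ y).2) with hD
  have hD1 : Real.cosh D = (g ⊙ y).2 := Real.cosh_arcosh h2
  obtain ⟨r, hr, hr2⟩ := exists_refl h1 (geo_mem D)
  refine ⟨r * g, D, Real.arcosh_nonneg h2, ?_, ?_, ?_⟩
  · rw [act_mul, hg, geo_zero]
    apply hr2
    simp [geo, hD1]
  · rw [act_mul, hr]
  · rw [hD1, ← lB_act g, hg]; simp

/-- boosts along the standard geodesic -/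
lemma exists_boost (s : ℝ) : ∃ g : lG (k + 1), (∀ t, g ⊙ geo t = (geo (s + t) : LV (k + 1))) := by
  let A : LV (k + 1) →ₗ[ℝ] LV (k + 1) :=
    { toFun := fun x => (x.1 + ((Real.cosh s - 1) * x.1 0 + Real.sinh s * x.2) • e0 k,
        Real.sinh s * x.1 0 + Real.cosh s * x.2)
      map_add' := by
        intro x y
        ext1
        · simp only [Prod.fst_add, Prod.snd_add, PiLp.add_apply]; module
        · simp only [Prod.fst_add, Prod.snd_add, PiLp.add_apply]; ring
      map_smul' := by
        intro c x
        ext1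
        · simp only [Prod.smul_fst, Prod.smul_snd, PiLp.smul_apply, smul_eq_mul, RingHom.id_apply]
          module
        · simp only [Prod.smul_fst, Prod.smul_snd, PiLp.smul_apply, smul_eq_mul, RingHom.id_apply]
          ring }
  have hA : ∀ x, A x = (x.1 + ((Real.cosh s - 1) * x.1 0 + Real.sinh s * x.2) • e0 k,
        Real.sinh s * x.1 0 + Real.cosh s * x.2) := fun _ => rfl
  have hg : ∀ t, A (geo t) = geo (s + t) := by
    intro t
    rw [hA]
    ext1
    · simp only [geo, PiLp.smul_apply, e0_zero, smul_eq_mul, Real.sinh_add]; module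
    · simp only [geo, PiLp.smul_apply, e0_zero, smul_eq_mul, Real.cosh_add]; ring
  obtain ⟨g, hg'⟩ := exists_lG A (fun x y => by
    rw [hA, hA]
    simp only [lB, inner_add_left, inner_add_right, real_inner_smul_left, real_inner_smul_right,
      inner_e0, inner_e0', e0_zero]
    have := Real.cosh_sq s
    grind) (geo_mem 0) (by rw [hg]; exact geo_mem _)
  exact ⟨g, fun t => by rw [hg', hg]⟩

/-! ### topology of the group -/

lemma norm_opr_le (A : lG k) : ‖opr A‖ ≤ 3 * (A ⊙ (lo : LV k)).2 := by
  have h0 := one_le_snd (act_mem A lo_mem)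
  set K := (A ⊙ (lo : LV k)).2 with hK
  apply ContinuousLinearMap.opNorm_le_bound _ (by linarith)
  intro x
  rw [show opr A x = A ⊙ x from rfl]
  have hp := act_mem A⁻¹ (lo_mem (k := k))
  set p := A⁻¹ ⊙ (lo : LV k) with hpd
  have hp2 : p.2 = K := by
    rw [hK, ← lB_lo, ← lB_lo, hpd, lB_inv_act, lB_comm]
  have h1 : (A ⊙ x).2 = lB x p := by rw [← lB_lo, lB_act_inv]
  have h2 : lB (A ⊙ x) (A ⊙ x) = lB x x := lB_act _ _ _
  rw [lB_self, lB_self] at h2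
  have hn1 : ‖x.1‖ ≤ ‖x‖ := norm_fst_le x
  have hn2 : |x.2| ≤ ‖x‖ := norm_snd_le x
  have h3 : |lB x p| ≤ 2 * ‖x‖ * K := by
    have hpn := hyp_norm hp
    have hp3 : ‖p.1‖ ≤ K := by
      rw [hp2] at hpn
      apply abs_le_of_sq_le_sq' _ (by linarith) |>.2
      linarith
    have := abs_real_inner_le_norm x.1 p.1
    have e1 : |x.2 * p.2| ≤ ‖x‖ * K := by
      rw [abs_mul, hp2, abs_of_nonneg (by linarith : 0 ≤ K)]
      gcongr
    have e2 : ‖x.1‖ * ‖p.1‖ ≤ ‖x‖ * K := by gcongr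
    unfold lB
    have := abs_sub (x.2 * p.2) (inner ℝ x.1 p.1)
    linarith
  have h4 : (A ⊙ x).2 ^ 2 ≤ (2 * ‖x‖ * K) ^ 2 := by
    rw [h1, ← sq_abs]; gcongr
  have h5 : |x.2| ^ 2 ≤ ‖x‖ ^ 2 := by gcongr
  have h6 : ‖x.1‖ ^ 2 ≤ ‖x‖ ^ 2 := by gcongr
  rw [sq_abs] at h5
  have h7 : ‖x‖ ^ 2 ≤ K ^ 2 * ‖x‖ ^ 2 := by nlinarith [sq_nonneg ‖x‖, sq_nonneg (K - 1), mul_nonneg (sq_nonneg ‖x‖) (sub_nonneg.2 h0), mul_nonneg (sq_nonneg ‖x‖) (sub_nonneg.2 (one_le_pow₀ (n := 2) h0))]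
  rw [Prod.norm_def]
  apply max_le
  · apply abs_le_of_sq_le_sq' _ (by positivity) |>.2
    nlinarith [sq_nonneg x.2]
  · apply abs_le_of_sq_le_sq _ (by positivity)
    nlinarith [sq_nonneg x.2]

lemma continuous_opr : Continuous (opr : lG k → LV k →L[ℝ] LV k) :=
  Units.continuous_val.comp continuous_subtype_val

lemma continuous_act : Continuous fun p : lG k × LV k => p.1 ⊙ p.2 :=
  (continuous_opr.comp continuous_fst).clm_apply continuous_snd

lemma continuous_act_left (x : LV k) : Continuous fun A : lG k => A ⊙ x :=
  continuous_act.comp (continuous_id.prodMk continuous_const)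

lemma isClosed_hyp : IsClosed (hyp k) := by
  have : hyp k = {x | lB x x = 1} ∩ {x | 0 ≤ x.2} := by
    ext x
    constructor
    · exact fun h => ⟨h.1, h.2.le⟩
    · exact fun h => ⟨h.1, lt_of_le_of_ne h.2
        (snd_ne_zero_of_timelike (by rw [show lB x x = 1 from h.1]; norm_num)).symm⟩
  rw [this]
  exact (isClosed_eq (lB_continuous.comp (continuous_id.prodMk continuous_id))
    continuous_const).inter (isClosed_le continuous_const continuous_snd)

lemma isClosed_lG : IsClosed (lG k : Set (LV k →L[ℝ] LV k)ˣ) := by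
  have hc : ∀ x : LV k, Continuous fun A : (LV k →L[ℝ] LV k)ˣ => A.1 x := fun x => by
    exact Units.continuous_val.clm_apply continuous_const
  have : (lG k : Set (LV k →L[ℝ] LV k)ˣ) =
      (⋂ x : LV k, ⋂ y : LV k, {A | lB (A.1 x) (A.1 y) = lB x y}) ∩ {A | A.1 (lo : LV k) ∈ hyp k} := by
    ext A
    simp only [mem_inter_iff, mem_iInter, mem_ofPred_eq]
    constructor
    · exact fun h => ⟨h.1, (h.2 _).1 lo_mem⟩
    · intro h
      refine ⟨h.1, fun x => ⟨fun hx => ?_, fun hx => ?_⟩⟩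
      · apply mem_hyp_of (b := A.1 lo) (by rw [h.1]; exact hx.1) h.2
        rw [h.1]; linarith [one_le_lB hx lo_mem]
      · apply mem_hyp_of (b := lo) (by rw [← h.1]; exact hx.1) lo_mem
        rw [← h.1]; linarith [one_le_lB hx h.2]
  rw [this]
  apply IsClosed.inter
  · refine isClosed_iInter fun x => isClosed_iInter fun y => isClosed_eq ?_ continuous_const
    exact lB_continuous.comp ((hc x).prodMk (hc y))
  · exact isClosed_hyp.preimage (hc lo)

lemma isCompact_ball (K : ℝ) : IsCompact {A : lG k | (A ⊙ (lo : LV k)).2 ≤ K} := by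
  have e : IsClosedEmbedding (fun A : lG k =>
      Units.embedProduct (LV k →L[ℝ] LV k) (A : (LV k →L[ℝ] LV k)ˣ)) :=
    Units.isClosedEmbedding_embedProduct.comp isClosed_lG.isClosedEmbedding_subtypeVal
  have hcpt : IsCompact ((Metric.closedBall (0 : LV k →L[ℝ] LV k) (3 * K)) ×ˢ
      (MulOpposite.unop ⁻¹' (Metric.closedBall (0 : LV k →L[ℝ] LV k) (3 * K)))) := by
    have : ProperSpace (LV k →L[ℝ] LV k) := FiniteDimensional.proper ℝ _
    apply (isCompact_closedBall _ _).prod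
    exact (MulOpposite.opHomeomorph.symm.isCompact_preimage).2 (isCompact_closedBall _ _)
  have h2 := e.isCompact_preimage hcpt
  refine h2.of_isClosed_subset ?_ ?_
  · refine isClosed_le ?_ continuous_const
    exact continuous_snd.comp (continuous_act_left lo)
  · intro A hA
    simp only [mem_ofPred_eq] at hA
    have h1 := norm_opr_le A
    have h2 := norm_opr_le A⁻¹
    have h3 : (A⁻¹ ⊙ (lo : LV k)).2 = (A ⊙ (lo : LV k)).2 := by
      rw [← lB_lo, ← lB_lo, lB_inv_act, lB_comm]
    rw [h3] at h2
    simp only [mem_preimage, mem_prod, mem_closedBall, dist_zero_right]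
    exact ⟨le_trans h1 (by linarith), le_trans h2 (by linarith)⟩

instance : LocallyCompactSpace (lG k) := by
  have : ProperSpace (LV k →L[ℝ] LV k) := FiniteDimensional.proper ℝ _
  exact isClosed_lG.isClosedEmbedding_subtypeVal.locallyCompactSpace

instance : SecondCountableTopology (lG k) := by
  have : ProperSpace (LV k →L[ℝ] LV k) := FiniteDimensional.proper ℝ _
  have : SecondCountableTopology (LV k →L[ℝ] LV k)ˣ :=
    Units.isEmbedding_embedProduct.secondCountableTopology
  exact Topology.IsInducing.subtypeVal.secondCountableTopology

end TV

namespace TV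

/-! ### Cross ratios -/

lemma cr_identity {X Y : Type*} [MetricSpace X] [MetricSpace Y] {f : X → Y}
    (hf : PreservesCR f) (hi : Function.Injective f) (x y z w : X) :
    dist (f x) (f z) * dist (f y) (f w) * (dist x w * dist y z) =
      dist x z * dist y w * (dist (f x) (f w) * dist (f y) (f z)) := by
  by_cases h1 : x = w
  · simp [h1]
  by_cases h2 : y = z
  · simp [h2]
  have h := hf x y z w
  unfold crossRatio at h
  have e1 : dist x w ≠ 0 := dist_ne_zero.2 h1
  have e2 : dist y z ≠ 0 := dist_ne_zero.2 h2
  have e3 : dist (f x) (f w) ≠ 0 := dist_ne_zero.2 (hi.ne h1)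
  have e4 : dist (f y) (f z) ≠ 0 := dist_ne_zero.2 (hi.ne h2)
  rwa [div_eq_div_iff (by positivity) (by positivity)] at h

lemma exists_lambda {X Y : Type*} [MetricSpace X] [MetricSpace Y] {f : X → Y}
    (hf : PreservesCR f) (hi : Function.Injective f)
    (h3 : ∀ x y : X, ∃ z, z ≠ x ∧ z ≠ y) :
    ∃ l : X → ℝ, (∀ x, 0 < l x) ∧ ∀ x y, dist (f x) (f y) ^ 2 = l x * l y * dist x y ^ 2 := by
  choose t ht1 ht2 using h3
  let D : X → X → ℝ := fun x y => dist (f x) (f y) / dist x y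
  have hD : ∀ {x y}, x ≠ y → 0 < D x y := fun {x y} h =>
    div_pos (dist_pos.2 (hi.ne h)) (dist_pos.2 h)
  have hDc : ∀ x y, D x y = D y x := fun x y => by simp only [D, dist_comm]
  have key : ∀ {x y z w}, x ≠ z → y ≠ w → x ≠ w → y ≠ z → D x z * D y w = D x w * D y z := by
    intro x y z w a b c d
    have h := cr_identity hf hi x y z w
    have e1 : dist x w ≠ 0 := dist_ne_zero.2 c
    have e2 : dist y z ≠ 0 := dist_ne_zero.2 d
    have e3 : dist x z ≠ 0 := dist_ne_zero.2 a
    have e4 : dist y w ≠ 0 := dist_ne_zero.2 b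
    simp only [D]
    field_simp
    linarith
  let F : X → X → X → ℝ := fun x q r => D x q * D x r / D q r
  have hFs : ∀ x q r, F x q r = F x r q := fun x q r => by
    simp only [F, hDc q r, mul_comm]
  have F1 : ∀ {x q r r'}, x ≠ q → x ≠ r → x ≠ r' → q ≠ r → q ≠ r' → F x q r = F x q r' := by
    intro x q r r' a b c d e
    have := key b e c d
    have h1 := hD d
    have h2 := hD e
    simp only [F]
    rw [div_eq_div_iff h1.ne' h2.ne']
    linear_combination (D x q) * this
  have F2 : ∀ {x q r q' r'}, x ≠ q → x ≠ r → q ≠ r → x ≠ q' → x ≠ r' → q' ≠ r' →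
      F x q r = F x q' r' := by
    intro x q r q' r' a b c a' b' c'
    by_cases h : q = r'
    · subst h
      rw [hFs x q' q]
      exact F1 a b a' c c'.symm
    · rw [F1 a b b' c h, hFs x q r', hFs x q' r']
      exact F1 b' a a' (Ne.symm h) c'.symm
  let l : X → ℝ := fun x => F x (t x x) (t x (t x x))
  have hl : ∀ {x q r}, x ≠ q → x ≠ r → q ≠ r → l x = F x q r := by
    intro x q r a b c
    exact F2 (ht1 x x).symm (ht1 _ _).symm (ht2 _ _).symm a b c
  refine ⟨l, fun x => ?_, fun x y => ?_⟩
  · have h1 := hD (ht1 x x).symm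
    have h2 := hD (ht1 x (t x x)).symm
    have h3 := hD (ht2 x (t x x)).symm
    exact div_pos (mul_pos h1 h2) h3
  · by_cases hxy : x = y
    · simp [hxy]
    have a := (ht1 x y).symm
    have b := (ht2 x y).symm
    rw [hl hxy a b, hl (Ne.symm hxy) b a]
    have h1 := hD hxy
    have h2 := hD a
    have h3 := hD b
    have e : dist x y ≠ 0 := dist_ne_zero.2 hxy
    have : D x y * dist x y = dist (f x) (f y) := by simp only [D]; field_simp
    simp only [F, hDc y x]
    rw [← this]
    field_simp

/-! ### The light cone -/

variable {n : ℕ}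

/-- null lift -/
def hat (x : Sph n) : LV (n + 1) := ((x : Euc (n + 1)), 1)

lemma sph_norm (x : Sph n) : ‖(x : Euc (n + 1))‖ = 1 := x.2

lemma lB_hat (x y : Sph n) : lB (hat x) (hat y) = dist x y ^ 2 / 2 := by
  have h : dist x y ^ 2 = ‖(x : Euc (n + 1)) - y‖ ^ 2 := by rw [Subtype.dist_eq, dist_eq_norm]
  rw [h, norm_sub_sq_real, sph_norm, sph_norm]
  simp only [lB, hat]; ring

lemma lB_hat_self (x : Sph n) : lB (hat x) (hat x) = 0 := by rw [lB_hat]; simp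

lemma lB_hat_pos {x : Sph n} {p : LV (n + 1)} (hp : p ∈ hyp (n + 1)) : 0 < lB (hat x) p := by
  have h1 := hyp_norm hp
  have h2 := real_inner_le_norm (x : Euc (n + 1)) p.1
  rw [sph_norm, one_mul] at h2
  have h3 : ‖p.1‖ < p.2 := by
    apply abs_lt_of_sq_lt_sq' _ hp.2.le |>.2
    linarith
  simp only [lB, hat]; linarith

/-- signed basis points -/
def bpt (i : Fin (n + 1)) : Sph n := ⟨EuclideanSpace.single i 1, by simp [Sph]⟩
def npt (i : Fin (n + 1)) : Sph n := ⟨-EuclideanSpace.single i 1, by simp [Sph]⟩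

lemma lo_eq_hat : (lo : LV (n + 1)) = (1 / 2 : ℝ) • (hat (bpt 0) + hat (npt 0)) := by
  ext1
  · simp [lo, hat, bpt, npt]
  · simp [lo, hat]; norm_num

lemma hat_span : Submodule.span ℝ (range (hat : Sph n → LV (n + 1))) = ⊤ := by
  rw [eq_top_iff]
  have h0 : ∀ x : Sph n, hat x ∈ Submodule.span ℝ (range (hat : Sph n → LV (n + 1))) :=
    fun x => Submodule.subset_span ⟨x, rfl⟩
  have h1 : (lo : LV (n + 1)) ∈ Submodule.span ℝ (range (hat : Sph n → LV (n + 1))) := by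
    rw [lo_eq_hat]
    exact Submodule.smul_mem _ _ (Submodule.add_mem _ (h0 _) (h0 _))
  rintro v -
  have : v = (∑ i, v.1 i • (hat (bpt i) - lo)) + v.2 • lo := by
    ext1
    · simp only [hat, lo, bpt, Prod.fst_add, Prod.fst_sum, Prod.smul_fst, Prod.fst_sub, sub_zero,
        smul_zero, add_zero]
      ext j
      simp [Pi.single_apply]
    · simp [hat, lo, Prod.snd_sum]
  rw [this]
  refine Submodule.add_mem _ (Submodule.sum_mem _ fun i _ => Submodule.smul_mem _ _
    (Submodule.sub_mem _ (h0 _) h1)) (Submodule.smul_mem _ _ h1)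

lemma eq_of_lB_hat {v w : LV (n + 1)} (h : ∀ x : Sph n, lB v (hat x) = lB w (hat x)) : v = w := by
  rw [← sub_eq_zero]
  apply lB_nondeg
  intro z
  have hz : z ∈ Submodule.span ℝ (range (hat : Sph n → LV (n + 1))) := by rw [hat_span]; trivial
  induction hz using Submodule.span_induction with
  | mem x hx => obtain ⟨y, rfl⟩ := hx; rw [lB_sub_left, h, sub_self]
  | zero => exact lB_zero_right _
  | add x y _ _ hx hy => rw [lB_add_right, hx, hy, add_zero]
  | smul c x _ hx => rw [lB_smul_right, hx, mul_zero]

lemma gram_ext {ι : Type*} (v w : ι → LV (n + 1)) (hv : Submodule.span ℝ (range v) = ⊤)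
    (hw : Submodule.span ℝ (range w) = ⊤) (h : ∀ i j, lB (v i) (v j) = lB (w i) (w j)) :
    ∃ A : LV (n + 1) →ₗ[ℝ] LV (n + 1), (∀ i, A (v i) = w i) ∧
      ∀ x y, lB (A x) (A y) = lB x y := by
  let T := Finsupp.linearCombination ℝ v
  let T' := Finsupp.linearCombination ℝ w
  have hT : LinearMap.range T = ⊤ := by rw [Finsupp.range_linearCombination, hv]
  have hT' : LinearMap.range T' = ⊤ := by rw [Finsupp.range_linearCombination, hw]
  have hBB : ∀ c c', lB (T c) (T c') = lB (T' c) (T' c') := by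
    intro c c'
    induction c using Finsupp.induction_linear with
    | zero => simp [lB_zero_left]
    | add f g hf hg => simp only [map_add, lB_add_left, hf, hg]
    | single i a =>
      induction c' using Finsupp.induction_linear with
      | zero => simp [lB_zero_right]
      | add f g hf hg => simp only [map_add, lB_add_right, hf, hg]
      | single j b =>
        simp only [T, T', Finsupp.linearCombination_single, lB_smul_left, lB_smul_right, h]
  have hker : ∀ c, T c = 0 → T' c = 0 := by
    intro c hc
    apply lB_nondeg
    intro z
    have hz : z ∈ LinearMap.range T' := by rw [hT']; trivial
    obtain ⟨c', rfl⟩ := hz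
    rw [← hBB, hc, lB_zero_left]
  obtain ⟨R, hR⟩ := T.exists_rightInverse_of_surjective hT
  have hR' : ∀ x, T (R x) = x := fun x => LinearMap.congr_fun hR x
  have hA : ∀ c, T' (R (T c)) = T' c := by
    intro c
    rw [← sub_eq_zero, ← map_sub]
    apply hker
    rw [map_sub, hR', sub_self]
  refine ⟨T' ∘ₗ R, fun i => ?_, fun x y => ?_⟩
  · have := hA (Finsupp.single i 1)
    simpa [T, T', Finsupp.linearCombination_single] using this
  · simp only [LinearMap.comp_apply]
    rw [← hBB, hR', hR']

/-- `A` implements `f` on the light cone -/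
def Impl (A : lG (n + 1)) (f : Sph n → Sph n) : Prop :=
  ∀ x, ∃ c : ℝ, 0 < c ∧ A ⊙ hat x = c • hat (f x)

lemma sph_third (x y : Sph (n + 1)) : ∃ z, z ≠ x ∧ z ≠ y := by
  by_contra! h
  have ab : (bpt 0 : Sph (n + 1)) ≠ npt 0 := by
    intro e
    have := congrArg (fun z : Sph (n + 1) => (z : Euc (n + 1 + 1)) 0) e
    simp [bpt, npt] at this
    linarith
  have ac : (bpt 0 : Sph (n + 1)) ≠ bpt 1 := by
    intro e
    have := congrArg (fun z : Sph (n + 1) => (z : Euc (n + 1 + 1)) 0) e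
    simp [bpt] at this
  have bc : (npt 0 : Sph (n + 1)) ≠ bpt 1 := by
    intro e
    have := congrArg (fun z : Sph (n + 1) => (z : Euc (n + 1 + 1)) 0) e
    simp [bpt, npt] at this
  generalize (bpt 0 : Sph (n + 1)) = a at *
  generalize (npt 0 : Sph (n + 1)) = b at *
  generalize (bpt 1 : Sph (n + 1)) = c at *
  by_cases ha : a = x
  · exact bc ((h b (fun e => ab (ha.trans e.symm))).trans (h c (fun e => ac (ha.trans e.symm))).symm)
  · by_cases hb : b = x
    · exact ac ((h a ha).trans (h c (fun e => bc (hb.trans e.symm))).symm)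
    · exact ab ((h a ha).trans (h b hb).symm)

lemma exists_impl' (f : Sph n → Sph n) (hs : Function.Surjective f) (l : Sph n → ℝ)
    (hl : ∀ x, 0 < l x) (h : ∀ x y, dist (f x) (f y) ^ 2 = l x * l y * dist x y ^ 2) :
    ∃ A : lG (n + 1), ∀ x, A ⊙ hat x = (l x)⁻¹ • hat (f x) := by
  obtain ⟨A, hA1, hA2⟩ := gram_ext (fun x : Sph n => hat x) (fun x => (l x)⁻¹ • hat (f x))
    hat_span (by
      rw [eq_top_iff, ← hat_span, Submodule.span_le]
      rintro _ ⟨y, rfl⟩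
      obtain ⟨x, rfl⟩ := hs y
      have : hat (f x) = (l x) • ((l x)⁻¹ • hat (f x)) := by
        rw [smul_smul, mul_inv_cancel₀ (hl x).ne', one_smul]
      rw [this]
      exact Submodule.smul_mem _ _ (Submodule.subset_span ⟨x, rfl⟩)) (by
      intro x y
      have := (hl x).ne'
      have := (hl y).ne'
      simp only [lB_smul_left, lB_smul_right, lB_hat, h]
      field_simp)
  obtain ⟨g, hg⟩ := exists_lG A hA2 lo_mem (by
    refine ⟨by rw [hA2]; exact lo_mem.1, ?_⟩
    rw [lo_eq_hat, map_smul, map_add, hA1, hA1]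
    simp only [Prod.smul_snd, Prod.snd_add, hat, smul_eq_mul]
    have := inv_pos.2 (hl (bpt 0))
    have := inv_pos.2 (hl (npt 0))
    positivity)
  exact ⟨g, fun x => (hg _).trans (hA1 x)⟩

lemma exists_impl {f : Sph (n + 1) → Sph (n + 1)} (hf : PreservesCR f)
    (hb : Function.Bijective f) : ∃ A : lG (n + 1 + 1), Impl A f := by
  obtain ⟨l, hl, h⟩ := exists_lambda hf hb.1 sph_third
  obtain ⟨A, hA⟩ := exists_impl' f hb.2 l hl h
  exact ⟨A, fun x => ⟨(l x)⁻¹, inv_pos.2 (hl x), hA x⟩⟩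

lemma act_hat_snd_pos (A : lG (n + 1)) (x : Sph n) : 0 < (A ⊙ hat x).2 := by
  rw [← lB_lo, lB_act_inv]
  exact lB_hat_pos (act_mem _ lo_mem)

lemma act_hat_norm (A : lG (n + 1)) (x : Sph n) : ‖(A ⊙ hat x).1‖ = (A ⊙ hat x).2 := by
  have h : lB (A ⊙ hat x) (A ⊙ hat x) = 0 := by rw [lB_act, lB_hat_self]
  rw [lB_self] at h
  have := act_hat_snd_pos A x
  have h2 : ‖(A ⊙ hat x).1‖ ^ 2 = (A ⊙ hat x).2 ^ 2 := by linarith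
  exact (pow_left_inj₀ (norm_nonneg _) this.le two_ne_zero).1 h2

/-- boundary map of a Lorentz transformation -/
def psi (A : lG (n + 1)) (x : Sph n) : Sph n :=
  ⟨((A ⊙ hat x).2)⁻¹ • (A ⊙ hat x).1, by
    have := act_hat_snd_pos A x
    simp only [Sph, mem_ofPred_eq, norm_smul, act_hat_norm, norm_inv, Real.norm_eq_abs,
      abs_of_pos this]
    field_simp⟩

lemma act_hat (A : lG (n + 1)) (x : Sph n) : A ⊙ hat x = (A ⊙ hat x).2 • hat (psi A x) := by
  have := (act_hat_snd_pos A x).ne'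
  ext1
  · change _ = (A ⊙ hat x).2 • (((A ⊙ hat x).2)⁻¹ • (A ⊙ hat x).1)
    rw [smul_smul, mul_inv_cancel₀ this, one_smul]
  · simp [hat]

lemma psi_impl (A : lG (n + 1)) : Impl A (psi A) :=
  fun x => ⟨_, act_hat_snd_pos A x, act_hat A x⟩

lemma impl_psi {A : lG (n + 1)} {f : Sph n → Sph n} (h : Impl A f) : psi A = f := by
  funext x
  obtain ⟨c, hc, e⟩ := h x
  apply Subtype.ext
  simp only [psi, e]
  simp only [hat, Prod.smul_snd, Prod.smul_fst, smul_eq_mul, mul_one, smul_smul]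
  rw [inv_mul_cancel₀ hc.ne', one_smul]

lemma Impl.mul {A B : lG (n + 1)} {f g : Sph n → Sph n} (hA : Impl A f) (hB : Impl B g) :
    Impl (A * B) (f ∘ g) := by
  intro x
  obtain ⟨c, hc, e⟩ := hB x
  obtain ⟨c', hc', e'⟩ := hA (g x)
  exact ⟨c * c', by positivity, by rw [act_mul, e, act_smul, e', smul_smul]; rfl⟩

lemma psi_mul (A B : lG (n + 1)) : psi (A * B) = psi A ∘ psi B :=
  impl_psi ((psi_impl A).mul (psi_impl B))

lemma psi_one : psi (1 : lG (n + 1)) = id :=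
  impl_psi fun x => ⟨1, one_pos, by simp⟩

lemma hat_continuous : Continuous (hat : Sph n → LV (n + 1)) := by
  unfold hat; fun_prop

lemma psi_continuous : Continuous fun p : lG (n + 1) × Sph n => psi p.1 p.2 := by
  have h : Continuous fun p : lG (n + 1) × Sph n => p.1 ⊙ hat p.2 :=
    continuous_act.comp (continuous_fst.prodMk (hat_continuous.comp continuous_snd))
  refine Continuous.subtype_mk ?_ _
  exact (h.snd.inv₀ fun p => (act_hat_snd_pos p.1 p.2).ne').smul h.fst

/-- boundary homeomorphism -/
def Psi : lG (n + 1) →* (Sph n ≃ₜ Sph n) where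
  toFun A :=
    { toFun := psi A
      invFun := psi A⁻¹
      left_inv := fun x => by
        rw [← Function.comp_apply (f := psi A⁻¹), ← psi_mul, inv_mul_cancel, psi_one]; rfl
      right_inv := fun x => by
        rw [← Function.comp_apply (f := psi A), ← psi_mul, mul_inv_cancel, psi_one]; rfl
      continuous_toFun := psi_continuous.comp (continuous_const.prodMk continuous_id)
      continuous_invFun := psi_continuous.comp (continuous_const.prodMk continuous_id) }
  map_one' := Homeomorph.ext fun x => congrFun psi_one x
  map_mul' A B := Homeomorph.ext fun x => congrFun (psi_mul A B) x

lemma Psi_apply (A : lG (n + 1)) (x : Sph n) : Psi A x = psi A x := rfl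

lemma Psi_continuous : Continuous (Psi : lG (n + 1) → (Sph n ≃ₜ Sph n)) := by
  rw [continuous_induced_rng]
  refine Continuous.prodMk ?_ ?_
  · exact ContinuousMap.continuous_of_continuous_uncurry _ psi_continuous
  · refine ContinuousMap.continuous_of_continuous_uncurry _ ?_
    exact psi_continuous.comp ((continuous_inv.comp continuous_fst).prodMk continuous_snd)

lemma psi_preservesCR (A : lG (n + 1)) : PreservesCR (psi A) := by
  have hd : ∀ x y : Sph n, dist x y ^ 2 =
      (A ⊙ hat x).2 * (A ⊙ hat y).2 * dist (psi A x) (psi A y) ^ 2 := by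
    intro x y
    have h := lB_act A (hat x) (hat y)
    rw [act_hat A x, act_hat A y, lB_smul_left, lB_smul_right, lB_hat, lB_hat] at h
    linarith
  have hd' : ∀ x y : Sph n, dist x y =
      Real.sqrt (A ⊙ hat x).2 * Real.sqrt (A ⊙ hat y).2 * dist (psi A x) (psi A y) := by
    intro x y
    have h1 := act_hat_snd_pos A x
    have h2 := act_hat_snd_pos A y
    rw [← Real.sqrt_sq (dist_nonneg (x := x) (y := y)), hd, Real.sqrt_mul (by positivity),
      Real.sqrt_mul h1.le, Real.sqrt_sq dist_nonneg]
  intro x y z w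
  have h : ∀ x, 0 < Real.sqrt (A ⊙ hat x).2 := fun x => Real.sqrt_pos.2 (act_hat_snd_pos A x)
  have hx := h x
  have hy := h y
  have hz := h z
  have hw := h w
  unfold crossRatio
  rw [hd' x z, hd' y w, hd' x w, hd' y z]
  generalize Real.sqrt (A ⊙ hat x).2 = a at *
  generalize Real.sqrt (A ⊙ hat y).2 = b at *
  generalize Real.sqrt (A ⊙ hat z).2 = c at *
  generalize Real.sqrt (A ⊙ hat w).2 = e at *
  generalize dist (psi A x) (psi A z) = d1
  generalize dist (psi A y) (psi A w) = d2
  generalize dist (psi A x) (psi A w) = d3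
  generalize dist (psi A y) (psi A z) = d4
  rw [show a * c * d1 * (b * e * d2) = (a * b * c * e) * (d1 * d2) by ring,
    show a * e * d3 * (b * c * d4) = (a * b * c * e) * (d3 * d4) by ring,
    mul_div_mul_left _ _ (by positivity)]

lemma Psi_mem (A : lG (n + 1)) : Psi A ∈ MobiusGrp n := psi_preservesCR A

lemma Psi_injective : Function.Injective (Psi : lG (n + 1 + 1) → (Sph (n + 1) ≃ₜ Sph (n + 1))) := by
  rw [injective_iff_map_eq_one]
  intro A hA
  have h1 : ∀ x, psi A x = x := fun x => by rw [← Psi_apply, hA]; rfl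
  have h2 : ∀ x : Sph (n + 1), A ⊙ hat x = (A ⊙ hat x).2 • hat x := fun x => by
    conv_lhs => rw [act_hat, h1]
  have h3 : ∀ x y : Sph (n + 1), x ≠ y → (A ⊙ hat x).2 * (A ⊙ hat y).2 = 1 := by
    intro x y hxy
    have h := lB_act A (hat x) (hat y)
    rw [h2 x, h2 y, lB_smul_left, lB_smul_right, lB_hat] at h
    have : 0 < dist x y ^ 2 := pow_pos (dist_pos.2 hxy) 2
    nlinarith
  have h4 : ∀ x : Sph (n + 1), (A ⊙ hat x).2 = 1 := by
    intro x
    obtain ⟨y, hy, -⟩ := sph_third x x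
    obtain ⟨z, hz, hz'⟩ := sph_third x y
    have a := h3 x y hy.symm
    have b := h3 x z hz.symm
    have c := h3 y z hz'.symm
    have p1 := act_hat_snd_pos A x
    have p2 := act_hat_snd_pos A y
    have p3 := act_hat_snd_pos A z
    generalize (A ⊙ hat x).2 = u at *
    generalize (A ⊙ hat y).2 = v at *
    generalize (A ⊙ hat z).2 = w at *
    have : v = w := by
      apply mul_left_cancel₀ p1.ne'; linarith
    subst this
    have : v = 1 := by nlinarith
    subst this; linarith
  apply lG_ext
  intro v
  apply eq_of_lB_hat
  intro x
  have : hat x = A ⊙ hat x := by rw [h2, h4, one_smul]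
  conv_lhs => rw [this, lB_act]
  simp

/-- the Möbius group is the Lorentz group -/
def mobEquiv : lG (n + 1 + 1) ≃* MobiusGrp (n + 1) :=
  MulEquiv.ofBijective (Psi.codRestrict (MobiusGrp (n + 1)) Psi_mem) (by
    constructor
    · intro A B h
      exact Psi_injective (congrArg Subtype.val h)
    · rintro ⟨f, hf⟩
      obtain ⟨A, hA⟩ := exists_impl (f := f) hf f.bijective
      exact ⟨A, Subtype.ext (Homeomorph.ext fun x => congrFun (impl_psi hA) x)⟩)

lemma mobEquiv_coe (A : lG (n + 1 + 1)) : (mobEquiv A : Sph (n + 1) ≃ₜ Sph (n + 1)) = Psi A := rfl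

lemma isEmbedding_opr {k : ℕ} : IsEmbedding (opr : lG k → LV k →L[ℝ] LV k) :=
  Units.isOpenEmbedding_val.isEmbedding.comp IsEmbedding.subtypeVal

lemma tendsto_clm {ι : Type*} {l : Filter ι} {k : ℕ} {f : ι → LV k →L[ℝ] LV k}
    {g : LV k →L[ℝ] LV k} (h : ∀ x, Tendsto (fun i => f i x) l (𝓝 (g x))) : Tendsto f l (𝓝 g) := by
  let X := {u : LV k → LV k // ∃ φ : LV k →L[ℝ] LV k, ⇑φ = u}
  let F : X → LV k →L[ℝ] LV k := fun u => u.2.choose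
  have hF : ∀ u x, F u x = u.1 x := fun u x => congrFun u.2.choose_spec x
  have hc : Continuous F := continuous_clm_apply.2 fun x => by
    simp only [hF]
    exact (continuous_apply x).comp continuous_subtype_val
  let G : (LV k →L[ℝ] LV k) → X := fun φ => ⟨φ, φ, rfl⟩
  have hFG : ∀ φ, F (G φ) = φ := fun φ => ContinuousLinearMap.ext fun x => hF _ _
  have h2 : Tendsto (fun i => G (f i)) l (𝓝 (G g)) := by
    rw [tendsto_subtype_rng]
    exact tendsto_pi_nhds.2 h
  have h3 := (hc.tendsto (G g)).comp h2
  rw [hFG] at h3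
  refine h3.congr fun i => hFG _

/-- pointwise convergence on the sphere gives convergence in the Lorentz group -/
lemma tendsto_of_pointwise {ι : Type*} {l : Filter ι} {A : ι → lG (n + 1 + 1)}
    {B : lG (n + 1 + 1)} (h : ∀ x, Tendsto (fun i => psi (A i) x) l (𝓝 (psi B x))) :
    Tendsto A l (𝓝 B) := by
  rw [isEmbedding_opr.tendsto_nhds_iff]
  apply tendsto_clm
  intro v
  let c : lG (n + 1 + 1) → Sph (n + 1) → ℝ := fun A x => (A ⊙ hat x).2
  have hc : ∀ (A : lG (n + 1 + 1)) x y, x ≠ y →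
      c A x * c A y = dist x y ^ 2 / dist (psi A x) (psi A y) ^ 2 ∧ psi A x ≠ psi A y := by
    intro A x y hxy
    have h := lB_act A (hat x) (hat y)
    rw [act_hat A x, act_hat A y, lB_smul_left, lB_smul_right, lB_hat, lB_hat] at h
    have h3 : psi A x ≠ psi A y := fun e => hxy ((Psi A).injective e)
    have h4 : dist (psi A x) (psi A y) ≠ 0 := dist_ne_zero.2 h3
    refine ⟨?_, h3⟩
    rw [eq_div_iff (by positivity)]
    simp only [c]; linarith
  have h1 : ∀ x y, x ≠ y → Tendsto (fun i => c (A i) x * c (A i) y) l (𝓝 (c B x * c B y)) := by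
    intro x y hxy
    rw [(hc B x y hxy).1]
    simp only [(hc _ x y hxy).1]
    refine Tendsto.div tendsto_const_nhds (((h x).dist (h y)).pow 2) ?_
    have := dist_ne_zero.2 (hc B x y hxy).2
    positivity
  have hpos : ∀ A x, 0 < c A x := act_hat_snd_pos
  have h2 : ∀ x, Tendsto (fun i => c (A i) x) l (𝓝 (c B x)) := by
    intro x
    obtain ⟨y, hy, -⟩ := sph_third x x
    obtain ⟨z, hz, hz'⟩ := sph_third x y
    have key : ∀ A, c A x = Real.sqrt ((c A x * c A y) * (c A x * c A z) / (c A y * c A z)) := by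
      intro A
      have := hpos A x; have := hpos A y; have := hpos A z
      rw [show (c A x * c A y) * (c A x * c A z) / (c A y * c A z) = c A x ^ 2 by field_simp,
        Real.sqrt_sq (by positivity)]
    refine (tendsto_congr fun i => key (A i)).2 ?_
    rw [key B]
    refine (((h1 x y hy.symm).mul (h1 x z hz.symm)).div (h1 y z hz'.symm) ?_).sqrt
    exact (mul_pos (hpos B y) (hpos B z)).ne'
  have h3 : ∀ x : Sph (n + 1), Tendsto (fun i => A i ⊙ hat x) l (𝓝 (B ⊙ hat x)) := by
    intro x
    refine (tendsto_congr fun i => act_hat (A i) x).2 ?_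
    rw [act_hat B x]
    exact (h2 x).smul ((hat_continuous.tendsto _).comp (h x))
  have hz : v ∈ Submodule.span ℝ (range (hat : Sph (n + 1) → LV (n + 1 + 1))) := by
    rw [hat_span]; trivial
  induction hz using Submodule.span_induction with
  | mem x hx => obtain ⟨y, rfl⟩ := hx; exact h3 y
  | zero => simp only [Function.comp_apply, map_zero]; exact tendsto_const_nhds
  | add x y _ _ hx hy => simp only [map_add, Function.comp_apply] at *; exact hx.add hy
  | smul a x _ hx => simp only [map_smul, Function.comp_apply] at *; exact hx.const_smul a

end TV

namespace TV

/-! ### Discreteness -/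

lemma exists_inj_seq {G X : Type*} [TopologicalSpace X] [FirstCountableTopology X] (a : G → X)
    (x : X) (h : ∀ U ∈ 𝓝 x, {g | a g ∈ U}.Infinite) :
    ∃ u : ℕ → G, Function.Injective u ∧ Tendsto (fun j => a (u j)) atTop (𝓝 x) := by
  obtain ⟨U, hU⟩ := (𝓝 x).exists_antitone_basis
  obtain ⟨f, hf1, hf2⟩ := exists_seq_of_forall_finset_exists (α := ℕ × G)
    (fun p => a p.2 ∈ U p.1) (fun p q => p.1 < q.1 ∧ p.2 ≠ q.2) (by
      classical
      intro s hs
      let N := s.sup Prod.fst + 1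
      have hinf := h (U N) (hU.1.mem_of_mem trivial)
      obtain ⟨g, hg, hg2⟩ := hinf.exists_notMem_finset (s.image Prod.snd)
      refine ⟨(N, g), hg, fun p hp => ⟨?_, ?_⟩⟩
      · exact Nat.lt_succ_of_le (Finset.le_sup (f := Prod.fst) hp)
      · intro e
        exact hg2 (Finset.mem_image.2 ⟨p, hp, e⟩))
  have hm : StrictMono (fun j => (f j).1) := fun i j hij => (hf2 i j hij).1
  refine ⟨fun j => (f j).2, ?_, ?_⟩
  · intro i j hij
    by_contra hne
    rcases lt_or_gt_of_ne hne with h1 | h1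
    · exact (hf2 _ _ h1).2 hij
    · exact (hf2 _ _ h1).2 hij.symm
  · rw [hU.1.tendsto_right_iff]
    intro i _
    filter_upwards [eventually_ge_atTop i] with j hj
    exact hU.2 (hj.trans (hm.id_le j)) (hf1 j)

/-- uniform discreteness of a homomorphism -/
def UDisc {G H : Type*} [Group G] [Group H] [TopologicalSpace H] (σ : G →* H) : Prop :=
  ∃ U ∈ 𝓝 (1 : H), ∀ g, σ g ∈ U → g = 1

lemma UDisc.finite {G H : Type*} [Group G] [Group H] [TopologicalSpace H] [IsTopologicalGroup H]
    {σ : G →* H} (h : UDisc σ) {K : Set H} (hK : IsCompact K) : {g | σ g ∈ K}.Finite := by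
  obtain ⟨U, hU, h1⟩ := h
  have hc : Tendsto (fun p : H × H => p.1⁻¹ * p.2) (𝓝 1 ×ˢ 𝓝 1) (𝓝 1) := by
    have : Continuous fun p : H × H => p.1⁻¹ * p.2 := by fun_prop
    have := this.tendsto (1, 1)
    rwa [nhds_prod_eq, inv_one, one_mul] at this
  obtain ⟨W, hW, hWU⟩ := mem_prod_same_iff.1 (hc hU)
  obtain ⟨t, -, ht⟩ := hK.elim_nhds_subcover (fun c => (fun x => c⁻¹ * x) ⁻¹' W) (fun c _ => by
    have : Continuous fun x : H => c⁻¹ * x := by fun_prop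
    apply this.continuousAt
    simpa using hW)
  have : {g | σ g ∈ K} ⊆ ⋃ c ∈ t, {g | c⁻¹ * σ g ∈ W} := by
    intro g hg
    have := ht hg
    simpa using this
  refine Set.Finite.subset (t.finite_toSet.biUnion fun c _ => ?_) this
  apply Set.Subsingleton.finite
  intro g hg g' hg'
  have := hWU (show ((c⁻¹ * σ g), (c⁻¹ * σ g')) ∈ W ×ˢ W from ⟨hg, hg'⟩)
  simp only [mem_preimage, mul_inv_rev, inv_inv] at this
  have h2 : σ (g⁻¹ * g') ∈ U := by
    rw [map_mul, map_inv]; convert this using 1; group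
  exact (inv_mul_eq_one.1 (h1 _ h2))

lemma udisc_of_finite {G H : Type*} [Group G] [Group H] [TopologicalSpace H] [T1Space H]
    {σ : G →* H} (hi : Function.Injective σ) (h : ∃ U ∈ 𝓝 (1 : H), {g | σ g ∈ U}.Finite) :
    UDisc σ := by
  obtain ⟨U, hU, hf⟩ := h
  refine ⟨U \ (σ '' ({g | σ g ∈ U} \ {1})), ?_, ?_⟩
  · rw [diff_eq]
    apply inter_mem hU
    apply IsOpen.mem_nhds
    · exact ((hf.diff).image σ).isClosed.isOpen_compl
    · rintro ⟨g, ⟨_, hg⟩, hg2⟩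
      exact hg (hi (by rw [hg2, map_one]))
  · rintro g ⟨hg1, hg2⟩
    by_contra hne
    exact hg2 ⟨g, ⟨hg1, hne⟩, rfl⟩

/-! ### Lattices in the Lorentz group -/

structure IsLat {G : Type*} [Group G] {k : ℕ} (A : G →* lG k) : Prop where
  fin : ∀ R : ℝ, {g | (A g ⊙ lo).2 ≤ R}.Finite
  free : ∀ g, g ≠ 1 → ∀ x ∈ hyp k, A g ⊙ x ≠ x
  cocpt : ∃ R : ℝ, ∀ x ∈ hyp k, ∃ g, (A g ⊙ x).2 ≤ R

variable {n : ℕ}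

/-- ball model to hyperboloid -/
def bv {k : ℕ} (x : Euc k) : LV k := (1 - ‖x‖ ^ 2)⁻¹ • ((2 : ℝ) • x, 1 + ‖x‖ ^ 2)

lemma bv_mem {k : ℕ} {x : Euc k} (hx : ‖x‖ < 1) : bv x ∈ hyp k := by
  have h1 : 0 < 1 - ‖x‖ ^ 2 := by nlinarith [norm_nonneg x]
  refine ⟨?_, ?_⟩
  · rw [lB_self]
    simp only [bv, Prod.smul_fst, Prod.smul_snd, norm_smul, smul_eq_mul, norm_inv,
      Real.norm_eq_abs, abs_of_pos h1, abs_two]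
    field_simp
    ring
  · simp only [bv, Prod.smul_snd, smul_eq_mul]
    positivity

lemma bv_surj {k : ℕ} {p : LV k} (hp : p ∈ hyp k) :
    ‖(1 + p.2)⁻¹ • p.1‖ < 1 ∧ bv ((1 + p.2)⁻¹ • p.1) = p := by
  have h1 := hyp_norm hp
  have h2 := hp.2
  have h3 : ‖(1 + p.2)⁻¹ • p.1‖ ^ 2 = (p.2 - 1) / (p.2 + 1) := by
    rw [norm_smul, mul_pow, h1, norm_inv, Real.norm_eq_abs, abs_of_pos (by linarith)]
    field_simp; ring
  have h4 : 1 - (p.2 - 1) / (p.2 + 1) = 2 / (p.2 + 1) := by field_simp; ring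
  constructor
  · have : ‖(1 + p.2)⁻¹ • p.1‖ ^ 2 < 1 := by
      have : 0 < 2 / (p.2 + 1) := by positivity
      linarith
    nlinarith [norm_nonneg ((1 + p.2)⁻¹ • p.1)]
  · ext1
    · simp only [bv, h3, h4, Prod.smul_fst, smul_smul]
      convert one_smul ℝ p.1 using 2
      field_simp; ring
    · simp only [bv, h3, h4, Prod.smul_snd, smul_eq_mul]
      field_simp; ring

lemma bv_inv {k : ℕ} {x : Euc k} (hx : ‖x‖ < 1) : (1 + (bv x).2)⁻¹ • (bv x).1 = x := by
  have h1 : 0 < 1 - ‖x‖ ^ 2 := by nlinarith [norm_nonneg x]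
  simp only [bv, Prod.smul_snd, Prod.smul_fst, smul_smul, smul_eq_mul]
  convert one_smul ℝ x using 2
  have : 1 + (1 - ‖x‖ ^ 2)⁻¹ * (1 + ‖x‖ ^ 2) ≠ 0 := by positivity
  field_simp; ring

lemma lB_bv_hat {x : Euc (n + 1)} (hx : ‖x‖ < 1) (y : Sph n) :
    lB (bv x) (hat y) = (1 - ‖x‖ ^ 2)⁻¹ * dist x (y : Euc (n + 1)) ^ 2 := by
  have h : dist x (y : Euc (n + 1)) ^ 2 = ‖x - y‖ ^ 2 := by rw [dist_eq_norm]
  rw [h, norm_sub_sq_real, sph_norm, bv, lB_smul_left]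
  simp only [lB, hat, real_inner_smul_left]; ring

/-- sphere inside the ball -/
def sb (x : Sph n) : CBall (n + 1) := ⟨x, le_of_eq x.2⟩

lemma impl_unique {A B : lG (n + 1 + 1)} {f : Sph (n + 1) → Sph (n + 1)} (hA : Impl A f)
    (hB : Impl B f) : A = B := by
  apply Psi_injective
  apply Homeomorph.ext
  intro x
  rw [Psi_apply, Psi_apply, impl_psi hA, impl_psi hB]

section
variable (Γ : UniformHypLattice (n + 1 + 1))

lemma int_lt (g : Γ.grp) {x : CBall (n + 1 + 1)} (hx : ‖(x : Euc (n + 1 + 1))‖ < 1) :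
    ‖((g : CBall (n + 1 + 1) ≃ₜ CBall (n + 1 + 1)) x : Euc (n + 1 + 1))‖ < 1 := by
  refine lt_of_le_of_ne (((g : CBall (n + 1 + 1) ≃ₜ CBall (n + 1 + 1)) x).2) fun h => ?_
  have := Γ.sphere_inv _ (g⁻¹).2 _ h
  have e : ((g⁻¹ : Γ.grp) : CBall (n + 1 + 1) ≃ₜ CBall (n + 1 + 1))
      ((g : CBall (n + 1 + 1) ≃ₜ CBall (n + 1 + 1)) x) = x :=
    (g : CBall (n + 1 + 1) ≃ₜ CBall (n + 1 + 1)).symm_apply_apply x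
  rw [e] at this
  exact hx.ne this

lemma bdry_mul (g h : Γ.grp) : Γ.bdry (g * h) = Γ.bdry g ∘ Γ.bdry h := rfl
lemma bdry_one : Γ.bdry 1 = id := rfl

lemma cball_third (x y : CBall (n + 1 + 1)) : ∃ z, z ≠ x ∧ z ≠ y := by
  obtain ⟨a, -, -⟩ := sph_third (n := n) (bpt 0) (bpt 0)
  obtain ⟨b, hb, -⟩ := sph_third a a
  obtain ⟨c, hc, hc'⟩ := sph_third a b
  have inj : ∀ u v : Sph (n + 1), sb u = sb v → u = v := fun u v h =>
    Subtype.ext (congrArg (fun z : CBall (n + 1 + 1) => (z : Euc (n + 1 + 1))) h)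
  by_contra! h
  by_cases ha : sb a = x
  · have h1 := h (sb b) (fun e => hb (inj _ _ (e.trans ha.symm)))
    have h2 := h (sb c) (fun e => hc (inj _ _ (e.trans ha.symm)))
    exact hc' (inj _ _ (h2.trans h1.symm))
  · have h1 := h _ ha
    by_cases hb2 : sb b = x
    · have h2 := h (sb c) (fun e => hc' (inj _ _ (e.trans hb2.symm)))
      exact hc (inj _ _ (h2.trans h1.symm))
    · exact hb (inj _ _ ((h _ hb2).trans h1.symm))

lemma bdry_eq (g : Γ.grp) (x : Sph (n + 1)) :
    sb (Γ.bdry g x) = (g : CBall (n + 1 + 1) ≃ₜ CBall (n + 1 + 1)) (sb x) := rfl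

lemma exists_lat_elt (g : Γ.grp) : ∃ A : lG (n + 1 + 1), Impl A (Γ.bdry g) ∧
    ∀ x : CBall (n + 1 + 1), ‖(x : Euc (n + 1 + 1))‖ < 1 →
      A ⊙ bv (x : Euc (n + 1 + 1)) = bv ((g : CBall (n + 1 + 1) ≃ₜ CBall (n + 1 + 1)) x : Euc (n + 1 + 1)) := by
  obtain ⟨l, hl, h⟩ := exists_lambda (Γ.mobius g g.2)
    (g : CBall (n + 1 + 1) ≃ₜ CBall (n + 1 + 1)).injective cball_third
  have hs : Function.Surjective (Γ.bdry g) := fun y => ⟨Γ.bdry g⁻¹ y, by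
    rw [← Function.comp_apply (f := Γ.bdry g), ← bdry_mul, mul_inv_cancel]; rfl⟩
  obtain ⟨A, hA⟩ := exists_impl' (Γ.bdry g) hs (fun x => l (sb x)) (fun x => hl _)
    (fun x y => h (sb x) (sb y))
  refine ⟨A, fun x => ⟨_, inv_pos.2 (hl _), hA x⟩, fun x hx => ?_⟩
  have hgx := int_lt Γ g hx
  set gx := (g : CBall (n + 1 + 1) ≃ₜ CBall (n + 1 + 1)) x with hgxd
  have p1 : 0 < 1 - ‖(x : Euc (n + 1 + 1))‖ ^ 2 := by nlinarith [norm_nonneg (x : Euc (n + 1 + 1))]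
  have p2 : 0 < 1 - ‖(gx : Euc (n + 1 + 1))‖ ^ 2 := by
    nlinarith [norm_nonneg (gx : Euc (n + 1 + 1))]
  let c := l x * (1 - ‖(x : Euc (n + 1 + 1))‖ ^ 2) / (1 - ‖(gx : Euc (n + 1 + 1))‖ ^ 2)
  have hc : 0 < c := div_pos (mul_pos (hl x) p1) p2
  have key : A⁻¹ ⊙ bv (gx : Euc (n + 1 + 1)) = c • bv (x : Euc (n + 1 + 1)) := by
    apply eq_of_lB_hat
    intro y
    rw [lB_inv_act, hA, lB_smul_right, lB_smul_left, lB_bv_hat hgx, lB_bv_hat hx]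
    have h1 := h x (sb y)
    have h2 : dist (gx : Euc (n + 1 + 1)) (Γ.bdry g y : Euc (n + 1 + 1)) ^ 2 =
      l x * l (sb y) * dist (x : Euc (n + 1 + 1)) (y : Euc (n + 1 + 1)) ^ 2 := h1
    rw [h2]
    have := hl (sb y)
    simp only [c]
    field_simp
  have hc1 : c = 1 := by
    have h1 := (act_mem A⁻¹ (bv_mem hgx)).1
    rw [key, lB_smul_left, lB_smul_right, (bv_mem hx).1] at h1
    nlinarith
  rw [hc1, one_smul] at key
  rw [← key, act_inv_act]

/-- the lattice inside the Lorentz group -/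
def latHom : Γ.grp →* lG (n + 1 + 1) where
  toFun g := (exists_lat_elt Γ g).choose
  map_one' := impl_unique (exists_lat_elt Γ 1).choose_spec.1 fun x => ⟨1, one_pos, by
    rw [bdry_one]; simp⟩
  map_mul' g h := impl_unique (exists_lat_elt Γ (g * h)).choose_spec.1
    ((exists_lat_elt Γ g).choose_spec.1.mul (exists_lat_elt Γ h).choose_spec.1)

lemma latHom_impl (g : Γ.grp) : Impl (latHom Γ g) (Γ.bdry g) := (exists_lat_elt Γ g).choose_spec.1
lemma latHom_bv (g : Γ.grp) {x : CBall (n + 1 + 1)} (hx : ‖(x : Euc (n + 1 + 1))‖ < 1) :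
    latHom Γ g ⊙ bv (x : Euc (n + 1 + 1)) =
      bv ((g : CBall (n + 1 + 1) ≃ₜ CBall (n + 1 + 1)) x : Euc (n + 1 + 1)) :=
  (exists_lat_elt Γ g).choose_spec.2 x hx

lemma latHom_tendsto {u : ℕ → Γ.grp}
    (h : Tendsto (fun j => latHom Γ (u j)) atTop (𝓝 1)) (x : CBall (n + 1 + 1)) :
    Tendsto (fun j => (u j : CBall (n + 1 + 1) ≃ₜ CBall (n + 1 + 1)) x) atTop (𝓝 x) := by
  rw [tendsto_subtype_rng]
  by_cases hx : ‖(x : Euc (n + 1 + 1))‖ < 1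
  · have h1 : ∀ j, ((u j : CBall (n + 1 + 1) ≃ₜ CBall (n + 1 + 1)) x : Euc (n + 1 + 1)) =
        (fun p : LV (n + 1 + 1) => (1 + p.2)⁻¹ • p.1) (latHom Γ (u j) ⊙ bv (x : Euc (n + 1 + 1))) := by
      intro j
      rw [latHom_bv Γ _ hx]
      exact (bv_inv (int_lt Γ _ hx)).symm
    refine (tendsto_congr h1).2 ?_
    have h2 : Tendsto (fun j => latHom Γ (u j) ⊙ bv (x : Euc (n + 1 + 1))) atTop
        (𝓝 (bv (x : Euc (n + 1 + 1)))) :=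
      ((continuous_act_left (bv (x : Euc (n + 1 + 1)))).tendsto 1).comp h
    have h3 : ContinuousAt (fun p : LV (n + 1 + 1) => (1 + p.2)⁻¹ • p.1)
        (bv (x : Euc (n + 1 + 1))) := by
      have := (bv_mem hx).2
      have a : ContinuousAt (fun p : LV (n + 1 + 1) => (1 + p.2))
        (bv (x : Euc (n + 1 + 1))) := by fun_prop
      have b : ContinuousAt (fun p : LV (n + 1 + 1) => p.1)
        (bv (x : Euc (n + 1 + 1))) := by fun_prop
      exact (a.inv₀ (by positivity)).smul b
    have h4 := h3.tendsto.comp h2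
    simp only [bv_inv hx] at h4
    exact h4
  · have hx1 : ‖(x : Euc (n + 1 + 1))‖ = 1 := le_antisymm x.2 (not_lt.1 hx)
    let y : Sph (n + 1) := ⟨x, hx1⟩
    have h1 : ∀ j, ((u j : CBall (n + 1 + 1) ≃ₜ CBall (n + 1 + 1)) x : Euc (n + 1 + 1)) =
        (psi (latHom Γ (u j)) y : Euc (n + 1 + 1)) := fun j => by
      rw [impl_psi (latHom_impl Γ (u j))]; rfl
    refine (tendsto_congr h1).2 ?_
    have h2 : Continuous fun A : lG (n + 1 + 1) => (psi A y : Euc (n + 1 + 1)) :=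
      continuous_subtype_val.comp (psi_continuous.comp (continuous_id.prodMk continuous_const))
    have h3 := (h2.tendsto 1).comp h
    rw [psi_one] at h3
    exact h3

lemma latHom_injective : Function.Injective (latHom Γ) := by
  rw [injective_iff_map_eq_one]
  intro g hg
  apply Subtype.ext
  apply Homeomorph.ext
  intro x
  have := latHom_tendsto Γ (u := fun _ => g) (by rw [hg]; exact tendsto_const_nhds) x
  exact tendsto_nhds_unique tendsto_const_nhds this

lemma latHom_udisc : UDisc (latHom Γ) := by
  apply udisc_of_finite (latHom_injective Γ)
  by_contra! h
  obtain ⟨u, hu, hu2⟩ := exists_inj_seq (latHom Γ) 1 h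
  exact Γ.discrete ⟨u, hu, latHom_tendsto Γ hu2⟩

lemma latHom_isLat (hfree : ∀ g ∈ Γ.grp, g ≠ 1 → ∀ x : ↥(CBall (n + 1 + 1)), ‖(x : Euc (n + 1 + 1))‖ < 1 →
      (g : ↥(CBall (n + 1 + 1)) ≃ₜ ↥(CBall (n + 1 + 1))) x ≠ x) : IsLat (latHom Γ) := by
  refine ⟨fun R => ?_, fun g hg p hp hgp => ?_, ?_⟩
  · exact (latHom_udisc Γ).finite (isCompact_ball R)
  · obtain ⟨h1, h2⟩ := bv_surj hp
    set x : CBall (n + 1 + 1) := ⟨_, h1.le⟩ with hx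
    have h3 := latHom_bv Γ g (x := x) h1
    refine hfree g g.2 (fun e => hg (Subtype.ext e)) x h1 ?_
    apply Subtype.ext
    have h4 := bv_inv (int_lt Γ g (x := x) h1)
    rw [← h3, show bv (x : Euc (n + 1 + 1)) = p from h2, hgp] at h4
    exact h4.symm
  · obtain ⟨K, hK, hK1, hK2⟩ := Γ.cocompact
    have hc : ContinuousOn (fun x : CBall (n + 1 + 1) => (bv (x : Euc (n + 1 + 1))).2) K := by
      have : ∀ x : CBall (n + 1 + 1), (bv (x : Euc (n + 1 + 1))).2 =
        (1 - ‖(x : Euc (n + 1 + 1))‖ ^ 2)⁻¹ * (1 + ‖(x : Euc (n + 1 + 1))‖ ^ 2) := fun x => rfl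
      simp only [this]
      refine ContinuousOn.mul (ContinuousOn.inv₀ (by fun_prop) fun x hx => ?_) (by fun_prop)
      have := hK1 x hx
      nlinarith [norm_nonneg (x : Euc (n + 1 + 1))]
    obtain ⟨R, hR⟩ := hK.bddAbove_image hc
    refine ⟨R, fun p hp => ?_⟩
    obtain ⟨h1, h2⟩ := bv_surj hp
    obtain ⟨g, hg, hgK⟩ := hK2 ⟨_, h1.le⟩ h1
    refine ⟨⟨g, hg⟩, ?_⟩
    have h3 := latHom_bv Γ ⟨g, hg⟩ (x := ⟨_, h1.le⟩) h1
    simp only [h2] at h3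
    rw [h3]
    exact hR ⟨_, hgK, rfl⟩
end

end TV

namespace TV

section lattice
variable {G : Type*} [Group G] {k : ℕ} {A : G →* lG k}

lemma isCompact_hypball (R : ℝ) : IsCompact {x : LV k | x ∈ hyp k ∧ x.2 ≤ R} := by
  apply Metric.isCompact_of_isClosed_isBounded
  · exact isClosed_hyp.inter (isClosed_le continuous_snd continuous_const)
  · refine (Metric.isBounded_closedBall (x := (0 : LV k)) (r := R)).subset ?_
    rintro x ⟨hx, hR⟩
    rw [mem_closedBall_zero_iff, Prod.norm_def, max_le_iff]
    have h1 := hyp_norm hx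
    have h2 := one_le_snd hx
    constructor
    · refine (abs_le_of_sq_le_sq' (a := ‖x.1‖) (b := R) ?_ (by linarith)).2
      nlinarith
    · rw [Real.norm_eq_abs, abs_of_pos hx.2]; exact hR

lemma IsLat.exists_min (hA : IsLat A) (g : G) :
    ∃ x ∈ hyp k, ∀ y ∈ hyp k, lB x (A g ⊙ x) ≤ lB y (A g ⊙ y) := by
  obtain ⟨R0, hR0⟩ := hA.cocpt
  set R := max R0 1
  set M := lB (lo : LV k) (A g ⊙ lo)
  set Z := {x : LV k | x ∈ hyp k ∧ x.2 ≤ R}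
  have hZ : IsCompact Z := isCompact_hypball R
  have hZn : Z.Nonempty := ⟨lo, lo_mem, le_max_right _ _⟩
  set T := {h : G | (A h ⊙ (lo : LV k)).2 ≤ 4 * R ^ 2 * M} ∩ {h | ∃ c, h = c * g * c⁻¹}
  have hT : T.Finite := (hA.fin _).inter_of_left _
  have hM : 1 ≤ M := one_le_lB lo_mem (act_mem _ lo_mem)
  have hR1 : 1 ≤ R := le_max_right _ _
  have hTn : T.Nonempty := by
    refine ⟨g, ?_, 1, by simp⟩
    have : (A g ⊙ (lo : LV k)).2 = M := by simp only [M]; rw [lB_comm]; simp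
    rw [Set.mem_ofPred_eq, this]
    have : 1 ≤ R ^ 2 := by nlinarith
    nlinarith
  have hc : ∀ h : G, ∃ y ∈ Z, ∀ y' ∈ Z, lB y (A h ⊙ y) ≤ lB y' (A h ⊙ y') := fun h => by
    have hcont : Continuous (fun y => lB y (A h ⊙ y)) :=
      lB_continuous.comp (continuous_id.prodMk (opr (A h)).continuous)
    obtain ⟨y, h1, h2⟩ := hZ.exists_isMinOn hZn hcont.continuousOn
    exact ⟨y, h1, fun y' hy' => h2 hy'⟩
  choose Y hY hYm using hc
  obtain ⟨h, hhT, hh⟩ := Set.exists_min_image T (fun h => lB (Y h) (A h ⊙ Y h)) hT hTn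
  obtain ⟨-, c, rfl⟩ := hhT
  refine ⟨(A c)⁻¹ ⊙ Y (c * g * c⁻¹), act_mem _ (hY _).1, fun y hy => ?_⟩
  have e : lB ((A c)⁻¹ ⊙ Y (c * g * c⁻¹)) (A g ⊙ (A c)⁻¹ ⊙ Y (c * g * c⁻¹)) =
      lB (Y (c * g * c⁻¹)) (A (c * g * c⁻¹) ⊙ Y (c * g * c⁻¹)) := by
    rw [lB_inv_act]; simp
  rw [e]
  have hg : g ∈ T := by
    refine ⟨?_, 1, by simp⟩
    have : (A g ⊙ (lo : LV k)).2 = M := by simp only [M]; rw [lB_comm]; simp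
    rw [Set.mem_ofPred_eq, this]
    have : 1 ≤ R ^ 2 := by nlinarith
    nlinarith
  by_cases hV : M < lB y (A g ⊙ y)
  · refine ((hh g hg).trans (hYm g lo ⟨lo_mem, hR1⟩)).trans hV.le
  · push Not at hV
    obtain ⟨b, hb⟩ := hR0 y hy
    have hb' : A b ⊙ y ∈ Z := ⟨act_mem _ hy, hb.trans (le_max_left _ _)⟩
    have e2 : lB (A b ⊙ y) (A (b * g * b⁻¹) ⊙ (A b ⊙ y)) = lB y (A g ⊙ y) := by
      simp
    have hbT : b * g * b⁻¹ ∈ T := by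
      refine ⟨?_, b, rfl⟩
      set x := A b ⊙ y
      set q := A (b * g * b⁻¹)
      have h1 : (q ⊙ (lo : LV k)).2 = lB lo (q ⊙ lo) := by rw [lB_comm]; simp
      have h2 : lB lo (q ⊙ lo) ≤ 2 * lB lo x * lB x (q ⊙ lo) :=
        quasi_triangle lo_mem hb'.1 (act_mem _ lo_mem)
      have h3 : lB x (q ⊙ lo) ≤ 2 * lB x (q ⊙ x) * lB (q ⊙ x) (q ⊙ lo) :=
        quasi_triangle hb'.1 (act_mem _ hb'.1) (act_mem _ lo_mem)
      have h4 : lB lo x = x.2 := by rw [lB_comm]; simp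
      have h5 : lB (q ⊙ x) (q ⊙ lo) = x.2 := by simp
      have h6 := one_le_snd hb'.1
      have h7 := hb'.2
      rw [e2, h5] at h3
      rw [h4] at h2
      rw [Set.mem_ofPred_eq, h1]
      have h8 := one_le_lB hy (act_mem (A g) hy)
      have : 2 * lB y (A g ⊙ y) * x.2 ≤ 2 * M * R := by gcongr
      have h9 : 0 ≤ lB x (q ⊙ lo) := by linarith [one_le_lB hb'.1 (act_mem q lo_mem)]
      calc _ ≤ 2 * x.2 * lB x (q ⊙ lo) := h2
        _ ≤ 2 * R * (2 * M * R) := by gcongr; exact h3.trans this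
        _ = _ := by ring
    have := (hh _ hbT).trans (hYm _ _ hb')
    rwa [e2] at this

/-- axis data of a hyperbolic element -/
def Axis (g : lG k) (l : ℝ) (p m : LV k) : Prop :=
  1 < l ∧ g ⊙ p = l • p ∧ g ⊙ m = l⁻¹ • m ∧ 0 < lB p m

lemma IsLat.exists_axis (hA : IsLat A) {g : G} (hg : g ≠ 1) :
    ∃ l p m, Axis (A g) l p m := by
  obtain ⟨x, hx, hmin⟩ := hA.exists_min g
  set a := A g
  set μ := lB x (a ⊙ x) with hμ
  have h1 : 1 ≤ μ := one_le_lB hx (act_mem _ hx)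
  have h1' : 1 < μ := by
    refine lt_of_le_of_ne h1 fun h => ?_
    have := eq_of_lB_one hx (act_mem a hx) h.symm
    exact hA.free g hg x hx this.symm
  have hmid := hmin _ (mid_mem hx (act_mem a hx))
  set ν := lB x (a ⊙ a ⊙ x) with hν
  have e1 : lB (a ⊙ x) x = μ := lB_comm _ _
  have hsq : Real.sqrt (2 + 2 * μ) ^ 2 = 2 + 2 * μ := Real.sq_sqrt (by linarith)
  have hs : 0 < Real.sqrt (2 + 2 * μ) := Real.sqrt_pos.2 (by linarith)
  have hν' : 2 * μ ^ 2 - 1 ≤ ν := by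
    have : lB (mid x (a ⊙ x)) (a ⊙ mid x (a ⊙ x)) = (2 * μ + ν + 1) / (2 + 2 * μ) := by
      simp only [mid, act_smul, act_add, lB_smul_left, lB_smul_right, lB_add_left, lB_add_right,
        lB_act, hx.1, ← hμ, ← hν]
      set s := Real.sqrt (2 + 2 * μ)
      rw [← hsq]; field_simp; ring
    rw [this, le_div_iff₀ (by linarith)] at hmid
    nlinarith
  have f1 : lB x (a⁻¹ ⊙ x) = μ := by rw [← lB_act_inv, e1]
  have f2 : lB (a⁻¹ ⊙ x) (a ⊙ x) = ν := by rw [lB_inv_act]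
  have hz : a ⊙ x + a⁻¹ ⊙ x - (2 * μ) • x = 0 := by
    apply lB_orth_eq (x := x) (by rw [hx.1]; norm_num)
    · simp only [lB_add_left, lB_sub_left, lB_smul_left, hx.1, e1, lB_comm (a⁻¹ ⊙ x) x, f1]; ring
    · have : lB (a ⊙ x + a⁻¹ ⊙ x - (2 * μ) • x) (a ⊙ x + a⁻¹ ⊙ x - (2 * μ) • x) =
          2 + 2 * ν - 4 * μ ^ 2 := by
        simp only [lB_add_left, lB_sub_left, lB_smul_left, lB_add_right, lB_sub_right,
          lB_smul_right, lB_act, hx.1, e1, lB_comm (a⁻¹ ⊙ x) x, f1, f2, lB_comm (a ⊙ x) (a⁻¹ ⊙ x),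
          ← hμ]
        ring
      rw [this]; linarith
  have haa : a ⊙ a ⊙ x = (2 * μ) • (a ⊙ x) - x := by
    have := congrArg (fun y => a ⊙ y) hz
    simp only [act_add, act_sub, act_smul, act_inv_act] at this
    have h0 : a ⊙ (0 : LV k) = 0 := map_zero (opr a)
    rw [h0] at this
    rw [← sub_eq_zero, ← this]; abel
  set t := Real.sqrt (μ ^ 2 - 1) with ht
  have ht2 : t ^ 2 = μ ^ 2 - 1 := Real.sq_sqrt (by nlinarith)
  have htpos : 0 < t := Real.sqrt_pos.2 (by nlinarith)
  have hl : (μ + t)⁻¹ = μ - t := by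
    rw [inv_eq_one_div, div_eq_iff (by positivity)]; nlinarith
  refine ⟨μ + t, a ⊙ x - (μ - t) • x, (μ + t) • x - a ⊙ x, by linarith, ?_, ?_, ?_⟩
  · rw [act_sub, act_smul, haa]
    have : (1 : ℝ) = (μ + t) * (μ - t) := by nlinarith
    calc (2 * μ) • a ⊙ x - x - (μ - t) • a ⊙ x
        = (2 * μ) • a ⊙ x - (1 : ℝ) • x - (μ - t) • a ⊙ x := by rw [one_smul]
      _ = _ := by rw [this]; module
  · rw [act_sub, act_smul, haa, hl]
    have : (1 : ℝ) = (μ + t) * (μ - t) := by nlinarith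
    calc (μ + t) • a ⊙ x - ((2 * μ) • a ⊙ x - x)
        = (μ + t) • a ⊙ x - ((2 * μ) • a ⊙ x - (1 : ℝ) • x) := by rw [one_smul]
      _ = _ := by rw [this]; module
  · simp only [lB_sub_left, lB_sub_right, lB_smul_left, lB_smul_right, lB_act, hx.1, e1, ← hμ]
    nlinarith

namespace Axis
variable {g h c : lG k} {l : ℝ} {p m : LV k}

lemma pp (H : Axis g l p m) : lB p p = 0 := by
  obtain ⟨h1, h2, h3, h4⟩ := H
  have := lB_act g p p
  rw [h2, lB_smul_left, lB_smul_right] at this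
  by_contra h
  have : l * l = 1 := mul_right_cancel₀ h (by linarith)
  nlinarith

lemma mm (H : Axis g l p m) : lB m m = 0 := by
  obtain ⟨h1, h2, h3, h4⟩ := H
  have := lB_act g m m
  rw [h3, lB_smul_left, lB_smul_right] at this
  by_contra h
  have e : l⁻¹ * l⁻¹ = 1 := mul_right_cancel₀ h (by linarith)
  have : l⁻¹ < 1 := inv_lt_one_of_one_lt₀ h1
  have : 0 < l⁻¹ := by positivity
  nlinarith

lemma timelike (H : Axis g l p m) {t : ℝ} (ht : 0 < t) : 0 < lB (p + t • m) (p + t • m) := by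
  have h4 := H.2.2.2
  simp only [lB_add_left, lB_add_right, lB_smul_left, lB_smul_right, H.pp, H.mm, lB_comm m p]
  nlinarith [mul_pos ht h4]

lemma eq_zero (H : Axis g l p m) {w : LV k} (h1 : lB w p = 0) (h2 : lB w m = 0)
    (h3 : lB w w = 0) : w = 0 := by
  apply lB_orth_eq (H.timelike one_pos) _ h3.ge
  rw [one_smul, lB_add_right, h1, h2, add_zero]

lemma eig_p (H : Axis g l p m) {w : LV k} (hw : g ⊙ w = l • w) : ∃ c : ℝ, w = c • p := by
  obtain ⟨h1, h2, h3, h4⟩ := id H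
  have ll : 1 < l * l := by nlinarith
  have a1 := lB_act g w p
  have a2 := lB_act g w w
  rw [hw, h2, lB_smul_left, lB_smul_right] at a1
  rw [hw, lB_smul_left, lB_smul_right] at a2
  have b1 : lB w p = 0 := by
    by_contra h
    have : l * l = 1 := mul_right_cancel₀ h (by linarith)
    linarith
  have b2 : lB w w = 0 := by
    by_contra h
    have : l * l = 1 := mul_right_cancel₀ h (by linarith)
    linarith
  refine ⟨lB w m / lB p m, ?_⟩
  rw [← sub_eq_zero]
  apply H.eq_zero
  · rw [lB_sub_left, lB_smul_left, H.pp, b1]; ring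
  · rw [lB_sub_left, lB_smul_left]; field_simp; ring
  · simp only [lB_sub_left, lB_smul_left, lB_sub_right, lB_smul_right, H.pp, b1, b2,
      lB_comm p w]; ring

lemma inv (H : Axis g l p m) : Axis g⁻¹ l m p := by
  obtain ⟨h1, h2, h3, h4⟩ := H
  have h0 : l ≠ 0 := by positivity
  refine ⟨h1, ?_, ?_, by rwa [lB_comm]⟩
  · apply act_inj g; rw [act_inv_act, act_smul, h3, smul_smul, mul_inv_cancel₀ h0, one_smul]
  · apply act_inj g; rw [act_inv_act, act_smul, h2, smul_smul, inv_mul_cancel₀ h0, one_smul]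

lemma eig_m (H : Axis g l p m) {w : LV k} (hw : g ⊙ w = l⁻¹ • w) : ∃ c : ℝ, w = c • m := by
  have h0 : l ≠ 0 := by have := H.1; positivity
  apply H.inv.eig_p
  apply act_inj g; rw [act_inv_act, act_smul, hw, smul_smul, mul_inv_cancel₀ h0, one_smul]

lemma pos_of_timelike {u : LV k} (hu : 0 < lB u u) (h : lG k) : 0 < lB u (h ⊙ u) := by
  set s := Real.sqrt (lB u u)
  have hs : 0 < s := Real.sqrt_pos.2 hu
  have hs2 : s ^ 2 = lB u u := Real.sq_sqrt hu.le
  have key : ∀ t : ℝ, t ≠ 0 → t ^ 2 * lB u u = 1 → 0 < t * u.2 → 0 < lB u (h ⊙ u) := by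
    intro t h0 ht ht2
    have hm : t • u ∈ hyp k := by
      refine ⟨?_, ?_⟩
      · rw [lB_smul_left, lB_smul_right, ← ht]; ring
      · simpa using ht2
    have := one_le_lB hm (act_mem h hm)
    rw [act_smul, lB_smul_left, lB_smul_right] at this
    by_contra! hneg
    nlinarith [mul_self_pos.2 h0]
  have h2 := snd_ne_zero_of_timelike hu
  rcases lt_or_gt_of_ne h2 with h3 | h3
  · exact key (-s⁻¹) (neg_ne_zero.2 (by positivity)) (by rw [← hs2]; field_simp) (by
      have : 0 < s⁻¹ := by positivity
      nlinarith)
  · exact key (s⁻¹) (by positivity) (by rw [← hs2]; field_simp) (by positivity)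

lemma stab_pos (H : Axis g l p m) {c c' : ℝ} (hp : h ⊙ p = c • p) (hm : h ⊙ m = c' • m) :
    0 < c ∧ c' = c⁻¹ := by
  have h4 := H.2.2.2
  have := lB_act h p m
  rw [hp, hm, lB_smul_left, lB_smul_right] at this
  have e : c * c' = 1 := mul_right_cancel₀ h4.ne' (by linarith)
  have e2 := pos_of_timelike (H.timelike one_pos) h
  simp only [one_smul, act_add, hp, hm, lB_add_left, lB_add_right, lB_smul_right, H.pp, H.mm,
    lB_comm m p] at e2
  have h5 : 0 < (c + c') * lB p m := by linarith
  have h6 : 0 < c + c' := by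
    by_contra! h; nlinarith
  refine ⟨by by_contra! h; nlinarith, eq_inv_of_mul_eq_one_right e⟩

lemma swap_pos (H : Axis g l p m) {c c' : ℝ} (hp : h ⊙ p = c • m) (hm : h ⊙ m = c' • p) :
    0 < c ∧ c' = c⁻¹ := by
  have h4 := H.2.2.2
  have := lB_act h p m
  rw [hp, hm, lB_smul_left, lB_smul_right, lB_comm m p] at this
  have e : c * c' = 1 := mul_right_cancel₀ h4.ne' (by linarith)
  have e2 := pos_of_timelike (H.timelike one_pos) h
  simp only [one_smul, act_add, hp, hm, lB_add_left, lB_add_right, lB_smul_right, H.pp, H.mm,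
    lB_comm m p] at e2
  have h5 : 0 < (c + c') * lB p m := by linarith
  have h6 : 0 < c + c' := by
    by_contra! h; nlinarith
  refine ⟨by by_contra! h; nlinarith, eq_inv_of_mul_eq_one_right e⟩

lemma stab_of_comm (H : Axis g l p m) (hc : h * g = g * h) :
    ∃ c : ℝ, 0 < c ∧ h ⊙ p = c • p ∧ h ⊙ m = c⁻¹ • m := by
  have e : ∀ x, g ⊙ h ⊙ x = h ⊙ g ⊙ x := fun x => by
    rw [← act_mul, ← act_mul, hc]
  obtain ⟨c, h1⟩ := H.eig_p (w := h ⊙ p) (by rw [e, H.2.1, act_smul])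
  obtain ⟨c', h2⟩ := H.eig_m (w := h ⊙ m) (by rw [e, H.2.2.1, act_smul])
  obtain ⟨h3, rfl⟩ := H.stab_pos h1 h2
  exact ⟨c, h3, h1, h2⟩

lemma conj (H : Axis g l p m) (h : lG k) : Axis (h * g * h⁻¹) l (h ⊙ p) (h ⊙ m) := by
  refine ⟨H.1, ?_, ?_, by rw [lB_act]; exact H.2.2.2⟩
  · rw [act_mul, act_mul, inv_act_act, H.2.1, act_smul]
  · rw [act_mul, act_mul, inv_act_act, H.2.2.1, act_smul]

end Axis

lemma IsLat.eq_one_of_timelike (hA : IsLat A) {g : G} {u : LV k} (hu : 0 < lB u u)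
    (h : A g ⊙ u = u) : g = 1 := by
  by_contra hg
  have hs : 0 < Real.sqrt (lB u u) := Real.sqrt_pos.2 hu
  have hs2 : Real.sqrt (lB u u) ^ 2 = lB u u := Real.sq_sqrt hu.le
  set s := Real.sqrt (lB u u)
  have h2 := snd_ne_zero_of_timelike hu
  have key : ∀ t : ℝ, t ^ 2 * lB u u = 1 → 0 < t * u.2 → False := by
    intro t ht ht2
    refine hA.free g hg (t • u) ⟨?_, by simpa using ht2⟩ (by rw [act_smul, h])
    rw [lB_smul_left, lB_smul_right, ← ht]; ring
  have : 0 < s⁻¹ := by positivity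
  rcases lt_or_gt_of_ne h2 with h3 | h3
  · refine key (-s⁻¹) (by rw [← hs2]; field_simp) (by nlinarith)
  · exact key (s⁻¹) (by rw [← hs2]; field_simp) (by positivity)

/-- CSA property -/
lemma IsLat.csa (hA : IsLat A) {g h : G} (hg : g ≠ 1)
    (hc : g * (h * g * h⁻¹) = (h * g * h⁻¹) * g) : h * g = g * h := by
  obtain ⟨l, p, m, H⟩ := hA.exists_axis hg
  have H' := H.conj (A h)
  obtain ⟨c, hc0, h1, h2⟩ := H'.stab_of_comm (h := A g) (by
    simpa using congrArg A hc)
  have hne : A h ⊙ p ≠ 0 := by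
    intro h0
    have := H'.2.2.2
    rw [h0, lB_zero_left] at this
    exact lt_irrefl _ this
  have hl0 : l ≠ 0 := by have := H.1; positivity
  have hcase : c = l ∨ c = l⁻¹ := by
    by_contra! hcon
    apply hne
    apply H.eq_zero
    · have := lB_act (A g) (A h ⊙ p) p
      rw [h1, H.2.1, lB_smul_left, lB_smul_right] at this
      by_contra hn
      exact hcon.2 (eq_inv_of_mul_eq_one_left (mul_right_cancel₀ hn (by linarith)))
    · have := lB_act (A g) (A h ⊙ p) m
      rw [h1, H.2.2.1, lB_smul_left, lB_smul_right] at this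
      by_contra hn
      have e : c * l⁻¹ = 1 := (mul_right_cancel₀ hn (by linarith))
      exact hcon.1 (by field_simp at e; exact e)
    · exact H'.pp
  rcases hcase with rfl | rfl
  · obtain ⟨α, hα⟩ := H.eig_p h1
    obtain ⟨β, hβ⟩ := H.eig_m h2
    obtain ⟨hα0, rfl⟩ := H.stab_pos hα hβ
    have : g⁻¹ * h⁻¹ * g * h = 1 := by
      apply hA.eq_one_of_timelike (H.timelike one_pos)
      have i1 : ∀ (b : lG k) (x : LV k) (t : ℝ), t ≠ 0 → b ⊙ x = t • x → b⁻¹ ⊙ x = t⁻¹ • x := by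
        intro b x t ht hb
        apply act_inj b; rw [act_inv_act, act_smul, hb, smul_smul, inv_mul_cancel₀ ht, one_smul]
      simp only [map_mul, map_inv, act_mul, act_add, one_smul, hα, hβ, act_smul, H.2.1, H.2.2.1,
        i1 _ _ _ hα0.ne' hα, i1 _ _ _ (inv_ne_zero hα0.ne') hβ, i1 _ _ _ hl0 H.2.1,
        i1 _ _ _ (inv_ne_zero hl0) H.2.2.1, smul_smul]
      congr 1
      · convert one_smul ℝ p using 2; field_simp
      · convert one_smul ℝ m using 2; field_simp
    have e : g * h = h * g * (g⁻¹ * h⁻¹ * g * h) := by group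
    rw [e, this, mul_one]
  · obtain ⟨α, hα⟩ := H.eig_m h1
    obtain ⟨β, hβ⟩ := H.eig_p (by rwa [inv_inv] at h2)
    obtain ⟨hα0, rfl⟩ := H.swap_pos hα hβ
    have : h = 1 := by
      apply hA.eq_one_of_timelike (H.timelike hα0)
      rw [act_add, act_smul, hα, hβ, smul_smul, mul_inv_cancel₀ hα0.ne', one_smul, add_comm]
    rw [this]; simp

lemma IsLat.center (hk : 2 ≤ k) (hA : IsLat A) {g : G} (hc : ∀ h, h * g = g * h) : g = 1 := by
  by_contra hg
  obtain ⟨l, p, m, H⟩ := hA.exists_axis hg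
  obtain ⟨R, hR⟩ := hA.cocpt
  have hinv : ∀ h : G, ∀ y, lB (A h ⊙ y) p * lB (A h ⊙ y) m = lB y p * lB y m := by
    intro h y
    obtain ⟨c, h0, h1, h2⟩ := H.stab_of_comm (h := A h) (by rw [← map_mul, hc, map_mul])
    rw [← lB_act (A h) y p, ← lB_act (A h) y m, h1, h2, lB_smul_right, lB_smul_right]
    field_simp
  obtain ⟨w, hw0, hwp, hwm⟩ : ∃ w : LV k, w ≠ 0 ∧ lB w p = 0 ∧ lB w m = 0 := by
    let f : LV k →ₗ[ℝ] ℝ × ℝ := (lBlin p).prod (lBlin m)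
    have : LinearMap.ker f ≠ ⊥ := by
      apply LinearMap.ker_ne_bot_of_finrank_lt
      simp only [Module.finrank_prod, finrank_euclideanSpace, Fintype.card_fin,
        Module.finrank_self]
      omega
    obtain ⟨w, hw, hw0⟩ := Submodule.exists_mem_ne_zero_of_ne_bot this
    have hw' : f w = 0 := hw
    exact ⟨w, hw0, congrArg Prod.fst hw', congrArg Prod.snd hw'⟩
  have hww : lB w w < 0 := by
    by_contra! h
    exact hw0 (lB_orth_eq (H.timelike one_pos)
      (by rw [one_smul, lB_add_right, hwp, hwm, add_zero]) h)
  set u := p + (1 : ℝ) • m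
  have hu : 0 < lB u u := H.timelike one_pos
  have hu' : lB u u = 2 * lB p m := by
    simp only [u, one_smul, lB_add_left, lB_add_right, H.pp, H.mm, lB_comm m p]; ring
  have huw : lB w u = 0 := by simp only [u]; rw [one_smul, lB_add_right, hwp, hwm, add_zero]
  have hup : lB u p = lB p m := by
    simp only [u]; rw [one_smul, lB_add_left, H.pp, lB_comm m p]; ring
  have hum : lB u m = lB p m := by
    simp only [u]; rw [one_smul, lB_add_left, H.mm]; ring
  set K := R * (‖p‖ + ‖p‖) * (R * (‖m‖ + ‖m‖))
  have hB : ∀ y ∈ hyp k, y.2 ≤ R → ∀ q : LV k, |lB y q| ≤ R * (‖q‖ + ‖q‖) := by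
    intro y hy hyR q
    have h1 := hyp_norm hy
    have h2 := one_le_snd hy
    have h3 : ‖y.1‖ ≤ R := (abs_le_of_sq_le_sq' (a := ‖y.1‖) (b := R) (by nlinarith)
      (by linarith)).2
    have h4 := abs_real_inner_le_norm y.1 q.1
    have h5 := norm_fst_le q
    have h6 := norm_snd_le q
    rw [Real.norm_eq_abs] at h6
    unfold lB
    calc _ ≤ |y.2 * q.2| + |inner ℝ y.1 q.1| := abs_sub _ _
      _ ≤ R * ‖q‖ + R * ‖q‖ := by
        rw [abs_mul, abs_of_pos hy.2]
        have hR0 : 0 ≤ R := by linarith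
        refine add_le_add (mul_le_mul hyR h6 (abs_nonneg _) hR0)
          (h4.trans (mul_le_mul h3 h5 (norm_nonneg _) hR0))
      _ = _ := by ring
  -- points of the hyperboloid
  have hbound : ∀ a b : ℝ, a ^ 2 * lB u u + b ^ 2 * lB w w = 1 → a ^ 2 * lB p m ^ 2 ≤ K := by
    intro a b hab
    have main : ∀ y ∈ hyp k, lB y p * lB y m ≤ K := by
      intro y hy
      obtain ⟨h, hh⟩ := hR y hy
      rw [← hinv h]
      refine (le_abs_self _).trans ?_
      rw [abs_mul]
      exact mul_le_mul (hB _ (act_mem _ hy) hh _) (hB _ (act_mem _ hy) hh _) (abs_nonneg _)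
        ((abs_nonneg _).trans (hB _ (act_mem _ hy) hh p))
    have hyy : lB (a • u + b • w) (a • u + b • w) = 1 := by
      simp only [lB_add_left, lB_add_right, lB_smul_left, lB_smul_right, huw, lB_comm u w]
      rw [← hab]; ring
    have h1 : lB (a • u + b • w) p * lB (a • u + b • w) m = a ^ 2 * lB p m ^ 2 := by
      simp only [lB_add_left, lB_smul_left, hwp, hwm, hup, hum]; ring
    rcases lt_or_gt_of_ne (snd_ne_zero_of_timelike (hyy.symm ▸ one_pos)) with h2 | h2
    · have := main (-(a • u + b • w)) ⟨by rw [lB_neg_left, lB_neg_right, hyy, neg_neg], by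
        simpa only [Prod.snd_neg, Left.neg_pos_iff] using h2⟩
      rw [lB_neg_left, lB_neg_left, neg_mul_neg, h1] at this
      exact this
    · have := main _ ⟨hyy, h2⟩
      rwa [h1] at this
  have h4 := H.2.2.2
  set x := K / lB p m ^ 2 + 1
  have hK : 0 ≤ K := by
    have := hbound (Real.sqrt (lB u u)⁻¹) 0 (by
      rw [Real.sq_sqrt (by positivity)]; field_simp; ring)
    exact le_trans (by positivity) this
  have hx : 0 < x := by positivity
  -- choose a^2 = x' large
  set X := x + (lB u u)⁻¹
  have hX : 0 < X := by positivity
  have := hbound (Real.sqrt X) (Real.sqrt ((X * lB u u - 1) / (- lB w w))) (by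
    rw [Real.sq_sqrt hX.le, Real.sq_sqrt]
    · have hw1 : lB w w ≠ 0 := hww.ne
      have hw2 : -lB w w ≠ 0 := neg_ne_zero.2 hw1
      rw [div_mul_eq_mul_div, div_eq_of_eq_mul hw2 (c := -(X * lB u u - 1)) (by ring)]; ring
    · apply div_nonneg _ (by linarith)
      have : X * lB u u = x * lB u u + 1 := by simp only [X]; field_simp
      rw [this]; nlinarith)
  rw [Real.sq_sqrt hX.le] at this
  have h5 : X * lB p m ^ 2 ≥ x * lB p m ^ 2 := by
    have : 0 < (lB u u)⁻¹ := by positivity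
    gcongr; simp only [X]; linarith
  have h6 : x * lB p m ^ 2 = K + lB p m ^ 2 := by simp only [x]; field_simp
  nlinarith [mul_pos h4 h4]

lemma IsLat.countable (hA : IsLat A) : Countable G := by
  have : (⋃ n : ℕ, {g : G | (A g ⊙ (lo : LV k)).2 ≤ n}) = univ := by
    ext g; simp only [mem_iUnion, Set.mem_ofPred_eq, mem_univ, iff_true]
    exact exists_nat_ge _
  rw [← Set.countable_univ_iff, ← this]
  exact countable_iUnion fun n => (hA.fin _).countable

lemma near_mul {R1 R2 : ℝ} (h0 : 0 ≤ R1) {x y : LV k} {g h : lG k} (hx : x ∈ hyp k)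
    (h1 : lB x (g ⊙ lo) ≤ R1) (h2 : lB x (h ⊙ lo) ≤ R2) :
    ((g⁻¹ * h) ⊙ (lo : LV k)).2 ≤ 2 * R1 * R2 := by
  have e : ((g⁻¹ * h) ⊙ (lo : LV k)).2 = lB (g ⊙ lo) (h ⊙ lo) := by
    rw [lB_act_inv, act_mul, lB_comm]; simp
  rw [e]
  have := quasi_triangle (act_mem g lo_mem) hx (act_mem h lo_mem)
  rw [lB_comm (g ⊙ lo) x] at this
  have h3 := one_le_lB hx (act_mem h lo_mem)
  exact this.trans (by gcongr)

lemma near_mul' {R1 R2 M : ℝ} (h0 : 0 ≤ R1) (hR2 : 0 ≤ R2) {x y : LV k} {g h : lG k}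
    (hx : x ∈ hyp k) (hy : y ∈ hyp k) (h1 : lB x (g ⊙ lo) ≤ R1) (hxy : lB x y ≤ M)
    (h2 : lB y (h ⊙ lo) ≤ R2) :
    ((g⁻¹ * h) ⊙ (lo : LV k)).2 ≤ 2 * R1 * (2 * M * R2) := by
  refine near_mul h0 (y := y) hx h1 ?_
  refine (quasi_triangle hx hy (act_mem h lo_mem)).trans ?_
  have := one_le_lB hx hy
  have := one_le_lB hy (act_mem h lo_mem)
  gcongr
  linarith

end lattice

lemma IsLat.exists_near {G : Type*} [Group G] {k : ℕ} {A : G →* lG k} (hA : IsLat A) :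
    ∃ R : ℝ, 1 ≤ R ∧ ∀ x ∈ hyp k, ∃ g, lB x (A g ⊙ lo) ≤ R := by
  obtain ⟨R, hR⟩ := hA.cocpt
  refine ⟨max R 1, le_max_right _ _, fun x hx => ?_⟩
  obtain ⟨g, hg⟩ := hR x hx
  refine ⟨g⁻¹, ?_⟩
  rw [map_inv, ← lB_act_inv]
  simpa using Or.inl hg

lemma IsLat.fg {G : Type*} [Group G] {k : ℕ} {A : G →* lG (k + 1)} (hA : IsLat A) :
    ∃ S : Finset G, Subgroup.closure (S : Set G) = ⊤ := by
  obtain ⟨R, hR1, hR⟩ := hA.exists_near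
  refine ⟨(hA.fin (2 * R * (2 * Real.cosh 1 * R))).toFinset, ?_⟩
  rw [Set.Finite.coe_toFinset]
  set S := {g : G | (A g ⊙ (lo : LV (k + 1))).2 ≤ 2 * R * (2 * Real.cosh 1 * R)}
  have hch : 1 ≤ Real.cosh 1 := Real.one_le_cosh 1
  have step : ∀ (x y : LV (k + 1)) (g h : G), x ∈ hyp (k + 1) → y ∈ hyp (k + 1) →
      lB x (A g ⊙ lo) ≤ R → lB y (A h ⊙ lo) ≤ R → lB x y ≤ Real.cosh 1 → g⁻¹ * h ∈ S := by
    intro x y g h hx hy h1 h2 h3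
    have := near_mul' (by linarith) (by linarith) hx hy h1 h3 h2
    simpa only [S, Set.mem_ofPred_eq, map_mul, map_inv] using this
  have main : ∀ n : ℕ, ∀ y ∈ hyp (k + 1), ∀ g : G, lB lo y ≤ Real.cosh n →
      lB y (A g ⊙ lo) ≤ R → g ∈ Subgroup.closure S := by
    intro n
    induction n with
    | zero =>
      intro y hy g h1 h2
      have h3 : y = lo := by
        refine (eq_of_lB_one lo_mem hy (le_antisymm (by simpa using h1) (one_le_lB lo_mem hy))).symm
      apply Subgroup.subset_closure
      have := step lo y 1 g lo_mem hy (by simpa using hR1) h2 (by rw [h3]; simpa using hch)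
      simpa using this
    | succ n ih =>
      intro y hy g h1 h2
      obtain ⟨t, D, hD, ht0, htD, hlB⟩ := exists_geo lo_mem hy
      rw [hlB] at h1
      have hDn : D ≤ n + 1 := by
        have := Real.cosh_le_cosh.1 h1
        rw [abs_of_nonneg hD, abs_of_nonneg (by positivity)] at this
        exact_mod_cast this
      set D' := max (D - 1) 0
      have hgeo : ∀ a b : ℝ, lB (geo a : LV (k + 1)) (geo b) = Real.cosh (b - a) := by
        intro a b
        simp only [lB, geo, real_inner_smul_left, real_inner_smul_right,
          real_inner_self_eq_norm_sq, norm_e0, Real.cosh_sub]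
        ring
      have hy' : t⁻¹ ⊙ geo D' ∈ hyp (k + 1) := act_mem _ (geo_mem _)
      obtain ⟨g', hg'⟩ := hR _ hy'
      have m1 : g' ∈ Subgroup.closure S := by
        refine ih _ hy' g' ?_ hg'
        rw [lB_comm, lB_inv_act, ht0, lB_comm, hgeo, Real.cosh_le_cosh, sub_zero,
          abs_of_nonneg (le_max_right _ _), abs_of_nonneg (by positivity)]
        exact max_le (by linarith) (by positivity)
      have m2 : g'⁻¹ * g ∈ S := by
        refine step _ y g' g hy' hy hg' h2 ?_
        rw [lB_inv_act, htD, hgeo, Real.cosh_le_cosh, abs_one, abs_of_nonneg]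
        · linarith [le_max_left (D - 1) 0]
        · exact sub_nonneg.2 (max_le (by linarith) hD)
      have := mul_mem m1 (Subgroup.subset_closure m2)
      simpa using this
  rw [eq_top_iff]
  intro g _
  obtain ⟨n, hn⟩ := exists_nat_ge (Real.arcosh (lB lo (A g ⊙ (lo : LV (k + 1)))))
  refine main n (A g ⊙ lo) (act_mem _ lo_mem) g ?_ ?_
  · have h1 := one_le_lB lo_mem (act_mem (A g) (lo_mem (k := k + 1)))
    rw [← Real.cosh_arcosh h1, Real.cosh_le_cosh, abs_of_nonneg (Real.arcosh_nonneg h1),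
      abs_of_nonneg (by positivity)]
    exact hn
  · rw [(act_mem (A g) (lo_mem (k := k + 1))).1]; exact hR1

end TV

namespace TV
open scoped ENNReal NNReal

/-- bounded multiplicity -/
def BM {X Y : Type*} (T : X → Y) : Prop :=
  ∃ (n : ℕ) (c : X → Fin n), Function.Injective fun x => (T x, c x)

lemma BM.comp {X Y Z : Type*} {T1 : X → Y} {T2 : Y → Z} (h2 : BM T2) (h1 : BM T1) :
    BM (fun x => T2 (T1 x)) := by
  obtain ⟨n, c, hc⟩ := h1
  obtain ⟨m, d, hd⟩ := h2
  refine ⟨m * n, fun x => finProdFinEquiv (d (T1 x), c x), fun x y h => ?_⟩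
  simp only [Prod.mk.injEq, EmbeddingLike.apply_eq_iff_eq] at h
  have := hd (a₁ := T1 x) (a₂ := T1 y) (by simp [h.1, h.2.1])
  exact hc (by simp [this, h.2.2])

lemma BM.of_inj {X Y : Type*} {T : X → Y} (h : Function.Injective T) : BM T :=
  ⟨1, fun _ => 0, fun x y hxy => h (congrArg Prod.fst hxy)⟩

lemma BM.of_finite {X Y Z : Type*} {T : X → Y} (s : Set Z) (hs : s.Finite) (c : X → Z)
    (hc : ∀ x, c x ∈ s) (h : Function.Injective fun x => (T x, c x)) : BM T := by
  have := hs.to_subtype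
  let e := Finite.equivFin s
  refine ⟨Nat.card s, fun x => e ⟨c x, hc x⟩, fun x y hxy => h ?_⟩
  simp only [Prod.mk.injEq, EmbeddingLike.apply_eq_iff_eq, Subtype.mk.injEq] at hxy
  simp [hxy.1, hxy.2]

lemma BM.of_rel {X Y Z : Type*} {T : X → Y} (s : Set Z) (hs : s.Finite) (d : X → X → Z)
    (h : ∀ x x', T x = T x' → d x x' ∈ s) (hd : ∀ x, Function.Injective (d x)) : BM T := by
  have hr : ∀ x : X, ∃ r : X, T r = T x := fun x => ⟨x, rfl⟩
  classical
  let r : Y → X → X := fun y x => if hy : ∃ r, T r = y then hy.choose else x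
  have r1 : ∀ x, T (r (T x) x) = T x := fun x => by
    have hy : ∃ r, T r = T x := ⟨x, rfl⟩
    simp only [r, dif_pos hy]; exact hy.choose_spec
  have r2 : ∀ x x', T x = T x' → r (T x) x = r (T x') x' := fun x x' hx => by
    have hy : ∃ r, T r = T x' := ⟨x', rfl⟩
    rw [hx]; simp only [r, dif_pos hy]
  refine BM.of_finite s hs (fun x => d (r (T x) x) x) (fun x => h _ _ (r1 x)) fun x y hxy => ?_
  simp only [Prod.mk.injEq] at hxy
  rw [r2 _ _ hxy.1] at hxy
  exact hd _ hxy.2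

lemma BM.tsum_le {X Y : Type*} {T : X → Y} (h : BM T) :
    ∃ C : ℝ≥0, ∀ F : Y → ℝ≥0∞, ∑' x, F (T x) ≤ C * ∑' y, F y := by
  obtain ⟨n, c, hc⟩ := h
  refine ⟨n, fun F => ?_⟩
  calc ∑' x, F (T x) = ∑' x, (fun p : Y × Fin n => F p.1) (T x, c x) := rfl
    _ ≤ ∑' p : Y × Fin n, F p.1 := ENNReal.tsum_comp_le_tsum_of_injective hc _
    _ = ∑' y, ∑' _ : Fin n, F y := ENNReal.tsum_prod (f := fun y _ => F y)
    _ = ∑' y, n * F y := by simp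
    _ = _ := by rw [ENNReal.tsum_mul_left]; simp

section coc
variable {G : Type*} [Group G]

variable (G) in
/-- antisymmetric summable kernels -/
structure Coc where
  a : G → G → ℝ
  anti : ∀ x y, a x y = - a y x
  fin : ∀ s, ∑' h, ‖a h (h * s)‖ₑ ≠ ⊤

namespace Coc
/-- I -/
def I (a : Coc G) (S : Finset G) : ℝ≥0∞ := ∑ s ∈ S, ∑' h, ‖a.a h (h * s)‖ₑ
/-- triangle defect -/
def tri (a : Coc G) (x y z : G) : ℝ := a.a x y + a.a y z + a.a z x
/-- D -/
def D (a : Coc G) (S : Finset G) : ℝ≥0∞ :=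
  ∑ s ∈ S, ∑ t ∈ S, ∑' h, ‖a.tri h (h * s) (h * s * t)‖ₑ

lemma I_mono (a : Coc G) : Monotone a.I := fun S T h =>
  Finset.sum_le_sum_of_subset h

lemma D_mono (a : Coc G) : Monotone a.D := fun S T h => by
  unfold D
  refine (Finset.sum_le_sum_of_subset h).trans (Finset.sum_le_sum fun s _ => ?_)
  exact Finset.sum_le_sum_of_subset h

lemma I_ne_top (a : Coc G) (S : Finset G) : a.I S ≠ ⊤ := by
  unfold I
  rw [ENNReal.sum_ne_top]
  exact fun s _ => a.fin s
end Coc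

/-- bounded displacement -/
def Disp {Y : Type*} (f1 f2 : Y → G) : Prop := ∃ S : Finset G, ∀ y, (f1 y)⁻¹ * f2 y ∈ S

lemma Disp.symm {Y : Type*} {f1 f2 : Y → G} (h : Disp f1 f2) : Disp f2 f1 := by
  classical
  obtain ⟨S, hS⟩ := h
  refine ⟨S.image (·⁻¹), fun y => Finset.mem_image.2 ⟨_, hS y, by simp⟩⟩

lemma Disp.trans {Y : Type*} {f1 f2 f3 : Y → G} (h : Disp f1 f2) (h' : Disp f2 f3) :
    Disp f1 f3 := by
  classical
  obtain ⟨S, hS⟩ := h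
  obtain ⟨T, hT⟩ := h'
  refine ⟨(S ×ˢ T).image (fun p => p.1 * p.2), fun y => Finset.mem_image.2
    ⟨((f1 y)⁻¹ * f2 y, (f2 y)⁻¹ * f3 y), Finset.mem_product.2 ⟨hS y, hT y⟩, by simp [mul_assoc]⟩⟩

lemma Disp.comp {Y Z : Type*} {f1 f2 : Y → G} (h : Disp f1 f2) (T : Z → Y) :
    Disp (fun z => f1 (T z)) (fun z => f2 (T z)) := by
  obtain ⟨S, hS⟩ := h
  exact ⟨S, fun z => hS _⟩

/-- controlled quantities -/
def Ctl (N : Coc G → Finset G → ℝ≥0∞) {Y : Type*} (F : Coc G → Y → ℝ) : Prop :=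
  ∃ (C : ℝ≥0) (S : Finset G), ∀ a, ∑' y, ‖F a y‖ₑ ≤ C * N a S

variable {N : Coc G → Finset G → ℝ≥0∞} {Y Z : Type*}

lemma Ctl.add (hN : ∀ a, Monotone (N a)) {F F' : Coc G → Y → ℝ} (h : Ctl N F) (h' : Ctl N F') :
    Ctl N (fun a y => F a y + F' a y) := by
  classical
  obtain ⟨C, S, h⟩ := h
  obtain ⟨C', S', h'⟩ := h'
  refine ⟨C + C', S ∪ S', fun a => ?_⟩
  calc _ ≤ ∑' y, (‖F a y‖ₑ + ‖F' a y‖ₑ) := ENNReal.tsum_le_tsum fun y => enorm_add_le _ _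
    _ = ∑' y, ‖F a y‖ₑ + ∑' y, ‖F' a y‖ₑ := ENNReal.tsum_add
    _ ≤ C * N a (S ∪ S') + C' * N a (S ∪ S') := by
      gcongr
      · exact (h a).trans (by gcongr; exact hN a Finset.subset_union_left)
      · exact (h' a).trans (by gcongr; exact hN a Finset.subset_union_right)
    _ = _ := by push_cast; ring

lemma Ctl.const_mul {F : Coc G → Y → ℝ} (h : Ctl N F) (c : ℝ) :
    Ctl N (fun a y => c * F a y) := by
  obtain ⟨C, S, h⟩ := h
  refine ⟨‖c‖₊ * C, S, fun a => ?_⟩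
  simp only [enorm_mul]
  rw [ENNReal.tsum_mul_left, ENNReal.coe_mul, mul_assoc]
  gcongr
  · exact le_of_eq rfl
  · exact h a

lemma Ctl.neg {F : Coc G → Y → ℝ} (h : Ctl N F) : Ctl N (fun a y => - F a y) := by
  obtain ⟨C, S, h⟩ := h
  exact ⟨C, S, fun a => by simpa only [enorm_neg] using h a⟩

lemma Ctl.sub (hN : ∀ a, Monotone (N a)) {F F' : Coc G → Y → ℝ} (h : Ctl N F) (h' : Ctl N F') :
    Ctl N (fun a y => F a y - F' a y) := by
  simpa only [sub_eq_add_neg] using h.add hN h'.neg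

lemma Ctl.zero : Ctl N (fun _ (_ : Y) => (0 : ℝ)) := ⟨0, ∅, by simp⟩

lemma Ctl.sum (hN : ∀ a, Monotone (N a)) {ι : Type*} (s : Finset ι) {F : ι → Coc G → Y → ℝ}
    (h : ∀ i ∈ s, Ctl N (F i)) : Ctl N (fun a y => ∑ i ∈ s, F i a y) := by
  classical
  induction s using Finset.induction_on with
  | empty => simpa using Ctl.zero
  | insert i s hi ih =>
    simp only [Finset.sum_insert hi]
    exact (h i (by simp)).add hN (ih fun j hj => h j (by simp [hj]))

lemma Ctl.comp {F : Coc G → Y → ℝ} (h : Ctl N F) {T : Z → Y} (hT : BM T) :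
    Ctl N (fun a z => F a (T z)) := by
  obtain ⟨C, S, h⟩ := h
  obtain ⟨C', h'⟩ := hT.tsum_le
  refine ⟨C' * C, S, fun a => (h' fun y => ‖F a y‖ₑ).trans ?_⟩
  rw [ENNReal.coe_mul, mul_assoc]
  gcongr
  exact h a

lemma Ctl.abs {F : Coc G → Y → ℝ} (h : Ctl N F) : Ctl N (fun a y => |F a y|) := by
  obtain ⟨C, S, h⟩ := h
  exact ⟨C, S, fun a => by simpa only [← Real.norm_eq_abs, enorm_norm] using h a⟩

lemma Ctl.mono {F F' : Coc G → Y → ℝ} (h : Ctl N F) (hF : ∀ a y, |F' a y| ≤ |F a y|) :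
    Ctl N F' := by
  obtain ⟨C, S, h⟩ := h
  exact ⟨C, S, fun a => (ENNReal.tsum_le_tsum fun y => enorm_le_iff_norm_le.2 (hF a y)).trans
    (h a)⟩

lemma ctl_I {f1 f2 : Y → G} (h1 : BM f1) (h : Disp f1 f2) :
    Ctl Coc.I (fun a y => a.a (f1 y) (f2 y)) := by
  obtain ⟨C, hC⟩ := h1.tsum_le
  obtain ⟨S, hS⟩ := h
  refine ⟨C, S, fun a => ?_⟩
  calc ∑' y, ‖a.a (f1 y) (f2 y)‖ₑ ≤ ∑' y, ∑ s ∈ S, ‖a.a (f1 y) (f1 y * s)‖ₑ := by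
        refine ENNReal.tsum_le_tsum fun y => ?_
        refine le_trans (le_of_eq ?_) (Finset.single_le_sum
          (f := fun s => ‖a.a (f1 y) (f1 y * s)‖ₑ) (fun _ _ => zero_le) (hS y))
        simp
    _ ≤ C * ∑' h, ∑ s ∈ S, ‖a.a h (h * s)‖ₑ := hC fun h => ∑ s ∈ S, ‖a.a h (h * s)‖ₑ
    _ = _ := by
      rw [Summable.tsum_finsetSum fun _ _ => ENNReal.summable]; rfl

lemma ctl_D {f1 f2 f3 : Y → G} (h1 : BM f1) (h : Disp f1 f2) (h' : Disp f2 f3) :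
    Ctl Coc.D (fun a y => a.tri (f1 y) (f2 y) (f3 y)) := by
  classical
  obtain ⟨C, hC⟩ := h1.tsum_le
  obtain ⟨S, hS⟩ := h
  obtain ⟨S', hS'⟩ := h'
  refine ⟨C, S ∪ S', fun a => ?_⟩
  set T := S ∪ S'
  calc ∑' y, ‖a.tri (f1 y) (f2 y) (f3 y)‖ₑ
      ≤ ∑' y, ∑ s ∈ T, ∑ t ∈ T, ‖a.tri (f1 y) (f1 y * s) (f1 y * s * t)‖ₑ := by
        refine ENNReal.tsum_le_tsum fun y => ?_
        refine le_trans ?_ (Finset.single_le_sum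
          (f := fun s => ∑ t ∈ T, ‖a.tri (f1 y) (f1 y * s) (f1 y * s * t)‖ₑ)
          (fun _ _ => zero_le) (Finset.mem_union_left _ (hS y)))
        refine le_trans (le_of_eq ?_) (Finset.single_le_sum
          (f := fun t => ‖a.tri (f1 y) (f1 y * ((f1 y)⁻¹ * f2 y)) (f1 y * ((f1 y)⁻¹ * f2 y) * t)‖ₑ)
          (fun _ _ => zero_le) (Finset.mem_union_right _ (hS' y)))
        simp
    _ ≤ C * ∑' h, ∑ s ∈ T, ∑ t ∈ T, ‖a.tri h (h * s) (h * s * t)‖ₑ :=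
        hC fun h => ∑ s ∈ T, ∑ t ∈ T, ‖a.tri h (h * s) (h * s * t)‖ₑ
    _ = _ := by
      rw [Summable.tsum_finsetSum fun _ _ => ENNReal.summable]
      congr 1
      refine Finset.sum_congr rfl fun s _ => ?_
      rw [Summable.tsum_finsetSum fun _ _ => ENNReal.summable]

/-- abstract dyadic tree -/
structure Dyad (G : Type*) [Group G] (X : Type*) (ι κ : Type*) [Fintype ι] where
  ch : ι → X → X
  ch_inj : Function.Injective fun p : ι × X => ch p.1 p.2
  card : 4 ≤ Fintype.card ι
  τ : κ → X ≃ X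
  ch_τ : ∀ c i Q, ch c (τ i Q) = τ i (τ i (ch c Q))
  g : X → G
  bm : BM g
  disp_ch : ∀ c, Disp g (fun Q => g (ch c Q))
  disp_τ : ∀ i, Disp g (fun Q => g (τ i Q))

namespace Dyad
variable {X ι κ : Type*} [Fintype ι] (d : Dyad G X ι κ)

/-- averaging -/
def avg (F : ι → ℝ) : ℝ := (Fintype.card ι : ℝ)⁻¹ * ∑ c, F c

lemma card_ne (d : Dyad G X ι κ) : (Fintype.card ι : ℝ) ≠ 0 := by
  have := d.card
  have : 0 < Fintype.card ι := by omega
  positivity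

lemma avg_const (d : Dyad G X ι κ) (x : ℝ) : avg (fun _ : ι => x) = x := by
  have := d.card_ne
  simp [avg]; field_simp

lemma avg_add (F F' : ι → ℝ) : avg (fun c => F c + F' c) = avg F + avg F' := by
  simp only [avg, Finset.sum_add_distrib]; ring

lemma avg_sub (F F' : ι → ℝ) : avg (fun c => F c - F' c) = avg F - avg F' := by
  simp only [avg, Finset.sum_sub_distrib]; ring

/-- general contraction -/
lemma tsum_avg_le (d : Dyad G X ι κ) (T : ι → X → X) (hT : Function.Injective fun p : ι × X => T p.1 p.2)
    (F : X → ℝ) : ∑' Q, ‖avg (fun c => F (T c Q))‖ₑ ≤ 4⁻¹ * ∑' Q, ‖F Q‖ₑ := by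
  have h4 : ‖(Fintype.card ι : ℝ)⁻¹‖ₑ ≤ 4⁻¹ := by
    have h1 : (4 : ℝ) ≤ Fintype.card ι := by exact_mod_cast d.card
    have : ‖(Fintype.card ι : ℝ)⁻¹‖ ≤ 4⁻¹ := by
      rw [norm_inv, Real.norm_of_nonneg (by positivity)]
      gcongr
    calc ‖(Fintype.card ι : ℝ)⁻¹‖ₑ = ENNReal.ofReal ‖(Fintype.card ι : ℝ)⁻¹‖ :=
          (ofReal_norm_eq_enorm _).symm
      _ ≤ ENNReal.ofReal 4⁻¹ := ENNReal.ofReal_le_ofReal this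
      _ = 4⁻¹ := by rw [ENNReal.ofReal_inv_of_pos (by norm_num)]; norm_num
  calc ∑' Q, ‖avg (fun c => F (T c Q))‖ₑ ≤ ∑' Q, 4⁻¹ * ∑ c, ‖F (T c Q)‖ₑ := by
        refine ENNReal.tsum_le_tsum fun Q => ?_
        rw [avg, enorm_mul]
        gcongr
        exact enorm_sum_le _ _
    _ = 4⁻¹ * ∑' c, ∑' Q, ‖F (T c Q)‖ₑ := by
        rw [ENNReal.tsum_mul_left, Summable.tsum_finsetSum fun _ _ => ENNReal.summable,
          tsum_fintype]
    _ = 4⁻¹ * ∑' p : ι × X, (fun Q => ‖F Q‖ₑ) (T p.1 p.2) := by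
        rw [ENNReal.tsum_prod (f := fun c Q => ‖F (T c Q)‖ₑ)]
    _ ≤ _ := by
        gcongr
        exact ENNReal.tsum_comp_le_tsum_of_injective hT _

/-- averaging over children -/
def M (F : X → ℝ) (Q : X) : ℝ := avg fun c => F (d.ch c Q)

/-- first increment -/
def a0 (a : Coc G) (Q : X) : ℝ := avg fun c => a.a (d.g Q) (d.g (d.ch c Q))

/-- potential -/
def v (a : Coc G) (Q : X) : ℝ := ∑' j : ℕ, (d.M^[j] (d.a0 a)) Q

lemma ctl_a0 : Ctl Coc.I (fun a => d.a0 a) := by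
  unfold a0 avg
  apply Ctl.const_mul
  apply Ctl.sum Coc.I_mono
  exact fun c _ => ctl_I d.bm (d.disp_ch c)

lemma tsum_iter (F : X → ℝ) (j : ℕ) :
    ∑' Q, ‖(d.M^[j] F) Q‖ₑ ≤ 4⁻¹ ^ j * ∑' Q, ‖F Q‖ₑ := by
  induction j with
  | zero => simp
  | succ j ih =>
    rw [Function.iterate_succ_apply']
    refine (d.tsum_avg_le d.ch d.ch_inj _).trans ?_
    rw [pow_succ', mul_assoc]
    gcongr

lemma tsum_iter' (F : X → ℝ) :
    ∑' Q, ∑' j, ‖(d.M^[j] F) Q‖ₑ ≤ (1 - 4⁻¹)⁻¹ * ∑' Q, ‖F Q‖ₑ := by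
  rw [ENNReal.tsum_comm]
  calc _ ≤ ∑' j : ℕ, 4⁻¹ ^ j * ∑' Q, ‖F Q‖ₑ := ENNReal.tsum_le_tsum fun j => d.tsum_iter F j
    _ = _ := by rw [ENNReal.tsum_mul_right, ENNReal.tsum_geometric]

lemma c_ne_top : ((1 : ℝ≥0∞) - 4⁻¹)⁻¹ ≠ ⊤ := by
  rw [ENNReal.inv_ne_top]
  refine (tsub_pos_of_lt ?_).ne'
  rw [ENNReal.inv_lt_one]; norm_num

lemma summable_iter (a : Coc G) (Q : X) : Summable fun j => (d.M^[j] (d.a0 a)) Q := by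
  obtain ⟨C, S, h⟩ := d.ctl_a0
  have h1 : ∑' Q, ∑' j, ‖(d.M^[j] (d.a0 a)) Q‖ₑ ≠ ⊤ := by
    refine ne_top_of_le_ne_top ?_ (d.tsum_iter' _)
    refine ENNReal.mul_ne_top c_ne_top (ne_top_of_le_ne_top ?_ (h a))
    exact ENNReal.mul_ne_top ENNReal.coe_ne_top (a.I_ne_top S)
  have h2 := ENNReal.ne_top_of_tsum_ne_top h1 Q
  apply Summable.of_nnnorm
  exact ENNReal.tsum_coe_ne_top_iff_summable.1 h2

lemma enorm_v_le (a : Coc G) (Q : X) : ‖d.v a Q‖ₑ ≤ ∑' j, ‖(d.M^[j] (d.a0 a)) Q‖ₑ := by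
  unfold v
  exact enorm_tsum_le_tsum_enorm

lemma ctl_v : Ctl Coc.I d.v := by
  obtain ⟨C, S, h⟩ := d.ctl_a0
  refine ⟨((1 : ℝ≥0∞) - 4⁻¹)⁻¹.toNNReal * C, S, fun a => ?_⟩
  rw [ENNReal.coe_mul, ENNReal.coe_toNNReal c_ne_top, mul_assoc]
  refine (ENNReal.tsum_le_tsum (d.enorm_v_le a)).trans ((d.tsum_iter' _).trans ?_)
  gcongr
  exact h a

lemma v_eq (a : Coc G) (Q : X) :
    d.v a Q = avg fun c => a.a (d.g Q) (d.g (d.ch c Q)) + d.v a (d.ch c Q) := by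
  rw [avg_add]
  have h1 : d.v a Q = d.a0 a Q + ∑' j, (d.M^[j+1] (d.a0 a)) Q := by
    unfold v
    rw [(d.summable_iter a Q).tsum_eq_zero_add]; rfl
  rw [h1]
  congr 1
  simp only [Function.iterate_succ_apply']
  simp only [M, avg, v]
  rw [tsum_mul_left, Summable.tsum_finsetSum fun c _ => d.summable_iter a _]

/-- corrected kernel -/
def e (a : Coc G) (x y : X) : ℝ := a.a (d.g x) (d.g y) + d.v a y - d.v a x

lemma e_anti (a : Coc G) (x y : X) : d.e a x y = - d.e a y x := by
  unfold e; rw [a.anti]; ring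

lemma e_tri (a : Coc G) (x y z : X) :
    d.e a x z = d.e a x y + d.e a y z - a.tri (d.g x) (d.g y) (d.g z) := by
  unfold e Coc.tri; rw [a.anti (d.g z)]; ring

lemma avg_e (a : Coc G) (Q : X) : avg (fun c => d.e a Q (d.ch c Q)) = 0 := by
  unfold e
  rw [avg_sub, d.avg_const, ← d.v_eq, sub_self]

/-- good moves -/
def Good (T : X → X) : Prop :=
  Ctl Coc.D (fun a Q => d.e a Q (T Q)) ∧ Disp d.g (fun Q => d.g (T Q)) ∧ BM T

lemma Good.comp {T1 T2 : X → X} (h2 : d.Good T2) (h1 : d.Good T1) :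
    d.Good (fun Q => T2 (T1 Q)) := by
  refine ⟨?_, h1.2.1.trans (h2.2.1.comp T1), h2.2.2.comp h1.2.2⟩
  have := ((h1.1.add Coc.D_mono (h2.1.comp h1.2.2)).sub Coc.D_mono
    (ctl_D d.bm h1.2.1 (h2.2.1.comp T1)))
  convert this using 3
  rw [d.e_tri _ _ (T1 _)]

lemma Good.id : d.Good (fun Q => Q) := by
  refine ⟨?_, ⟨{1}, by simp⟩, BM.of_inj Function.injective_id⟩
  refine (Ctl.zero (N := Coc.D) (Y := X)).mono fun a y => ?_
  have := d.e_anti a y y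
  rw [show d.e a y y = 0 by linarith]

lemma Good.iter {T : X → X} (h : d.Good T) (n : ℕ) : d.Good (T^[n]) := by
  induction n with
  | zero => exact Good.id d
  | succ n ih =>
    have : T^[n+1] = fun Q => T (T^[n] Q) := by ext; simp [Function.iterate_succ_apply']
    rw [this]; exact Good.comp d h ih

lemma bm_ch (c : ι) : BM (d.ch c) := BM.of_inj fun x y h => by
  have := d.ch_inj (a₁ := (c, x)) (a₂ := (c, y)) h
  exact congrArg Prod.snd this

lemma bm_τ (i : κ) : BM (d.τ i) := BM.of_inj (d.τ i).injective

/-- remainder -/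
def δ (i : κ) (a : Coc G) (Q : X) : ℝ := avg fun c =>
  a.tri (d.g Q) (d.g (d.τ i Q)) (d.g (d.ch c (d.τ i Q)))
  - a.tri (d.g Q) (d.g (d.ch c Q)) (d.g (d.ch c (d.τ i Q)))
  - a.tri (d.g (d.ch c Q)) (d.g (d.τ i (d.ch c Q))) (d.g (d.τ i (d.τ i (d.ch c Q))))

lemma ctl_δ (i : κ) : Ctl Coc.D (d.δ i) := by
  unfold δ avg
  apply Ctl.const_mul
  apply Ctl.sum Coc.D_mono
  intro c _
  apply Ctl.sub Coc.D_mono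
  · apply Ctl.sub Coc.D_mono
    · exact ctl_D d.bm (d.disp_τ i) ((d.disp_ch c).comp _)
    · exact ctl_D d.bm (d.disp_ch c)
        ((d.disp_ch c).symm.trans ((d.disp_τ i).trans ((d.disp_ch c).comp _)))
  · exact ctl_D (d.bm.comp (d.bm_ch c)) ((d.disp_τ i).comp _)
      (((d.disp_τ i).comp fun Q => d.τ i (d.ch c Q)))

lemma E_eq (i : κ) (a : Coc G) (Q : X) : d.e a Q (d.τ i Q) =
    avg (fun c => d.e a (d.ch c Q) (d.τ i (d.ch c Q))) +
    avg (fun c => d.e a (d.τ i (d.ch c Q)) (d.τ i (d.τ i (d.ch c Q)))) + d.δ i a Q := by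
  have h : ∀ c, d.e a Q (d.τ i Q) =
      (d.e a Q (d.ch c Q) - d.e a (d.τ i Q) (d.ch c (d.τ i Q))) +
      (d.e a (d.ch c Q) (d.τ i (d.ch c Q)) +
        d.e a (d.τ i (d.ch c Q)) (d.τ i (d.τ i (d.ch c Q)))) +
      (a.tri (d.g Q) (d.g (d.τ i Q)) (d.g (d.ch c (d.τ i Q)))
      - a.tri (d.g Q) (d.g (d.ch c Q)) (d.g (d.ch c (d.τ i Q)))
      - a.tri (d.g (d.ch c Q)) (d.g (d.τ i (d.ch c Q))) (d.g (d.τ i (d.τ i (d.ch c Q))))) := by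
    intro c
    have e1 := d.e_tri a Q (d.τ i Q) (d.ch c (d.τ i Q))
    have e2 := d.e_tri a Q (d.ch c Q) (d.ch c (d.τ i Q))
    have e3 := d.e_tri a (d.ch c Q) (d.τ i (d.ch c Q)) (d.τ i (d.τ i (d.ch c Q)))
    rw [← d.ch_τ] at e3 ⊢
    linarith
  rw [← d.avg_const (d.e a Q (d.τ i Q))]
  conv_lhs => arg 1; ext c; rw [h c]
  rw [avg_add, avg_add, avg_add, avg_sub, d.avg_e, d.avg_e]
  simp only [δ]; ring

lemma good_τ (i : κ) : d.Good (d.τ i) := by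
  refine ⟨?_, d.disp_τ i, d.bm_τ i⟩
  obtain ⟨C, S, h⟩ := d.ctl_δ i
  have hI : Ctl Coc.I (fun a Q => d.e a Q (d.τ i Q)) := by
    unfold e
    exact ((ctl_I d.bm (d.disp_τ i)).add Coc.I_mono (d.ctl_v.comp (d.bm_τ i))).sub Coc.I_mono
      d.ctl_v
  obtain ⟨C', S', h'⟩ := hI
  refine ⟨2 * C, S, fun a => ?_⟩
  set n := ∑' Q, ‖d.e a Q (d.τ i Q)‖ₑ with hn
  have hfin : n ≠ ⊤ := ne_top_of_le_ne_top (ENNReal.mul_ne_top ENNReal.coe_ne_top (a.I_ne_top S'))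
    (h' a)
  have hτch : Function.Injective fun p : ι × X => d.τ i (d.ch p.1 p.2) :=
    (d.τ i).injective.comp d.ch_inj
  have key : n ≤ 4⁻¹ * n + 4⁻¹ * n + C * a.D S := by
    calc n = ∑' Q, ‖avg (fun c => d.e a (d.ch c Q) (d.τ i (d.ch c Q))) +
          avg (fun c => d.e a (d.τ i (d.ch c Q)) (d.τ i (d.τ i (d.ch c Q)))) + d.δ i a Q‖ₑ :=
          tsum_congr fun Q => by rw [← d.E_eq]
      _ ≤ ∑' Q, (‖avg (fun c => d.e a (d.ch c Q) (d.τ i (d.ch c Q)))‖ₑ +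
          ‖avg (fun c => d.e a (d.τ i (d.ch c Q)) (d.τ i (d.τ i (d.ch c Q))))‖ₑ
          + ‖d.δ i a Q‖ₑ) := ENNReal.tsum_le_tsum fun Q =>
            (enorm_add_le _ _).trans (by gcongr; exact enorm_add_le _ _)
      _ = _ := by rw [ENNReal.tsum_add, ENNReal.tsum_add]
      _ ≤ _ := by
        gcongr
        · exact d.tsum_avg_le d.ch d.ch_inj (fun Q => d.e a Q (d.τ i Q))
        · exact d.tsum_avg_le (fun c Q => d.τ i (d.ch c Q)) hτch (fun Q => d.e a Q (d.τ i Q))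
        · exact h a
  by_cases hR : C * a.D S = ⊤
  · rw [ENNReal.coe_mul, mul_assoc, hR]; simp
  rw [ENNReal.coe_mul, mul_assoc]
  lift n to ℝ≥0 using hfin with n' 
  obtain ⟨r, hr⟩ : ∃ r : ℝ≥0, (r : ℝ≥0∞) = C * a.D S := ⟨_, ENNReal.coe_toNNReal hR⟩
  rw [← hr] at key ⊢
  have h44 : (4 : ℝ≥0∞)⁻¹ = ((4⁻¹ : ℝ≥0) : ℝ≥0∞) := by
    rw [ENNReal.coe_inv (by norm_num)]; norm_num
  rw [h44] at key
  norm_cast at key ⊢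
  rw [← NNReal.coe_le_coe] at key ⊢
  push_cast at key ⊢
  linarith

lemma good_τ_symm (i : κ) : d.Good (d.τ i).symm := by
  have hb : BM (d.τ i).symm := BM.of_inj (d.τ i).symm.injective
  refine ⟨?_, ?_, hb⟩
  · have := ((d.good_τ i).1.comp hb).neg
    convert this using 3
    rw [d.e_anti]; simp
  · have := ((d.disp_τ i).comp (d.τ i).symm).symm
    simpa using this

lemma good_ch (c : ι) (hT : ∀ c', ∃ T : X → X, d.Good T ∧ ∀ Q, d.ch c Q = T (d.ch c' Q)) :
    d.Good (d.ch c) := by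
  refine ⟨?_, d.disp_ch c, d.bm_ch c⟩
  have h1 : Ctl Coc.D (fun a Q => avg fun c' => d.e a (d.ch c' Q) (d.ch c Q) -
      a.tri (d.g Q) (d.g (d.ch c' Q)) (d.g (d.ch c Q))) := by
    unfold avg
    apply Ctl.const_mul
    apply Ctl.sum Coc.D_mono
    intro c' _
    obtain ⟨T, hT, hc⟩ := hT c'
    apply Ctl.sub Coc.D_mono
    · have := hT.1.comp (d.bm_ch c')
      simpa only [← hc] using this
    · exact ctl_D d.bm (d.disp_ch c') ((d.disp_ch c').symm.trans (d.disp_ch c))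
  convert h1 using 3 with a Q
  have h2 : ∀ c', d.e a Q (d.ch c Q) = d.e a Q (d.ch c' Q) + (d.e a (d.ch c' Q) (d.ch c Q) -
      a.tri (d.g Q) (d.g (d.ch c' Q)) (d.g (d.ch c Q))) := fun c' => by
    rw [d.e_tri a Q (d.ch c' Q)]; ring
  rw [← d.avg_const (d.e a Q (d.ch c Q))]
  conv_lhs => arg 1; ext c'; rw [h2 c']
  rw [avg_add, d.avg_e, zero_add]

lemma good_par (hch : ∀ c, d.Good (d.ch c)) (par : X → X) (hp : BM par) (c : X → ι)
    (hc : ∀ Q, d.ch (c Q) (par Q) = Q) : d.Good par := by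
  classical
  refine ⟨?_, ?_, hp⟩
  · have h1 : Ctl Coc.D (fun a Q => ∑ c', |d.e a (par Q) (d.ch c' (par Q))|) :=
      Ctl.sum Coc.D_mono _ fun c' _ => ((hch c').1.comp hp).abs
    refine h1.mono fun a Q => ?_
    rw [d.e_anti, abs_neg]
    refine le_trans ?_ (le_abs_self _)
    refine le_trans (le_of_eq ?_) (Finset.single_le_sum
      (f := fun c' => |d.e a (par Q) (d.ch c' (par Q))|) (fun _ _ => abs_nonneg _)
      (Finset.mem_univ (c Q)))
    simp only [hc]
  · choose S hS using d.disp_ch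
    refine Disp.symm ⟨Finset.univ.biUnion S, fun Q => Finset.mem_biUnion.2 ⟨c Q, Finset.mem_univ _, ?_⟩⟩
    have := hS (c Q) (par Q)
    simpa only [hc] using this

/-- abstract conclusion -/
lemma final (qh : G → X) (hq : BM qh) (hd : Disp (fun h => h) (fun h => d.g (qh h)))
    (S0 : Finset G) (hS : ∀ s ∈ S0, ∃ 𝓜 : Set (X → X), 𝓜.Finite ∧ (∀ T ∈ 𝓜, d.Good T) ∧
      ∀ h, ∃ T ∈ 𝓜, qh (h * s) = T (qh h)) :
    ∃ w : Coc G → G → ℝ, Ctl Coc.I w ∧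
      ∀ s ∈ S0, Ctl Coc.D (fun a h => a.a h (h * s) + w a (h * s) - w a h) := by
  classical
  refine ⟨fun a h => d.v a (qh h) + a.a h (d.g (qh h)), ?_, fun s hs => ?_⟩
  · exact (d.ctl_v.comp hq).add Coc.I_mono (ctl_I (BM.of_inj Function.injective_id) hd)
  obtain ⟨𝓜, hf, hg, hT⟩ := hS s hs
  have hbs : BM (fun h : G => h * s) := BM.of_inj (mul_left_injective s)
  have hds : Disp (fun h : G => h) (fun h => h * s) := ⟨{s}, by simp⟩
  have hds' := hd.comp (fun h => h * s)
  have h1 : Ctl Coc.D (fun a h => d.e a (qh h) (qh (h * s))) := by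
    have : Ctl Coc.D (fun a h => ∑ T ∈ hf.toFinset, |d.e a (qh h) (T (qh h))|) :=
      Ctl.sum Coc.D_mono _ fun T hT => ((hg T (by simpa using hT)).1.comp hq).abs
    refine this.mono fun a h => ?_
    refine le_trans ?_ (le_abs_self _)
    obtain ⟨T, hTM, hT⟩ := hT h
    rw [hT]
    exact Finset.single_le_sum (f := fun T : X → X => |d.e a (qh h) (T (qh h))|) (s := hf.toFinset)
      (fun _ _ => abs_nonneg _) (by simpa using hTM)
  have h2 : Ctl Coc.D (fun a h => a.tri h (h * s) (d.g (qh (h * s)))) :=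
    ctl_D (BM.of_inj Function.injective_id) hds hds'
  have h3 : Ctl Coc.D (fun a h => a.tri h (d.g (qh h)) (d.g (qh (h * s)))) :=
    ctl_D (BM.of_inj Function.injective_id) hd (hd.symm.trans (hds.trans hds'))
  convert (h1.add Coc.D_mono h2).sub Coc.D_mono h3 using 3 with a h
  simp only [e, Coc.tri]
  ring

end Dyad
end coc
end TV

namespace TV
open scoped ENNReal NNReal
section dyadic
variable {q : ℕ}

/-- half space coordinates -/
def hs (y : Fin q → ℝ) (t : ℝ) : LV (q + 1) :=
  (WithLp.toLp 2 (Fin.cons ((1 - (∑ i, y i ^ 2 + t ^ 2)) / (2 * t)) (fun i => y i / t)),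
    (1 + (∑ i, y i ^ 2 + t ^ 2)) / (2 * t))

lemma lB_hs (y y' : Fin q → ℝ) {t t' : ℝ} (ht : 0 < t) (ht' : 0 < t') :
    lB (hs y t) (hs y' t') = (∑ i, (y i - y' i) ^ 2 + t ^ 2 + t' ^ 2) / (2 * t * t') := by
  have h1 : ∑ i, (y i - y' i) ^ 2 = ∑ i, y i ^ 2 + ∑ i, y' i ^ 2 - 2 * ∑ i, y i * y' i := by
    rw [Finset.mul_sum, ← Finset.sum_add_distrib, ← Finset.sum_sub_distrib]
    exact Finset.sum_congr rfl fun i _ => by ring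
  have h2 : ∑ i, y' i / t' * (y i / t) = (∑ i, y i * y' i) / (t * t') := by
    rw [Finset.sum_div]
    exact Finset.sum_congr rfl fun i _ => by field_simp
  simp only [lB, hs, PiLp.inner_apply, Fin.sum_univ_succ, Fin.cons_zero, Fin.cons_succ,
    RCLike.inner_apply, conj_trivial, h1, h2]
  field_simp
  ring

lemma hs_mem (y : Fin q → ℝ) {t : ℝ} (ht : 0 < t) : hs y t ∈ hyp (q + 1) := by
  refine ⟨?_, ?_⟩
  · rw [lB_hs y y ht ht]; simp; field_simp; norm_num
  · simp only [hs]
    have : 0 ≤ ∑ i, y i ^ 2 := Finset.sum_nonneg fun i _ => sq_nonneg _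
    positivity

lemma exists_hs {x : LV (q + 1)} (hx : x ∈ hyp (q + 1)) :
    ∃ (y : Fin q → ℝ) (t : ℝ), 0 < t ∧ x = hs y t := by
  have h1 := hyp_norm hx
  rw [EuclideanSpace.real_norm_sq_eq, Fin.sum_univ_succ] at h1
  have h0 : 0 ≤ ∑ i : Fin q, x.1 i.succ ^ 2 := Finset.sum_nonneg fun i _ => sq_nonneg _
  have hp := hx.2
  have h2 : 0 < x.2 + x.1 0 := by
    by_contra! h
    nlinarith
  set w := x.2 + x.1 0 with hw
  have hs1 : ∑ i : Fin q, (w⁻¹ * x.1 i.succ) ^ 2 = (∑ i : Fin q, x.1 i.succ ^ 2) / w ^ 2 := by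
    rw [Finset.sum_div]
    exact Finset.sum_congr rfl fun i _ => by field_simp
  have hs2 : ∑ i : Fin q, x.1 i.succ ^ 2 = w * (x.2 - x.1 0) - 1 := by rw [hw]; linarith
  refine ⟨fun i => w⁻¹ * x.1 i.succ, w⁻¹, by positivity, ?_⟩
  refine Prod.ext ?_ ?_
  · ext i
    refine Fin.cases ?_ (fun i => ?_) i
    · simp only [hs, Fin.cons_zero, hs1, hs2]
      field_simp; rw [hw]; ring
    · simp only [hs, Fin.cons_succ]
      field_simp
  · simp only [hs, hs1, hs2]
    field_simp; rw [hw]; ring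

/-- index set -/
abbrev XX (q : ℕ) := ℤ × (Fin q → ℤ)

/-- size -/
def usz (j : ℤ) : ℝ := (2 : ℝ) ^ (-j)

lemma usz_pos (j : ℤ) : 0 < usz j := by unfold usz; positivity

/-- center -/
def pt (Q : XX q) : LV (q + 1) := hs (fun i => usz Q.1 * Q.2 i) (usz Q.1)

lemma pt_mem (Q : XX q) : pt Q ∈ hyp (q + 1) := hs_mem _ (usz_pos _)

/-- child -/
def chd (c : Fin q → Bool) (Q : XX q) : XX q := (Q.1 + 1, fun i => 2 * Q.2 i + (if c i then 1 else 0))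

/-- translation -/
def trl (u : Fin q → ℤ) : XX q ≃ XX q where
  toFun Q := (Q.1, fun i => Q.2 i + u i)
  invFun Q := (Q.1, fun i => Q.2 i - u i)
  left_inv Q := by simp
  right_inv Q := by simp

/-- parent -/
def prt (Q : XX q) : XX q := (Q.1 - 1, fun i => Q.2 i / 2)

/-- digits -/
def dig (Q : XX q) : Fin q → Bool := fun i => decide (Q.2 i % 2 = 1)

lemma chd_prt (Q : XX q) : chd (dig Q) (prt Q) = Q := by
  refine Prod.ext ?_ ?_
  · simp [chd, prt]
  · ext i
    simp only [chd, prt, dig, decide_eq_true_eq]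
    split_ifs <;> omega

lemma chd_inj : Function.Injective fun p : (Fin q → Bool) × XX q => chd p.1 p.2 := by
  rintro ⟨c, j, z⟩ ⟨c', j', z'⟩ h
  simp only [chd, Prod.mk.injEq, add_left_inj] at h
  obtain ⟨h1, h2⟩ := h
  have h3 : ∀ i, c i = c' i ∧ z i = z' i := fun i => by
    have := congrFun h2 i
    cases hc : c i <;> cases hc' : c' i <;> simp [hc, hc'] at this ⊢ <;> omega
  simp only [Prod.mk.injEq]
  exact ⟨funext fun i => (h3 i).1, h1, funext fun i => (h3 i).2⟩

/-- vertical move -/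
def vmv (i : ℤ) : XX q → XX q :=
  if 0 ≤ i then (chd fun _ => false)^[i.toNat] else prt^[(-i).toNat]

lemma chd_iter (n : ℕ) (Q : XX q) :
    (chd fun _ => false)^[n] Q = (Q.1 + n, fun i => 2 ^ n * Q.2 i) := by
  induction n with
  | zero => simp
  | succ n ih =>
    rw [Function.iterate_succ_apply', ih]
    refine Prod.ext (by simp [chd]; ring) (by ext i; simp [chd]; ring)

lemma prt_iter (n : ℕ) (Q : XX q) :
    prt^[n] Q = (Q.1 - n, fun i => Q.2 i / 2 ^ n) := by
  induction n with
  | zero => simp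
  | succ n ih =>
    rw [Function.iterate_succ_apply', ih]
    refine Prod.ext (by simp [prt]; ring) ?_
    ext i
    simp only [prt]
    rw [Int.ediv_ediv_of_nonneg (by positivity), pow_succ]

lemma vmv_fst (i : ℤ) (Q : XX q) : (vmv i Q).1 = Q.1 + i := by
  unfold vmv
  split_ifs with h
  · rw [chd_iter]; simp [h]
  · rw [prt_iter]; simp; omega

lemma vmv_snd (i : ℤ) (Q : XX q) (k : Fin q) :
    |((vmv i Q).2 k : ℝ) - 2 ^ i * Q.2 k| ≤ 1 := by
  unfold vmv
  split_ifs with h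
  · rw [chd_iter]
    obtain ⟨n, rfl⟩ := Int.eq_ofNat_of_zero_le h
    simp
  · rw [prt_iter]
    obtain ⟨n, hn⟩ := Int.eq_ofNat_of_zero_le (show 0 ≤ -i by omega)
    obtain rfl : i = -n := by omega
    simp only [neg_neg, Int.toNat_natCast, zpow_neg, zpow_natCast]
    have h1 := Int.emod_add_mul_ediv (Q.2 k) (2 ^ n)
    have h2 := Int.emod_nonneg (Q.2 k) (show (2 : ℤ) ^ n ≠ 0 by positivity)
    have h3 := Int.emod_lt_of_pos (Q.2 k) (show (0 : ℤ) < 2 ^ n by positivity)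
    set r := Q.2 k % 2 ^ n
    have h1' : (Q.2 k : ℝ) = r + 2 ^ n * ((Q.2 k / 2 ^ n : ℤ) : ℝ) := by
      have := congrArg (Int.cast : ℤ → ℝ) h1
      push_cast at this ⊢; linarith
    have hp : (0 : ℝ) < 2 ^ n := by positivity
    have e : (((Q.2 k / 2 ^ n : ℤ) : ℝ)) - ((2 : ℝ) ^ n)⁻¹ * Q.2 k = - (r / 2 ^ n) := by
      rw [h1']; field_simp; ring
    rw [e, abs_neg, abs_of_nonneg (by positivity), div_le_one hp]
    have : (r : ℝ) < ((2 ^ n : ℤ) : ℝ) := by exact_mod_cast h3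
    push_cast at this; exact this.le

/-- relative position -/
def rel (Q Q' : XX q) : XX q := (Q'.1 - Q.1, fun k => Q'.2 k - (vmv (Q'.1 - Q.1) Q).2 k)

lemma rel_spec (Q Q' : XX q) : Q' = trl (rel Q Q').2 (vmv (rel Q Q').1 Q) := by
  refine Prod.ext ?_ ?_
  · simp [trl, rel, vmv_fst]
  · ext k; simp [trl, rel]

lemma rel_inj (Q : XX q) : Function.Injective (rel Q) := fun Q' Q'' h => by
  rw [rel_spec Q Q', rel_spec Q Q'', h]

lemma lB_pt (Q Q' : XX q) : lB (pt Q) (pt Q') =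
    (∑ i, (usz Q.1 * Q.2 i - usz Q'.1 * Q'.2 i) ^ 2 + usz Q.1 ^ 2 + usz Q'.1 ^ 2) /
      (2 * usz Q.1 * usz Q'.1) := lB_hs _ _ (usz_pos _) (usz_pos _)

lemma usz_add (j i : ℤ) : usz (j + i) = usz j * (2 ^ i)⁻¹ := by
  unfold usz
  rw [neg_add, zpow_add₀ (by norm_num), zpow_neg 2 i]

lemma rel_finite (M : ℝ) : ∃ B : Set (XX q), B.Finite ∧ ∀ Q Q' : XX q, lB (pt Q) (pt Q') ≤ M →
    rel Q Q' ∈ B := by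
  obtain ⟨I, hI⟩ := pow_unbounded_of_one_lt (2 * M) (one_lt_two (α := ℝ))
  set K : ℤ := ⌈2 * M + 1⌉
  refine ⟨Set.Icc (-(I : ℤ)) I ×ˢ Set.Icc (fun _ => -K) (fun _ => K),
    (Set.finite_Icc _ _).prod (Set.finite_Icc _ _), fun Q Q' h => ?_⟩
  set i := Q'.1 - Q.1 with hi
  have hQ' : Q'.1 = Q.1 + i := by omega
  set u := usz Q.1 with hu
  have hup : 0 < u := usz_pos _
  set w : ℝ := 2 ^ i with hw
  have hwp : 0 < w := by positivity
  have hM : 1 ≤ M := (one_le_lB (pt_mem Q) (pt_mem Q')).trans h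
  rw [lB_pt, hQ', usz_add, ← hu, ← hw] at h
  rw [div_le_iff₀ (by positivity)] at h
  have hsum : ∑ k, (u * Q.2 k - u * w⁻¹ * Q'.2 k) ^ 2 =
      (u * w⁻¹) ^ 2 * ∑ k, (Q'.2 k - w * Q.2 k : ℝ) ^ 2 := by
    rw [Finset.mul_sum]
    exact Finset.sum_congr rfl fun k _ => by field_simp; ring
  rw [hsum] at h
  set sg := ∑ k, (Q'.2 k - w * Q.2 k : ℝ) ^ 2 with hsg
  have hsg0 : 0 ≤ sg := Finset.sum_nonneg fun _ _ => sq_nonneg _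
  have h' : sg + w ^ 2 + 1 ≤ M * 2 * w := by
    have e1 : (u * w⁻¹) ^ 2 * sg + u ^ 2 + (u * w⁻¹) ^ 2 = (u * w⁻¹) ^ 2 * (sg + w ^ 2 + 1) := by
      field_simp
    have e2 : M * (2 * u * (u * w⁻¹)) = (u * w⁻¹) ^ 2 * (M * 2 * w) := by field_simp
    rw [e1, e2] at h
    exact le_of_mul_le_mul_left h (by positivity)
  have hw1 : w ≤ 2 * M := by nlinarith
  have hw2 : 1 ≤ 2 * M * w := by nlinarith
  have hiI : i ≤ I := by
    by_contra! hc
    have : (2 : ℝ) ^ (I : ℤ) ≤ w := zpow_le_zpow_right₀ (by norm_num) hc.le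
    rw [zpow_natCast] at this; linarith
  have hiI' : -(I : ℤ) ≤ i := by
    by_contra! hc
    have : w ≤ (2 : ℝ) ^ (-(I : ℤ)) := zpow_le_zpow_right₀ (by norm_num) hc.le
    rw [zpow_neg, zpow_natCast] at this
    have h3 : w * 2 ^ I ≤ 1 := by
      have := mul_le_mul_of_nonneg_right this (show (0:ℝ) ≤ 2 ^ I by positivity)
      rwa [inv_mul_cancel₀ (by positivity)] at this
    nlinarith
  have hk : ∀ k, |((rel Q Q').2 k : ℝ)| ≤ K := fun k => by
    have h1 := vmv_snd i Q k
    have h2 : (Q'.2 k - w * Q.2 k : ℝ) ^ 2 ≤ sg :=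
      Finset.single_le_sum (f := fun k => (Q'.2 k - w * Q.2 k : ℝ) ^ 2)
        (fun _ _ => sq_nonneg _) (Finset.mem_univ k)
    have h3 : |(Q'.2 k - w * Q.2 k : ℝ)| ≤ 2 * M := abs_le_of_sq_le_sq (by nlinarith) (by linarith)
    have h4 : ((rel Q Q').2 k : ℝ) = (Q'.2 k - w * Q.2 k) - ((vmv i Q).2 k - 2 ^ i * Q.2 k) := by
      simp only [rel]; push_cast; rw [← hi, ← hw]; ring
    rw [h4]
    calc _ ≤ |(Q'.2 k - w * Q.2 k : ℝ)| + |((vmv i Q).2 k : ℝ) - 2 ^ i * Q.2 k| := abs_sub _ _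
      _ ≤ 2 * M + 1 := by linarith
      _ ≤ K := Int.le_ceil _
  refine ⟨⟨hiI', hiI⟩, ?_, ?_⟩
  · intro k; have := (abs_le.1 (hk k)).1; exact_mod_cast this
  · intro k; have := (abs_le.1 (hk k)).2; exact_mod_cast this

lemma lB_chd (c : Fin q → Bool) (Q : XX q) : lB (pt Q) (pt (chd c Q)) ≤ q + 2 := by
  have hup := usz_pos Q.1
  rw [lB_pt]
  simp only [chd]
  rw [usz_add]
  set u := usz Q.1
  rw [div_le_iff₀ (by positivity)]
  have : ∑ k, (u * Q.2 k - u * (2 ^ (1:ℤ))⁻¹ * ((2 * Q.2 k + (if c k then 1 else 0) : ℤ) : ℝ)) ^ 2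
      ≤ ∑ k : Fin q, u ^ 2 := by
    refine Finset.sum_le_sum fun k _ => ?_
    push_cast
    split_ifs <;> ring_nf <;> nlinarith [sq_nonneg u]
  simp only [Finset.sum_const, Finset.card_univ, Fintype.card_fin, nsmul_eq_mul] at this
  norm_num at this ⊢
  nlinarith [sq_nonneg u]

lemma lB_trl (w : Fin q → ℤ) (Q : XX q) :
    lB (pt Q) (pt (trl w Q)) = (∑ i, (w i : ℝ) ^ 2 + 2) / 2 := by
  have hup := usz_pos Q.1
  rw [lB_pt]
  simp only [trl, Equiv.coe_fn_mk]
  set u := usz Q.1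
  have : ∑ k, (u * Q.2 k - u * ((Q.2 k + w k : ℤ) : ℝ)) ^ 2 = u ^ 2 * ∑ k, (w k : ℝ) ^ 2 := by
    rw [Finset.mul_sum]
    refine Finset.sum_congr rfl fun k _ => by push_cast; ring
  rw [this]; field_simp; ring

lemma exists_pt {x : LV (q + 1)} (hx : x ∈ hyp (q + 1)) : ∃ Q : XX q, lB (pt Q) x ≤ q + 3 := by
  obtain ⟨y, t, ht, rfl⟩ := exists_hs hx
  obtain ⟨n, h1, h2⟩ := exists_mem_Ico_zpow ht (one_lt_two (α := ℝ))
  have hu : usz (-n) = 2 ^ n := by simp [usz]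
  refine ⟨(-n, fun i => ⌊y i / 2 ^ n⌋), ?_⟩
  simp only [pt]
  rw [lB_hs _ _ (usz_pos _) ht, hu]
  rw [zpow_add₀ (by norm_num), zpow_one] at h2
  set u : ℝ := 2 ^ n
  have hup : 0 < u := by positivity
  rw [div_le_iff₀ (by positivity)]
  have : ∑ k, (u * ⌊y k / u⌋ - y k) ^ 2 ≤ ∑ k : Fin q, u ^ 2 := by
    refine Finset.sum_le_sum fun k _ => ?_
    have a1 := Int.floor_le (y k / u)
    have a2 := Int.lt_floor_add_one (y k / u)
    rw [le_div_iff₀ hup] at a1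
    rw [div_lt_iff₀ hup] at a2
    apply sq_le_sq'  <;> linarith
  simp only [Finset.sum_const, Finset.card_univ, Fintype.card_fin, nsmul_eq_mul] at this
  have hq : (0:ℝ) ≤ q := by positivity
  have h3 : u ^ 2 ≤ u * t := by nlinarith
  have h4 : t ^ 2 ≤ 2 * (u * t) := by nlinarith
  nlinarith [mul_nonneg hq (mul_pos hup ht).le, mul_le_mul_of_nonneg_left h3 hq]

theorem rigid {G : Type*} [Group G] (hq : 2 ≤ q) {A : G →* lG (q + 1)} (hA : IsLat A)
    (S0 : Finset G) :
    ∃ w : Coc G → G → ℝ, Ctl Coc.I w ∧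
      ∀ s ∈ S0, Ctl Coc.D (fun a h => a.a h (h * s) + w a (h * s) - w a h) := by
  classical
  obtain ⟨R, hR1, hR⟩ := hA.exists_near
  choose! gx hgx using hR
  choose! qx hqx using fun (x : LV (q + 1)) (hx : x ∈ hyp (q + 1)) => exists_pt hx
  let g : XX q → G := fun Q => gx (pt Q)
  have hg : ∀ Q, lB (pt Q) (A (g Q) ⊙ lo) ≤ R := fun Q => hgx _ (pt_mem Q)
  let qh : G → XX q := fun h => qx (A h ⊙ lo)
  have hqh : ∀ h, lB (pt (qh h)) (A h ⊙ lo) ≤ q + 3 := fun h => hqx _ (act_mem _ lo_mem)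
  have disp : ∀ (T : XX q → XX q) (M : ℝ), (∀ Q, lB (pt Q) (pt (T Q)) ≤ M) →
      Disp g (fun Q => g (T Q)) := fun T M hM => by
    refine ⟨(hA.fin (2 * R * (2 * M * R))).toFinset, fun Q => ?_⟩
    simp only [Set.Finite.mem_toFinset, Set.mem_ofPred_eq]
    rw [map_mul, map_inv]
    exact near_mul' (by linarith) (by linarith) (pt_mem Q) (pt_mem _) (hg _) (hM Q) (hg _)
  let d : Dyad G (XX q) (Fin q → Bool) (Fin q → ℤ) :=
    { ch := chd
      ch_inj := chd_inj
      card := by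
        simp only [Fintype.card_pi, Fintype.card_bool, Finset.prod_const, Finset.card_univ,
          Fintype.card_fin]
        calc 4 = 2 ^ 2 := by norm_num
          _ ≤ 2 ^ q := Nat.pow_le_pow_right (by norm_num) hq
      τ := trl
      ch_τ := fun c u Q => by
        refine Prod.ext rfl ?_
        ext i; simp [chd, trl]; ring
      g := g
      bm := by
        obtain ⟨B, hB, hB'⟩ := rel_finite (q := q) (2 * R * R)
        refine BM.of_rel B hB rel (fun Q Q' h => hB' _ _ ?_) rel_inj
        have h1 := hg Q
        have h2 := hg Q'
        rw [← h, lB_comm] at h2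
        have h3 := quasi_triangle (pt_mem Q) (act_mem (A (g Q)) lo_mem) (pt_mem Q')
        have h4 := one_le_lB (pt_mem Q) (act_mem (A (g Q)) lo_mem)
        have h5 := one_le_lB (act_mem (A (g Q)) lo_mem) (pt_mem Q')
        nlinarith
      disp_ch := fun c => disp _ _ (lB_chd c)
      disp_τ := fun u => disp _ _ fun Q => (lB_trl u Q).le }
  have gτ : ∀ u, d.Good (trl u) := fun u => d.good_τ u
  have gch : ∀ c, d.Good (chd c) := fun c => d.good_ch c fun c' =>
    ⟨trl (fun i => (if c i then 1 else 0) - (if c' i then 1 else 0)), gτ _, fun Q => by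
      refine Prod.ext rfl ?_
      ext i; simp [d, chd, trl]⟩
  have gpar : d.Good prt := by
    refine d.good_par gch prt ?_ dig chd_prt
    refine BM.of_finite Set.univ Set.finite_univ dig (fun _ => trivial) fun Q Q' h => ?_
    simp only [Prod.mk.injEq] at h
    rw [← chd_prt Q, ← chd_prt Q', h.1, h.2]
  have gv : ∀ i, d.Good (vmv i) := fun i => by
    unfold vmv
    split_ifs
    · exact Dyad.Good.iter d (gch _) _
    · exact Dyad.Good.iter d gpar _
  refine d.final qh ?_ ?_ S0 fun s _ => ?_
  · refine BM.of_rel _ (hA.fin (2 * (q + 3) * (q + 3))) (fun h h' => h⁻¹ * h')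
      (fun h h' e => ?_) (fun h => mul_right_injective _)
    simp only [Set.mem_ofPred_eq, map_mul, map_inv]
    have h2 := hqh h'
    rw [← e] at h2
    exact near_mul (y := lo) (by positivity) (pt_mem _) (hqh h) h2
  · refine ⟨(hA.fin (2 * (q + 3) * R)).toFinset, fun h => ?_⟩
    simp only [Set.Finite.mem_toFinset, Set.mem_ofPred_eq, map_mul, map_inv]
    exact near_mul (y := lo) (by positivity) (pt_mem _) (hqh h) (hg _)
  · obtain ⟨B, hB, hB'⟩ := rel_finite (q := q)
      (2 * (q + 3) * (2 * (A s ⊙ (lo : LV (q + 1))).2 * (q + 3)))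
    refine ⟨(fun p Q => trl p.2 (vmv p.1 Q)) '' B, hB.image _, ?_, fun h => ?_⟩
    · rintro _ ⟨p, _, rfl⟩
      exact Dyad.Good.comp d (gτ _) (gv _)
    · refine ⟨_, ⟨rel (qh h) (qh (h * s)), hB' _ _ ?_, rfl⟩, rel_spec _ _⟩
      have h1 := hqh h
      have h2 := hqh (h * s)
      rw [lB_comm] at h2
      have h3 : lB (A h ⊙ lo) (A (h * s) ⊙ lo) = (A s ⊙ (lo : LV (q + 1))).2 := by
        rw [map_mul, act_mul, lB_act]; simp
      have m1 := pt_mem (qh h)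
      have m2 := pt_mem (qh (h * s))
      have m3 := act_mem (A h) (lo_mem (k := q + 1))
      have m4 := act_mem (A (h * s)) (lo_mem (k := q + 1))
      have h4 := quasi_triangle m1 m3 m2
      have h5 := quasi_triangle m3 m4 m2
      rw [h3] at h5
      have p1 := one_le_lB m1 m3
      have p2 := one_le_lB m3 m2
      have p3 := one_le_lB m4 m2
      have p4 := one_le_snd (act_mem (A s) (lo_mem (k := q + 1)))
      refine h4.trans ?_
      gcongr
      · exact h5.trans (by gcongr)

end dyadic
end TV

namespace TV
open scoped ENNReal NNReal
open MeasureTheory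

instance instMeasLG (k : ℕ) : MeasurableSpace (lG k) := borel _
instance instBorelLG (k : ℕ) : BorelSpace (lG k) := ⟨rfl⟩

/-- Haar measure -/
def hmu (k : ℕ) : Measure (lG k) := Measure.haar

instance (k : ℕ) : (hmu k).IsHaarMeasure := by unfold hmu; infer_instance

/-- soft threshold -/
def sth (t : ℝ) : ℝ := max (t - 1/2) 0 - max (-t - 1/2) 0

lemma sth_cont : Continuous sth := by unfold sth; fun_prop

lemma sth_neg (t : ℝ) : sth (-t) = - sth t := by unfold sth; rw [neg_neg]; ring

lemma sth_lip (s t : ℝ) : |sth s - sth t| ≤ |s - t| := by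
  unfold sth
  rcases max_cases (s - 1/2) 0 with h1 | h1 <;> rcases max_cases (-s - 1/2) 0 with h2 | h2 <;>
  rcases max_cases (t - 1/2) 0 with h3 | h3 <;> rcases max_cases (-t - 1/2) 0 with h4 | h4 <;>
  rw [h1.1, h2.1, h3.1, h4.1] <;> rcases abs_cases (s - t) with h | h <;> rw [h.1, abs_le] <;>
  constructor <;> linarith

lemma sth_zero {t : ℝ} (h : |t| ≤ 1/2) : sth t = 0 := by
  unfold sth
  rw [abs_le] at h
  rw [max_eq_right (by linarith), max_eq_right (by linarith)]; simp

lemma sth_le (t : ℝ) : |sth t| ≤ |t| := by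
  have := sth_lip t 0
  rwa [sth_zero (t := 0) (by simp), sub_zero, sub_zero] at this

lemma sth_ge {t : ℝ} (h : 1 ≤ t) : 1/2 ≤ sth t := by
  unfold sth
  rw [max_eq_left (by linarith), max_eq_right (by linarith)]; linarith

lemma sth_defect {a b c : ℝ} (h : a + b + c = 0) : |sth a + sth b + sth c| ≤ 2 * |c| := by
  have h1 := sth_lip a (-b)
  rw [sth_neg] at h1
  have h2 := sth_le c
  have h3 : |a - -b| = |c| := by rw [show a - -b = -c by linarith, abs_neg]
  calc _ ≤ |sth a - -sth b| + |sth c| := by rw [sub_neg_eq_add]; exact abs_add_le _ _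
    _ ≤ _ := by linarith

variable {k : ℕ}

/-- boundary coordinate -/
def kap (p : LV (k + 1)) : ℝ := p.1 0 / p.2

lemma abs_coord_le (p : LV (k + 1)) : |p.1 0| ≤ ‖p.1‖ := by
  have := PiLp.norm_apply_le p.1 0
  simpa using this

lemma abs_kap_le {p : LV (k + 1)} (hp : p ∈ hyp (k + 1)) : |kap p| ≤ 1 := by
  unfold kap
  rw [abs_div, abs_of_pos hp.2, div_le_one hp.2]
  have h1 := hyp_norm hp
  exact (abs_coord_le p).trans
    ((pow_le_pow_iff_left₀ (norm_nonneg _) hp.2.le two_ne_zero).1 (by linarith))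

lemma kap_sub_sq {p q : LV (k + 1)} (hp : p ∈ hyp (k + 1)) (hq : q ∈ hyp (k + 1)) :
    (kap p - kap q) ^ 2 ≤ 2 * lB p q / (p.2 * q.2) := by
  have h1 := hyp_norm hp
  have h2 := hyp_norm hq
  have hp2 := hp.2
  have hq2 := hq.2
  set v : Euc (k + 1) := p.2⁻¹ • p.1 - q.2⁻¹ • q.1 with hv
  have hv0 : v 0 = kap p - kap q := by
    simp [hv, kap]; ring
  have h3 : ‖v‖ ^ 2 = 2 * lB p q / (p.2 * q.2) - 1 / p.2 ^ 2 - 1 / q.2 ^ 2 := by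
    rw [hv, norm_sub_sq_real, norm_smul, norm_smul, mul_pow, mul_pow, h1, h2, real_inner_smul_left,
      real_inner_smul_right, norm_inv, norm_inv, Real.norm_of_nonneg hp2.le,
      Real.norm_of_nonneg hq2.le]
    unfold lB
    field_simp; ring
  have h4 : (v 0) ^ 2 ≤ ‖v‖ ^ 2 := by
    have := PiLp.norm_apply_le v 0
    rw [← sq_abs, ← Real.norm_eq_abs]
    gcongr
  rw [← hv0]
  have : 0 ≤ 1 / p.2 ^ 2 := by positivity
  have : 0 ≤ 1 / q.2 ^ 2 := by positivity
  linarith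

/-- the kernel -/
def ker (x y : LV (k + 1)) (g : lG (k + 1)) : ℝ := sth (kap (g⁻¹ ⊙ x) - kap (g⁻¹ ⊙ y))

lemma ker_anti (x y : LV (k + 1)) (g : lG (k + 1)) : ker x y g = - ker y x g := by
  unfold ker; rw [← sth_neg, neg_sub]

lemma ker_act (x y : LV (k + 1)) (h g : lG (k + 1)) : ker (h ⊙ x) (h ⊙ y) (h * g) = ker x y g := by
  unfold ker
  rw [mul_inv_rev, act_mul, act_mul, inv_act_act, inv_act_act]

lemma kap_cont {x : LV (k + 1)} (hx : x ∈ hyp (k + 1)) :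
    Continuous fun g : lG (k + 1) => kap (g⁻¹ ⊙ x) := by
  unfold kap
  have h1 : Continuous fun g : lG (k + 1) => g⁻¹ ⊙ x := (continuous_act_left x).comp continuous_inv
  have h2 : Continuous fun g : lG (k + 1) => (g⁻¹ ⊙ x).1 := continuous_fst.comp h1
  have h3 : Continuous fun g : lG (k + 1) => (g⁻¹ ⊙ x).1 0 := by fun_prop
  exact h3.div (continuous_snd.comp h1) fun g => (act_mem _ hx).2.ne'

lemma ker_cont {x y : LV (k + 1)} (hx : x ∈ hyp (k + 1)) (hy : y ∈ hyp (k + 1)) :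
    Continuous (ker x y) := sth_cont.comp ((kap_cont hx).sub (kap_cont hy))

lemma abs_ker_le {x y : LV (k + 1)} (hx : x ∈ hyp (k + 1)) (hy : y ∈ hyp (k + 1)) (g) :
    |ker x y g| ≤ 2 := by
  refine (sth_le _).trans ((abs_sub _ _).trans ?_)
  have := abs_kap_le (act_mem g⁻¹ hx)
  have := abs_kap_le (act_mem g⁻¹ hy)
  linarith

lemma kapg_sub_sq {x y : LV (k + 1)} (hx : x ∈ hyp (k + 1)) (hy : y ∈ hyp (k + 1))
    (g : lG (k + 1)) : (kap (g⁻¹ ⊙ x) - kap (g⁻¹ ⊙ y)) ^ 2 ≤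
      2 * lB x y / (lB (g ⊙ lo) x * lB (g ⊙ lo) y) := by
  have := kap_sub_sq (act_mem g⁻¹ hx) (act_mem g⁻¹ hy)
  rw [lB_act] at this
  rwa [← lB_lo, ← lB_lo, lB_inv_act, lB_inv_act, lB_comm x (g ⊙ lo),
    lB_comm y (g ⊙ lo)] at this

/-- ball -/
def bll (x : LV (k + 1)) (K : ℝ) : Set (lG (k + 1)) := {g | lB (g ⊙ lo) x ≤ K}

lemma bll_closed (x : LV (k + 1)) (K : ℝ) : IsClosed (bll x K) := by
  have : Continuous fun g : lG (k + 1) => lB (g ⊙ lo) x := by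
    have h1 := continuous_act_left (k := k + 1) lo
    exact lB_continuous.comp (h1.prodMk continuous_const)
  exact isClosed_le this continuous_const

lemma bll_meas {x : LV (k + 1)} (hx : x ∈ hyp (k + 1)) (K : ℝ) :
    hmu (k + 1) (bll x K) = hmu (k + 1) (bll lo K) := by
  obtain ⟨h, hh⟩ := exists_transl hx
  have : bll x K = (fun g => h * g) ⁻¹' (bll lo K) := by
    ext g
    simp only [bll, Set.mem_ofPred_eq, Set.mem_preimage, act_mul]
    rw [← hh, lB_act]
  rw [this, measure_preimage_mul]

lemma bll_fin (K : ℝ) : hmu (k + 1) (bll lo K) < ⊤ := by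
  have : bll (lo : LV (k + 1)) K = {A | (A ⊙ lo).2 ≤ K} := by
    ext g; simp [bll]
  rw [this]
  exact (isCompact_ball K).measure_lt_top

lemma lB_geo_geo (a b : ℝ) : lB (geo a : LV (k + 1)) (geo b) = Real.cosh (b - a) := by
  simp only [lB, geo, real_inner_smul_left, real_inner_smul_right, real_inner_self_eq_norm_sq,
    norm_e0, Real.cosh_sub]; ring

/-- coefficients along the geodesic -/
lemma lB_geo_coef {P : LV (k + 1)} (hP : P ∈ hyp (k + 1)) : ∃ α β : ℝ, 0 < α ∧ 0 < β ∧
    ∀ s, lB P (geo s) = α * Real.exp s + β * Real.exp (-s) := by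
  have h1 := hyp_norm hP
  have h2 := abs_coord_le P
  have h3 := hP.2
  have h4 : ‖P.1‖ < P.2 := by
    apply lt_of_pow_lt_pow_left₀ 2 h3.le; linarith
  have h5 := abs_lt.1 (h2.trans_lt h4)
  refine ⟨(P.2 - P.1 0) / 2, (P.2 + P.1 0) / 2, by linarith, by linarith, fun s => ?_⟩
  simp only [lB, geo, real_inner_smul_right, inner_e0, Real.cosh_eq, Real.sinh_eq]
  ring

/-- along a geodesic, the minimum in integers -/
lemma exists_near_geo {α β D c : ℝ} (hα : 0 < α) (hβ : 0 < β) (hD : 0 ≤ D) (hc : 1 ≤ c)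
    (h : (α + β) * (α * Real.exp D + β * Real.exp (-D)) ≤ c * Real.exp D) :
    ∃ i : ℕ, (i : ℝ) ≤ D ∧ α * Real.exp i + β * Real.exp (-i) ≤ 6 * c := by
  have hE := Real.exp_pos D
  have hE' : Real.exp (-D) = (Real.exp D)⁻¹ := Real.exp_neg D
  have hαα : α * α ≤ c := by
    have : α * α * Real.exp D ≤ c * Real.exp D := by
      refine le_trans ?_ h
      have : 0 < Real.exp (-D) := Real.exp_pos _
      nlinarith [mul_pos hα hβ, mul_pos (mul_pos hα hβ) hE, mul_pos (mul_pos hα hβ) this,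
        mul_pos (mul_pos hβ hβ) this]
    exact le_of_mul_le_mul_right this hE
  have hαβ : α * β ≤ c := by
    have : α * β * Real.exp D ≤ c * Real.exp D := by
      refine le_trans ?_ h
      have : 0 < Real.exp (-D) := Real.exp_pos _
      nlinarith [mul_pos hα hβ, mul_pos (mul_pos hα hα) hE, mul_pos (mul_pos hα hβ) this,
        mul_pos (mul_pos hβ hβ) this]
    exact le_of_mul_le_mul_right this hE
  have hββ : (β * Real.exp (-D)) * (β * Real.exp (-D)) ≤ c := by
    have : (β * Real.exp (-D)) * (β * Real.exp (-D)) * Real.exp D ≤ c * Real.exp D := by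
      refine le_trans ?_ h
      have h0 : 0 < Real.exp (-D) := Real.exp_pos _
      have e : (β * Real.exp (-D)) * (β * Real.exp (-D)) * Real.exp D = β * β * Real.exp (-D) := by
        rw [hE']; field_simp
      rw [e]
      nlinarith [mul_pos hα hβ, mul_pos (mul_pos hα hα) hE, mul_pos (mul_pos hα hβ) h0,
        mul_pos (mul_pos hα hβ) hE]
    exact le_of_mul_le_mul_right this hE
  -- real point
  obtain ⟨s, hs0, hsD, hs⟩ : ∃ s : ℝ, 0 ≤ s ∧ s ≤ D ∧
      α * Real.exp s + β * Real.exp (-s) ≤ 2 * c := by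
    rcases le_total β α with h1 | h1
    · refine ⟨0, le_rfl, hD, ?_⟩
      simp; nlinarith
    rcases le_total (α * Real.exp D) (β * Real.exp (-D)) with h2 | h2
    · refine ⟨D, hD, le_rfl, ?_⟩
      have : 0 < β * Real.exp (-D) := by positivity
      nlinarith
    · have hr : 0 < β / α := by positivity
      refine ⟨Real.log (β / α) / 2, ?_, ?_, ?_⟩
      · have := Real.log_nonneg ((one_le_div hα).2 h1); linarith
      · have : β / α ≤ Real.exp (2 * D) := by
          rw [div_le_iff₀ hα]
          have e : Real.exp (2 * D) = Real.exp D * Real.exp D := by rw [← Real.exp_add]; ring_nf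
          rw [hE', ← div_eq_mul_inv, div_le_iff₀ hE] at h2
          rw [e]; linarith
        have := (Real.log_le_iff_le_exp hr).2 this
        linarith
      · set e := Real.exp (Real.log (β / α) / 2) with he
        have hep : 0 < e := Real.exp_pos _
        have e2 : e * e = β / α := by
          rw [he, ← Real.exp_add, add_halves, Real.exp_log hr]
        rw [Real.exp_neg, ← he]
        have e3 : β = α * (e * e) := by rw [e2]; field_simp
        have e4 : α * e + β * e⁻¹ = 2 * (α * e) := by rw [e3]; field_simp; ring
        rw [e4]
        have e5 : (α * e) * (α * e) ≤ c := by
          have : (α * e) * (α * e) = α * β := by rw [e3]; ring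
          rw [this]; exact hαβ
        have : 0 < α * e := by positivity
        nlinarith
  refine ⟨⌊s⌋₊, (Nat.floor_le hs0).trans hsD, ?_⟩
  have f1 := Nat.floor_le hs0
  have f2 := (Nat.lt_floor_add_one s).le
  set i : ℝ := (⌊s⌋₊ : ℝ)
  have g1 : Real.exp i ≤ Real.exp s := Real.exp_le_exp.2 f1
  have g2 : Real.exp (-i) ≤ 3 * Real.exp (-s) := by
    have : Real.exp (-i) ≤ Real.exp (1 + -s) := Real.exp_le_exp.2 (by linarith)
    rw [Real.exp_add] at this
    have h3 := Real.exp_one_lt_d9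
    have := Real.exp_pos (-s)
    nlinarith
  have p1 := Real.exp_pos s
  have p2 := Real.exp_pos (-s)
  calc α * Real.exp i + β * Real.exp (-i) ≤ α * Real.exp s + β * (3 * Real.exp (-s)) := by gcongr
    _ ≤ 3 * (α * Real.exp s + β * Real.exp (-s)) := by nlinarith [mul_pos hα p1]
    _ ≤ _ := by linarith

lemma cosh_le_exp {D : ℝ} (hD : 0 ≤ D) : Real.cosh D ≤ Real.exp D := by
  rw [Real.cosh_eq]
  have : Real.exp (-D) ≤ Real.exp D := Real.exp_le_exp.2 (by linarith)
  linarith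

lemma exp_le_cosh (D : ℝ) : Real.exp D ≤ 2 * Real.cosh D := by
  rw [Real.cosh_eq]; have := Real.exp_pos (-D); linarith

/-- where the kernel is supported -/
lemma exists_ball {D : ℝ} (hD : 0 ≤ D) (g : lG (k + 1))
    (h : 1/2 < |kap (g⁻¹ ⊙ (geo 0 : LV (k + 1))) - kap (g⁻¹ ⊙ geo D)|) :
    ∃ i : ℕ, (i : ℝ) ≤ D ∧ g ∈ bll (geo i : LV (k + 1)) 48 := by
  have hP : g ⊙ (lo : LV (k + 1)) ∈ hyp (k + 1) := act_mem g lo_mem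
  obtain ⟨α, β, hα, hβ, hc⟩ := lB_geo_coef hP
  have h1 := kapg_sub_sq (geo_mem 0) (geo_mem D) g
  rw [lB_geo_geo, hc, hc, ← sq_abs] at h1
  simp only [neg_zero, Real.exp_zero, mul_one, sub_zero] at h1
  have hE : 0 < Real.exp D := Real.exp_pos _
  have hE' : 0 < Real.exp (-D) := Real.exp_pos _
  rw [le_div_iff₀ (by positivity)] at h1
  have h2 : (1/4 : ℝ) ≤ |kap (g⁻¹ ⊙ (geo 0 : LV (k + 1))) - kap (g⁻¹ ⊙ geo D)| ^ 2 := by nlinarith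
  have h3 := cosh_le_exp hD
  have h4 : 0 ≤ (α + β) * (α * Real.exp D + β * Real.exp (-D)) := by positivity
  obtain ⟨i, hi, hi'⟩ := exists_near_geo (c := 8) hα hβ hD (by norm_num) (by nlinarith)
  exact ⟨i, hi, by simp only [bll, Set.mem_ofPred_eq]; rw [hc]; linarith⟩

lemma lintegral_ker_act (x y : LV (k + 1)) (h : lG (k + 1)) :
    ∫⁻ g, ‖ker (h ⊙ x) (h ⊙ y) g‖ₑ ∂(hmu (k + 1)) = ∫⁻ g, ‖ker x y g‖ₑ ∂(hmu (k + 1)) := by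
  rw [← lintegral_mul_left_eq_self _ h]
  simp only [ker_act]

lemma enorm_le_of_abs {a b : ℝ} (h : |a| ≤ b) : ‖a‖ₑ ≤ ENNReal.ofReal b := by
  rw [Real.enorm_eq_ofReal_abs]; exact ENNReal.ofReal_le_ofReal h

/-- upper bound -/
theorem ker_upper (k : ℕ) : ∃ K : ℝ≥0, ∀ x ∈ hyp (k + 1), ∀ y ∈ hyp (k + 1),
    ∫⁻ g, ‖ker x y g‖ₑ ∂(hmu (k + 1)) ≤ K * (1 + ENNReal.ofReal (Real.log (lB x y))) := by
  set V := hmu (k + 1) (bll lo 48)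
  have hV : V ≠ ⊤ := (bll_fin 48).ne
  refine ⟨(2 * V).toNNReal * 2, fun x hx y hy => ?_⟩
  obtain ⟨h, D, hD, h1, h2, h3⟩ := exists_geo hx hy
  rw [← lintegral_ker_act x y h, h1, h2, h3]
  have hb : ∀ g, ‖ker (geo 0 : LV (k + 1)) (geo D) g‖ₑ ≤
      ∑ i ∈ Finset.range (⌊D⌋₊ + 1), (bll (geo i : LV (k + 1)) 48).indicator (fun _ => 2) g := by
    intro g
    by_cases hg : |kap (g⁻¹ ⊙ (geo 0 : LV (k + 1))) - kap (g⁻¹ ⊙ geo D)| ≤ 1/2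
    · unfold ker; rw [sth_zero hg]; simp
    push Not at hg
    obtain ⟨i, hi, hi'⟩ := exists_ball hD g hg
    refine le_trans ?_ (Finset.single_le_sum
      (f := fun i : ℕ => (bll (geo i : LV (k + 1)) 48).indicator (fun _ => (2 : ℝ≥0∞)) g)
      (fun _ _ => zero_le) (Finset.mem_range.2 (Nat.lt_succ_of_le (Nat.le_floor hi))))
    simp only [Set.indicator_of_mem hi']
    refine (enorm_le_of_abs (abs_ker_le (geo_mem 0) (geo_mem D) g)).trans ?_
    simp
  refine (lintegral_mono hb).trans ?_
  rw [lintegral_finsetSum _ fun i _ => measurable_const.indicator (bll_closed _ _).measurableSet]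
  simp only [lintegral_indicator (bll_closed _ _).measurableSet, lintegral_const,
    Measure.restrict_apply MeasurableSet.univ, Set.univ_inter, bll_meas (geo_mem _)]
  simp only [Finset.sum_const, Finset.card_range, nsmul_eq_mul]
  rw [ENNReal.coe_mul, ENNReal.coe_toNNReal (ENNReal.mul_ne_top (by simp) hV)]
  have hl : D ≤ 1 + Real.log (Real.cosh D) := by
    have e1 := exp_le_cosh D
    have hch := Real.cosh_pos D
    have e2 := Real.log_le_log (Real.exp_pos D) e1
    rw [Real.log_exp, Real.log_mul (by norm_num) hch.ne'] at e2
    have := Real.log_two_lt_d9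
    linarith
  have hl0 : 0 ≤ Real.log (Real.cosh D) := Real.log_nonneg (Real.one_le_cosh D)
  have hn : ((⌊D⌋₊ + 1 : ℕ) : ℝ≥0∞) ≤ 2 * (1 + ENNReal.ofReal (Real.log (Real.cosh D))) := by
    rw [← ENNReal.ofReal_natCast]
    have : (2 : ℝ≥0∞) * (1 + ENNReal.ofReal (Real.log (Real.cosh D))) =
        ENNReal.ofReal (2 * (1 + Real.log (Real.cosh D))) := by
      rw [ENNReal.ofReal_mul (by norm_num), ENNReal.ofReal_add (by norm_num) hl0]; simp
    rw [this]
    apply ENNReal.ofReal_le_ofReal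
    push_cast
    have := Nat.floor_le hD
    linarith
  calc _ ≤ (2 * (1 + ENNReal.ofReal (Real.log (Real.cosh D)))) * (2 * V) := by gcongr
    _ = _ := by push_cast; ring

end TV

namespace TV
open scoped ENNReal NNReal
open MeasureTheory
variable {k : ℕ}

lemma exists_Z : ∃ Z : ℝ≥0, ∀ t : ℝ, ∑' i : ℕ, ENNReal.ofReal (Real.exp (-|(i : ℝ) - t|)) ≤ Z := by
  have hs : Summable fun i : ℤ => Real.exp (-|(i : ℝ)|) := by
    have h1 : Summable fun n : ℕ => Real.exp (-(n : ℝ)) := by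
      simpa using Real.summable_exp_neg_nat
    apply Summable.of_nat_of_neg
    · simpa using h1
    · simpa using h1
  set Z : ℝ≥0∞ := ∑' i : ℤ, ENNReal.ofReal (Real.exp 1 * Real.exp (-|(i : ℝ)|)) with hZ
  have hZt : Z ≠ ⊤ := (hs.mul_left _).tsum_ofReal_ne_top
  refine ⟨Z.toNNReal, fun t => ?_⟩
  rw [ENNReal.coe_toNNReal hZt]
  calc ∑' i : ℕ, ENNReal.ofReal (Real.exp (-|(i : ℝ) - t|))
      = ∑' i : ℕ, (fun j : ℤ => ENNReal.ofReal (Real.exp (-|(j : ℝ) - t|))) (i : ℤ) := by simp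
    _ ≤ ∑' j : ℤ, ENNReal.ofReal (Real.exp (-|(j : ℝ) - t|)) :=
        ENNReal.tsum_comp_le_tsum_of_injective Nat.cast_injective _
    _ ≤ ∑' j : ℤ, ENNReal.ofReal (Real.exp 1 * Real.exp (-|((j - ⌊t⌋ : ℤ) : ℝ)|)) := by
        refine ENNReal.tsum_le_tsum fun j => ENNReal.ofReal_le_ofReal ?_
        rw [← Real.exp_add]
        apply Real.exp_le_exp.2
        push_cast
        have h1 : |(j : ℝ) - ⌊t⌋| ≤ |(j : ℝ) - t| + |t - ⌊t⌋| := by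
          have := abs_add_le ((j : ℝ) - t) (t - ⌊t⌋)
          rwa [sub_add_sub_cancel] at this
        have h2 : |t - ⌊t⌋| ≤ 1 := by
          rw [abs_of_nonneg (by linarith [Int.floor_le t])]
          linarith [Int.lt_floor_add_one t]
        linarith
    _ = Z := (Equiv.subRight ⌊t⌋).tsum_eq
        (fun j : ℤ => ENNReal.ofReal (Real.exp 1 * Real.exp (-|(j : ℝ)|)))

/-- defect -/
def tdef (x y z : LV (k + 1)) (g : lG (k + 1)) : ℝ := ker x y g + ker y z g + ker z x g

lemma tdef_cyc (x y z : LV (k + 1)) (g : lG (k + 1)) : tdef x y z g = tdef y z x g := by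
  unfold tdef; ring

lemma tdef_act (x y z : LV (k + 1)) (h g : lG (k + 1)) :
    tdef (h ⊙ x) (h ⊙ y) (h ⊙ z) (h * g) = tdef x y z g := by
  unfold tdef; simp only [ker_act]

lemma tdef_le (x y z : LV (k + 1)) (g : lG (k + 1)) :
    |tdef x y z g| ≤ 2 * |kap (g⁻¹ ⊙ z) - kap (g⁻¹ ⊙ x)| := sth_defect (by ring)

lemma tdef_le' (x y z : LV (k + 1)) (g : lG (k + 1)) :
    |tdef x y z g| ≤ 2 * |kap (g⁻¹ ⊙ y) - kap (g⁻¹ ⊙ z)| := by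
  rw [tdef_cyc, tdef_cyc]; exact tdef_le _ _ _ _

lemma coef_z {z : LV (k + 1)} (hz : z ∈ hyp (k + 1)) : ∃ α s₀ : ℝ, 0 < α ∧
    ∀ s, lB z (geo s) = α * (Real.exp s + Real.exp (2 * s₀ - s)) := by
  obtain ⟨α, β, hα, hβ, h⟩ := lB_geo_coef hz
  refine ⟨α, Real.log (β / α) / 2, hα, fun s => ?_⟩
  rw [h, mul_div_cancel₀ _ (two_ne_zero), sub_eq_add_neg, Real.exp_add, Real.exp_log (by positivity)]
  field_simp

lemma near_lower {g : lG (k + 1)} {p w : LV (k + 1)} (hp : p ∈ hyp (k + 1)) (hw : w ∈ hyp (k + 1))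
    (hg : g ∈ bll p 48) : lB p w ≤ 96 * lB (g ⊙ lo) w := by
  have hP : g ⊙ (lo : LV (k + 1)) ∈ hyp (k + 1) := act_mem g lo_mem
  have h1 := quasi_triangle hp hP hw
  have h2 : lB (g ⊙ lo) p ≤ 48 := hg
  rw [lB_comm] at h2
  have h3 := one_le_lB hP hw
  nlinarith

lemma exp_bd {b c u v : ℝ} (hc : 0 ≤ c) (h : b ^ 2 ≤ c ^ 2 * (Real.exp (2 * u) + Real.exp (2 * v))) :
    |b| ≤ c * (Real.exp u + Real.exp v) := by
  have e1 : Real.exp (2 * u) = Real.exp u ^ 2 := by rw [← Real.exp_nat_mul]; norm_num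
  have e2 : Real.exp (2 * v) = Real.exp v ^ 2 := by rw [← Real.exp_nat_mul]; norm_num
  rw [e1, e2] at h
  have p1 := Real.exp_pos u
  have p2 := Real.exp_pos v
  apply abs_le_of_sq_le_sq _ (by positivity)
  refine h.trans ?_
  rw [mul_pow]
  gcongr
  nlinarith [mul_pos p1 p2]

lemma tdef_geo {z : LV (k + 1)} {D : ℝ} {α s₀ : ℝ} (hz : z ∈ hyp (k + 1))
    (hα : 0 < α) (hc : ∀ s, lB z (geo s) = α * (Real.exp s + Real.exp (2 * s₀ - s)))
    {i : ℝ} (h0 : 0 ≤ i) (hi : i ≤ D) {g : lG (k + 1)} (hg : g ∈ bll (geo i : LV (k + 1)) 48) :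
    |tdef (geo 0) (geo D) z g| ≤
      384 * (Real.exp (-|i - s₀|) + Real.exp (-|i - 0|) + Real.exp (-|i - D|)) := by
  have hP : g ⊙ (lo : LV (k + 1)) ∈ hyp (k + 1) := act_mem g lo_mem
  have l1 := near_lower (geo_mem i) hz hg
  have l2 := near_lower (geo_mem i) (geo_mem 0) hg
  have l3 := near_lower (geo_mem i) (geo_mem D) hg
  rw [lB_comm, hc] at l1
  rw [lB_geo_geo] at l2 l3
  rw [← Real.cosh_neg, neg_sub, sub_zero] at l2
  have m2 := exp_le_cosh i
  have m3 := exp_le_cosh (D - i)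
  set Pz := lB (g ⊙ lo) z
  set P0 := lB (g ⊙ lo) (geo 0)
  set PD := lB (g ⊙ lo) (geo D)
  have q1 : 0 < Pz := by linarith [one_le_lB hP hz]
  have q2 : 0 < P0 := by linarith [one_le_lB hP (geo_mem (k := k) 0)]
  have q3 : 0 < PD := by linarith [one_le_lB hP (geo_mem (k := k) D)]
  have b1 : |kap (g⁻¹ ⊙ z) - kap (g⁻¹ ⊙ geo 0)| ≤ 192 * (Real.exp (-i) + Real.exp (s₀ - i)) := by
    apply exp_bd (by norm_num)
    refine (kapg_sub_sq hz (geo_mem 0) g).trans ?_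
    rw [div_le_iff₀ (by positivity), hc]
    simp only [Real.exp_zero, sub_zero]
    have e1 : α * (1 + Real.exp (2 * s₀)) = (Real.exp (2 * -i) + Real.exp (2 * (s₀ - i))) *
        ((α * Real.exp i) * Real.exp i) := by
      have a1 : Real.exp (2 * -i) * (Real.exp i * Real.exp i) = 1 := by
        rw [← Real.exp_add, ← Real.exp_add, ← Real.exp_zero]; ring_nf
      have a2 : Real.exp (2 * (s₀ - i)) * (Real.exp i * Real.exp i) = Real.exp (2 * s₀) := by
        rw [← Real.exp_add, ← Real.exp_add]; ring_nf
      linear_combination (-α) * a1 + (-α) * a2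
    rw [e1]
    have pe := Real.exp_pos i
    have pe2 := Real.exp_pos (2 * s₀ - i)
    have f1 : α * Real.exp i ≤ 96 * Pz := le_trans (by nlinarith) l1
    have f2 : Real.exp i ≤ 192 * P0 := by linarith
    have f3 : (α * Real.exp i) * Real.exp i ≤ (96 * Pz) * (192 * P0) := by gcongr
    have ps : 0 < Real.exp (2 * -i) + Real.exp (2 * (s₀ - i)) := by positivity
    have := mul_le_mul_of_nonneg_left f3 ps.le
    have e3 : (96 * Pz) * (192 * P0) * 2 = 192 ^ 2 * (Pz * P0) := by ring
    nlinarith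
  have b2 : |kap (g⁻¹ ⊙ geo D) - kap (g⁻¹ ⊙ z)| ≤ 192 * (Real.exp (i - s₀) + Real.exp (i - D)) := by
    apply exp_bd (by norm_num)
    refine (kapg_sub_sq (geo_mem D) hz g).trans ?_
    rw [div_le_iff₀ (by positivity), lB_comm, hc]
    have e1 : α * (Real.exp D + Real.exp (2 * s₀ - D)) =
        (Real.exp (2 * (i - s₀)) + Real.exp (2 * (i - D))) *
        ((α * Real.exp (2 * s₀ - i)) * Real.exp (D - i)) := by
      have a1 : Real.exp (2 * (i - s₀)) * (Real.exp (2 * s₀ - i) * Real.exp (D - i)) = Real.exp D := by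
        rw [← Real.exp_add, ← Real.exp_add]; ring_nf
      have a2 : Real.exp (2 * (i - D)) * (Real.exp (2 * s₀ - i) * Real.exp (D - i)) =
          Real.exp (2 * s₀ - D) := by
        rw [← Real.exp_add, ← Real.exp_add]; ring_nf
      linear_combination (-α) * a1 + (-α) * a2
    rw [e1]
    have pe := Real.exp_pos i
    have pe2 := Real.exp_pos (2 * s₀ - i)
    have pe3 := Real.exp_pos (D - i)
    have f1 : α * Real.exp (2 * s₀ - i) ≤ 96 * Pz := le_trans (by nlinarith) l1
    have f2 : Real.exp (D - i) ≤ 192 * PD := by linarith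
    have f3 : (α * Real.exp (2 * s₀ - i)) * Real.exp (D - i) ≤ (96 * Pz) * (192 * PD) := by gcongr
    have ps : 0 < Real.exp (2 * (i - s₀)) + Real.exp (2 * (i - D)) := by positivity
    have := mul_le_mul_of_nonneg_left f3 ps.le
    have e3 : (96 * Pz) * (192 * PD) * 2 = 192 ^ 2 * (Pz * PD) := by ring
    nlinarith
  have t1 := tdef_le (geo 0) (geo D) z g
  have t2 := tdef_le' (geo 0) (geo D) z g
  have r1 : Real.exp (-|i - 0|) = Real.exp (-i) := by rw [sub_zero, abs_of_nonneg h0]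
  have r2 : Real.exp (-|i - D|) = Real.exp (i - D) := by rw [abs_of_nonpos (by linarith), neg_neg]
  rw [r1, r2]
  have x1 := Real.exp_pos (-i)
  have x2 := Real.exp_pos (i - D)
  rcases le_total i s₀ with h | h
  · have e : |i - s₀| = -(i - s₀) := abs_of_nonpos (by linarith)
    rw [e, neg_neg]; linarith
  · have e : |i - s₀| = i - s₀ := abs_of_nonneg (by linarith)
    rw [e, neg_sub]; linarith

lemma tdef_cont {x y z : LV (k + 1)} (hx : x ∈ hyp (k + 1)) (hy : y ∈ hyp (k + 1))
    (hz : z ∈ hyp (k + 1)) : Continuous (tdef x y z) :=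
  ((ker_cont hx hy).add (ker_cont hy hz)).add (ker_cont hz hx)

/-- support set -/
def spt (x y : LV (k + 1)) : Set (lG (k + 1)) := {g | 1/2 < |kap (g⁻¹ ⊙ x) - kap (g⁻¹ ⊙ y)|}

lemma spt_meas {x y : LV (k + 1)} (hx : x ∈ hyp (k + 1)) (hy : y ∈ hyp (k + 1)) :
    MeasurableSet (spt x y) :=
  (isOpen_lt continuous_const ((kap_cont hx).sub (kap_cont hy)).abs).measurableSet

lemma tdef_part (k : ℕ) : ∃ K : ℝ≥0, ∀ x ∈ hyp (k + 1), ∀ y ∈ hyp (k + 1), ∀ z ∈ hyp (k + 1),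
    ∫⁻ g, (spt x y).indicator (fun g => ‖tdef x y z g‖ₑ) g ∂(hmu (k + 1)) ≤ K := by
  obtain ⟨Z, hZ⟩ := exists_Z
  set V := hmu (k + 1) (bll lo 48)
  have hV : V ≠ ⊤ := (bll_fin 48).ne
  refine ⟨384 * (Z + Z + Z) * V.toNNReal, fun x hx y hy z hz => ?_⟩
  obtain ⟨h, D, hD, h1, h2, h3⟩ := exists_geo hx hy
  have e : ∀ g, (spt x y).indicator (fun g => ‖tdef x y z g‖ₑ) g =
      (spt (geo 0) (geo D)).indicator (fun g => ‖tdef (geo 0) (geo D) (h ⊙ z) g‖ₑ) (h * g) := by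
    intro g
    have m : h * g ∈ spt (geo 0) (geo D) ↔ g ∈ spt x y := by
      simp only [spt, Set.mem_ofPred_eq]
      rw [← h1, ← h2, mul_inv_rev, act_mul, act_mul, inv_act_act, inv_act_act]
    by_cases hg : g ∈ spt x y
    · rw [Set.indicator_of_mem hg, Set.indicator_of_mem (m.2 hg), ← h1, ← h2, tdef_act]
    · rw [Set.indicator_of_notMem hg, Set.indicator_of_notMem (mt m.1 hg)]
  simp only [e]
  rw [lintegral_mul_left_eq_self]
  have hz' := act_mem h hz
  obtain ⟨α, s₀, hα, hc⟩ := coef_z hz'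
  set c : ℕ → ℝ≥0∞ := fun i => 384 * (ENNReal.ofReal (Real.exp (-|(i:ℝ) - s₀|)) +
    ENNReal.ofReal (Real.exp (-|(i:ℝ) - 0|)) + ENNReal.ofReal (Real.exp (-|(i:ℝ) - D|))) with hcdef
  have hb : ∀ g, (spt (geo 0) (geo D)).indicator (fun g => ‖tdef (geo 0) (geo D) (h ⊙ z) g‖ₑ) g ≤
      ∑' i : ℕ, (bll (geo i : LV (k + 1)) 48).indicator (fun _ => c i) g := by
    intro g
    by_cases hg : g ∈ spt (geo 0 : LV (k + 1)) (geo D)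
    · rw [Set.indicator_of_mem hg]
      obtain ⟨i, hi, hi'⟩ := exists_ball hD g hg
      refine le_trans ?_ (ENNReal.le_tsum i)
      rw [Set.indicator_of_mem hi']
      refine (enorm_le_of_abs (tdef_geo hz' hα hc (Nat.cast_nonneg i) hi hi')).trans (le_of_eq ?_)
      rw [ENNReal.ofReal_mul (by norm_num), ENNReal.ofReal_add (by positivity) (by positivity),
        ENNReal.ofReal_add (by positivity) (by positivity)]
      simp [hcdef]
    · rw [Set.indicator_of_notMem hg]; exact zero_le
  refine (lintegral_mono hb).trans ?_
  rw [lintegral_tsum fun i =>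
    (measurable_const.indicator (bll_closed _ _).measurableSet).aemeasurable]
  simp only [lintegral_indicator (bll_closed _ _).measurableSet, lintegral_const,
    Measure.restrict_apply MeasurableSet.univ, Set.univ_inter, bll_meas (geo_mem _)]
  rw [ENNReal.tsum_mul_right, hcdef, ENNReal.tsum_mul_left, ENNReal.tsum_add, ENNReal.tsum_add]
  push_cast
  rw [ENNReal.coe_toNNReal hV]
  gcongr
  · exact hZ _
  · exact hZ _
  · exact hZ _

/-- uniform bound on the triangle defect -/
theorem tdef_bound (k : ℕ) : ∃ K : ℝ≥0, ∀ x ∈ hyp (k + 1), ∀ y ∈ hyp (k + 1), ∀ z ∈ hyp (k + 1),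
    ∫⁻ g, ‖tdef x y z g‖ₑ ∂(hmu (k + 1)) ≤ K := by
  obtain ⟨K, hK⟩ := tdef_part k
  refine ⟨K + K + K, fun x hx y hy z hz => ?_⟩
  have hb : ∀ g, ‖tdef x y z g‖ₑ ≤ (spt x y).indicator (fun g => ‖tdef x y z g‖ₑ) g +
      (spt y z).indicator (fun g => ‖tdef y z x g‖ₑ) g +
      (spt z x).indicator (fun g => ‖tdef z x y g‖ₑ) g := by
    intro g
    by_cases h1 : g ∈ spt x y
    · rw [Set.indicator_of_mem h1, add_assoc]; exact le_self_add
    by_cases h2 : g ∈ spt y z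
    · rw [Set.indicator_of_mem h2, tdef_cyc]
      exact le_trans le_add_self le_self_add
    by_cases h3 : g ∈ spt z x
    · rw [Set.indicator_of_mem h3, tdef_cyc, tdef_cyc]
      exact le_add_self
    simp only [spt, Set.mem_ofPred_eq, not_lt] at h1 h2 h3
    simp only [tdef, ker, sth_zero h1, sth_zero h2, sth_zero h3]
    simp
  have ms : ∀ a ∈ hyp (k + 1), ∀ b ∈ hyp (k + 1), ∀ c ∈ hyp (k + 1),
      Measurable (fun g => (spt a b).indicator (fun g => ‖tdef a b c g‖ₑ) g) :=
    fun a ha b hb c hc => ((tdef_cont ha hb hc).measurable.enorm).indicator (spt_meas ha hb)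
  refine (lintegral_mono hb).trans ?_
  rw [lintegral_add_right _ (ms z hz x hx y hy),
    lintegral_add_left (ms x hx y hy z hz)]
  push_cast
  gcongr
  · exact hK _ hx _ hy _ hz
  · exact hK _ hy _ hz _ hx
  · exact hK _ hz _ hx _ hy

/-- lower bound neighbourhood -/
def unb (k : ℕ) : Set (lG (k + 1)) := {u | ‖opr u⁻¹ - 1‖ < 1/16}

lemma unb_open : IsOpen (unb k) := by
  have : Continuous fun u : lG (k + 1) => ‖opr u⁻¹ - 1‖ :=
    ((continuous_opr.comp continuous_inv).sub continuous_const).norm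
  exact isOpen_lt this continuous_const

lemma one_mem_unb : (1 : lG (k + 1)) ∈ unb k := by simp [unb, opr_one]

lemma norm_hyp {p : LV k} (hp : p ∈ hyp k) : ‖p‖ ≤ p.2 := by
  have h1 := hyp_norm hp
  have h2 := hp.2
  rw [Prod.norm_def]
  refine max_le ?_ (by rw [Real.norm_of_nonneg h2.le])
  exact (pow_le_pow_iff_left₀ (norm_nonneg _) h2.le two_ne_zero).1 (by linarith)

lemma unb_move {u : lG (k + 1)} (hu : u ∈ unb k) {p : LV (k + 1)} (hp : p ∈ hyp (k + 1)) :
    |(u⁻¹ ⊙ p).1 0 - p.1 0| ≤ p.2 / 16 ∧ |(u⁻¹ ⊙ p).2 - p.2| ≤ p.2 / 16 := by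
  have h1 : ‖u⁻¹ ⊙ p - p‖ ≤ p.2 / 16 := by
    have : u⁻¹ ⊙ p - p = (opr u⁻¹ - 1) p := by simp [act]
    rw [this]
    refine (ContinuousLinearMap.le_opNorm _ _).trans ?_
    have := norm_hyp hp
    have hu' : ‖opr u⁻¹ - 1‖ < 1/16 := hu
    have := mul_le_mul hu'.le this (norm_nonneg _) (by norm_num)
    linarith
  constructor
  · have := abs_coord_le (u⁻¹ ⊙ p - p)
    have h2 : ‖(u⁻¹ ⊙ p - p).1‖ ≤ ‖u⁻¹ ⊙ p - p‖ := norm_fst_le _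
    simp only [Prod.fst_sub, PiLp.sub_apply] at this h2
    linarith
  · have h2 : ‖(u⁻¹ ⊙ p - p).2‖ ≤ ‖u⁻¹ ⊙ p - p‖ := norm_snd_le _
    simp only [Prod.snd_sub, Real.norm_eq_abs] at h2
    linarith

lemma geo_sinh {t : ℝ} (ht : 1 ≤ t) : 3/4 * Real.cosh t ≤ Real.sinh t := by
  rw [Real.cosh_eq, Real.sinh_eq]
  have h1 : Real.exp 1 ≤ Real.exp t := Real.exp_le_exp.2 ht
  have h2 := Real.exp_one_gt_d9
  have h3 : Real.exp (-t) * Real.exp t = 1 := by rw [← Real.exp_add]; simp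
  have h4 := Real.exp_pos (-t)
  nlinarith

lemma kap_geo_pos {u : lG (k + 1)} (hu : u ∈ unb k) {t : ℝ} (ht : 1 ≤ t) :
    1/2 ≤ kap (u⁻¹ ⊙ (geo t : LV (k + 1))) := by
  obtain ⟨h1, h2⟩ := unb_move hu (geo_mem (k := k) t)
  have e1 : (geo t : LV (k + 1)).1 0 = Real.sinh t := by simp [geo, e0_zero]
  have e2 : (geo t : LV (k + 1)).2 = Real.cosh t := rfl
  rw [e1, e2, abs_le] at h1
  rw [e2, abs_le] at h2
  have h3 := geo_sinh ht
  have hc := Real.cosh_pos t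
  unfold kap
  rw [le_div_iff₀ (act_mem _ (geo_mem _)).2]
  linarith

lemma kap_geo_neg {u : lG (k + 1)} (hu : u ∈ unb k) {t : ℝ} (ht : 1 ≤ t) :
    kap (u⁻¹ ⊙ (geo (-t) : LV (k + 1))) ≤ -(1/2) := by
  obtain ⟨h1, h2⟩ := unb_move hu (geo_mem (k := k) (-t))
  have e1 : (geo (-t) : LV (k + 1)).1 0 = - Real.sinh t := by simp [geo, e0_zero]
  have e2 : (geo (-t) : LV (k + 1)).2 = Real.cosh t := by simp [geo]
  rw [e1, e2, abs_le] at h1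
  rw [e2, abs_le] at h2
  have h3 := geo_sinh ht
  have hc := Real.cosh_pos t
  unfold kap
  rw [div_le_iff₀ (act_mem _ (geo_mem _)).2]
  linarith

theorem ker_lower (k : ℕ) : ∃ K : ℝ≥0, ∀ x ∈ hyp (k + 1), ∀ y ∈ hyp (k + 1),
    ENNReal.ofReal (Real.log (lB x y)) ≤ K * (1 + ∫⁻ g, ‖ker x y g‖ₑ ∂(hmu (k + 1))) := by
  set U := hmu (k + 1) (unb k)
  have hU0 : U ≠ 0 := (unb_open.measure_pos _ ⟨1, one_mem_unb⟩).ne'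
  obtain ⟨K, hK⟩ : ∃ K : ℝ≥0, 8 ≤ K * U := by
    by_cases hU : U = ⊤
    · exact ⟨1, by rw [hU]; simp⟩
    · refine ⟨(8 / U).toNNReal, ?_⟩
      rw [ENNReal.coe_toNNReal (ENNReal.div_ne_top (by simp) hU0), ENNReal.div_mul_cancel hU0 hU]
  refine ⟨5 + K, fun x hx y hy => ?_⟩
  obtain ⟨h, D, hD, h1, h2, h3⟩ := exists_geo hx hy
  rw [← lintegral_ker_act x y h, h1, h2, h3]
  choose b hb using fun s : ℝ => exists_boost (k := k) s
  set n := ⌊(D - 1) / 4⌋₊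
  have hn : D ≤ 4 * n + 5 := by
    have := (Nat.lt_floor_add_one ((D - 1) / 4)).le
    linarith
  set W : ℕ → Set (lG (k + 1)) := fun i => (fun g => (b (4 * i))⁻¹ * g) ⁻¹' (unb k) with hW
  have hWm : ∀ i, MeasurableSet (W i) := fun i =>
    (unb_open.preimage (continuous_const.mul continuous_id)).measurableSet
  have hWμ : ∀ i, hmu (k + 1) (W i) = U := fun i => by
    simp only [hW]; rw [measure_preimage_mul]
  have key : ∀ i, ∀ g ∈ W i, lB (g ⊙ lo) (geo (4 * i) : LV (k + 1)) ≤ 17/16 := by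
    intro i g hg
    have hu : (b (4 * i))⁻¹ * g ∈ unb k := hg
    have e1 : (geo (4 * i) : LV (k + 1)) = b (4 * i) ⊙ lo := by
      have := hb (4 * i) 0
      rw [add_zero, geo_zero] at this; exact this.symm
    have := (unb_move hu (lo_mem (k := k + 1))).2
    rw [mul_inv_rev, inv_inv, act_mul, ← e1] at this
    rw [← lB_lo, lB_inv_act, abs_le] at this
    rw [lB_comm]
    simp only [lo_snd] at this
    linarith
  have hWd : ∀ i j, i ≠ j → Disjoint (W i) (W j) := by
    intro i j hij
    rw [Set.disjoint_left]
    intro g hgi hgj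
    have k1 := key i g hgi
    have k2 := key j g hgj
    have hP : g ⊙ (lo : LV (k + 1)) ∈ hyp (k + 1) := act_mem g lo_mem
    have k3 := quasi_triangle (geo_mem (k := k) (4 * i)) hP (geo_mem (4 * j))
    rw [lB_comm] at k1
    have k4 := one_le_lB hP (geo_mem (k := k) (4 * j))
    have k5 := one_le_lB (geo_mem (k := k) (4 * i)) hP
    rw [lB_geo_geo] at k3
    have k6 : Real.cosh ((4 : ℝ) * j - 4 * i) ≤ 4 := by nlinarith
    have k7 : (4 : ℝ) ≤ |(4 : ℝ) * j - 4 * i| := by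
      rw [← mul_sub, abs_mul]
      have : (1 : ℤ) ≤ |(j : ℤ) - i| := Int.one_le_abs (by omega)
      have : (1 : ℝ) ≤ |(j : ℝ) - i| := by exact_mod_cast this
      rw [abs_of_pos (by norm_num : (0:ℝ) < 4)]; linarith
    rw [← Real.cosh_abs] at k6
    have k8 := exp_le_cosh |(4 : ℝ) * j - 4 * i|
    have k9 := Real.quadratic_le_exp_of_nonneg (abs_nonneg ((4 : ℝ) * j - 4 * i))
    nlinarith
  have hlow : ∀ i ∈ Finset.Icc 1 n, ∀ g ∈ W i, (2⁻¹ : ℝ≥0∞) ≤ ‖ker (geo 0 : LV (k + 1)) (geo D) g‖ₑ := by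
    intro i hi g hg
    rw [Finset.mem_Icc] at hi
    have hu : (b (4 * i))⁻¹ * g ∈ unb k := hg
    set u := (b (4 * i))⁻¹ * g with hu'
    have hgu : g = b (4 * i) * u := by simp [hu']
    have hi1 : (1 : ℝ) ≤ i := by exact_mod_cast hi.1
    have hin : (i : ℝ) ≤ (D - 1) / 4 := by
      have : i ≤ ⌊(D - 1) / 4⌋₊ := hi.2
      rwa [Nat.le_floor_iff' (by omega)] at this
    have a1 : (geo 0 : LV (k + 1)) = b (4 * i) ⊙ geo (-(4 * i)) := by rw [hb]; simp
    have a2 : (geo D : LV (k + 1)) = b (4 * i) ⊙ geo (D - 4 * i) := by rw [hb]; simp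
    have c1 := kap_geo_neg hu (t := 4 * i) (by linarith)
    have c2 := kap_geo_pos hu (t := D - 4 * i) (by linarith)
    rw [a1, a2, hgu, ker_act, ker_anti, enorm_neg]
    have := sth_ge (t := kap (u⁻¹ ⊙ (geo (D - 4 * i) : LV (k + 1))) - kap (u⁻¹ ⊙ geo (-(4 * i))))
      (by linarith)
    unfold ker
    rw [Real.enorm_eq_ofReal_abs, abs_of_nonneg (by linarith)]
    calc (2⁻¹ : ℝ≥0∞) = ENNReal.ofReal (1/2) := by
          rw [one_div, ENNReal.ofReal_inv_of_pos (by norm_num)]; norm_num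
      _ ≤ _ := ENNReal.ofReal_le_ofReal this
  have hint : (n : ℝ≥0∞) * (2⁻¹ * U) ≤ ∫⁻ g, ‖ker (geo 0 : LV (k + 1)) (geo D) g‖ₑ ∂(hmu (k + 1)) := by
    calc (n : ℝ≥0∞) * (2⁻¹ * U) = ∑ i ∈ Finset.Icc 1 n, 2⁻¹ * hmu (k + 1) (W i) := by
          simp [hWμ]
      _ ≤ ∑ i ∈ Finset.Icc 1 n, ∫⁻ g in W i, ‖ker (geo 0 : LV (k + 1)) (geo D) g‖ₑ ∂(hmu (k + 1)) := by
          refine Finset.sum_le_sum fun i hi => ?_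
          rw [← setLIntegral_const]
          exact setLIntegral_mono' (hWm i) (hlow i hi)
      _ = ∫⁻ g in ⋃ i ∈ Finset.Icc 1 n, W i, ‖ker (geo 0 : LV (k + 1)) (geo D) g‖ₑ ∂(hmu (k + 1)) := by
          rw [lintegral_biUnion_finset (fun i _ j _ hij => hWd i j hij) fun i _ => hWm i]
      _ ≤ _ := setLIntegral_le_lintegral _ _
  have hl : Real.log (Real.cosh D) ≤ 4 * n + 5 := by
    have := Real.log_le_log (Real.cosh_pos D) (cosh_le_exp hD)
    rw [Real.log_exp] at this; linarith
  set J := ∫⁻ g, ‖ker (geo 0 : LV (k + 1)) (geo D) g‖ₑ ∂(hmu (k + 1))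
  calc ENNReal.ofReal (Real.log (Real.cosh D)) ≤ ENNReal.ofReal (4 * n + 5) :=
        ENNReal.ofReal_le_ofReal hl
    _ = 4 * n + 5 := by
        rw [ENNReal.ofReal_add (by positivity) (by norm_num), ENNReal.ofReal_mul (by norm_num)]; simp
    _ ≤ K * J + 5 := by
        refine add_le_add ?_ le_rfl
        calc (4 : ℝ≥0∞) * n = n * (2⁻¹ * 8) := by
              rw [mul_comm]; congr 1
              rw [show (8 : ℝ≥0∞) = 2 * 4 by norm_num, ← mul_assoc,
                ENNReal.inv_mul_cancel (by norm_num) (by norm_num), one_mul]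
          _ ≤ n * (2⁻¹ * (K * U)) := by gcongr
          _ = K * (n * (2⁻¹ * U)) := by ring
          _ ≤ K * J := by gcongr
    _ ≤ ((5 + K : ℝ≥0) : ℝ≥0∞) * (1 + J) := by
        push_cast
        have : ((5 : ℝ≥0∞) + K) * (1 + J) = (K * J + 5) + (K + 5 * J) := by ring
        rw [this]; exact le_self_add

end TV

namespace TV
open scoped ENNReal NNReal Pointwise
open MeasureTheory

/-! ### Unfolding -/

lemma exists_fund {G : Type*} [Group G] [Countable G] {k : ℕ} {ρ : G →* lG k} (hρ : UDisc ρ) :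
    ∃ F : Set (lG k), MeasurableSet F ∧ ∀ g, ∃! h, ρ h * g ∈ F := by
  obtain ⟨U, hU, h1⟩ := hρ
  have hc : Tendsto (fun p : lG k × lG k => p.1 * p.2⁻¹) (𝓝 1 ×ˢ 𝓝 1) (𝓝 1) := by
    have : Continuous fun p : lG k × lG k => p.1 * p.2⁻¹ := by fun_prop
    have := this.tendsto (1, 1)
    rwa [nhds_prod_eq, inv_one, one_mul] at this
  obtain ⟨W', hW', hWU'⟩ := mem_prod_same_iff.1 (hc hU)
  obtain ⟨W, hWW, hWo, hW1⟩ := mem_nhds_iff.1 hW'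
  have hWU : ∀ x ∈ W, ∀ y ∈ W, x * y⁻¹ ∈ U := fun x hx y hy =>
    hWU' (show (x, y) ∈ W' ×ˢ W' from ⟨hWW hx, hWW hy⟩)
  obtain ⟨c, hcd⟩ := TopologicalSpace.exists_dense_seq (lG k)
  let E : ℕ → Set (lG k) := fun i => (fun g => g * (c i)⁻¹) ⁻¹' W
  have hEo : ∀ i, IsOpen (E i) := fun i => hWo.preimage (by fun_prop)
  have hEcov : ∀ g, ∃ i, g ∈ E i := by
    intro g
    have ho : IsOpen ((fun x : lG k => g * x⁻¹) ⁻¹' W) := hWo.preimage (by fun_prop)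
    obtain ⟨i, hi⟩ := hcd.exists_mem_open ho ⟨g, by simpa using hW1⟩
    exact ⟨i, hi⟩
  have hEu : ∀ i g h h', ρ h * g ∈ E i → ρ h' * g ∈ E i → h = h' := by
    intro i g h h' h2 h3
    have h4 := hWU _ h2 _ h3
    have h5 : ρ (h * h'⁻¹) ∈ U := by
      rw [map_mul, map_inv]; convert h4 using 1; group
    exact mul_inv_eq_one.1 (h1 _ h5)
  let X : ℕ → Set (lG k) := fun i => ⋃ h, (fun g => ρ h * g) ⁻¹' (E i)
  have hXo : ∀ i, IsOpen (X i) := fun i => isOpen_iUnion fun h => (hEo i).preimage (by fun_prop)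
  have hXi : ∀ i h g, ρ h * g ∈ X i ↔ g ∈ X i := by
    intro i h g
    simp only [X, mem_iUnion, mem_preimage]
    constructor
    · rintro ⟨h', hh⟩; exact ⟨h' * h, by rwa [map_mul, mul_assoc]⟩
    · rintro ⟨h', hh⟩; exact ⟨h' * h⁻¹, by rwa [map_mul, mul_assoc, map_inv, inv_mul_cancel_left]⟩
  refine ⟨⋃ i, (E i \ ⋃ j < i, X j), ?_, ?_⟩
  · refine MeasurableSet.iUnion fun i => (hEo i).measurableSet.diff ?_
    exact MeasurableSet.iUnion fun j => MeasurableSet.iUnion fun _ => (hXo j).measurableSet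
  · intro g
    classical
    have hex : ∃ i, g ∈ X i := by
      obtain ⟨i, hi⟩ := hEcov g
      exact ⟨i, mem_iUnion.2 ⟨1, by simpa using hi⟩⟩
    set i := Nat.find hex with hi
    have hgi : g ∈ X i := Nat.find_spec hex
    have hmin : ∀ j < i, g ∉ X j := fun j hj => Nat.find_min hex hj
    have key : ∀ h, ρ h * g ∈ (⋃ i, (E i \ ⋃ j < i, X j)) ↔ ρ h * g ∈ E i := by
      intro h
      simp only [mem_iUnion, mem_diff, exists_prop, not_exists, not_and]
      constructor
      · rintro ⟨i', h2, h3⟩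
        have : g ∈ X i' := mem_iUnion.2 ⟨h, h2⟩
        have h4 : i ≤ i' := by
          by_contra hlt; exact hmin _ (not_le.1 hlt) this
        have h5 : ¬ i < i' := fun hlt => h3 i hlt ((hXi _ _ _).2 hgi)
        rwa [show i = i' by omega]
      · intro h2
        exact ⟨i, h2, fun j hj hx => hmin j hj ((hXi _ _ _).1 hx)⟩
    obtain ⟨h, hh⟩ := mem_iUnion.1 hgi
    exact ⟨h, (key h).2 hh, fun h' hh' => hEu i g h' h ((key h').1 hh') hh⟩

lemma unfold {G : Type*} [Group G] [Countable G] {k : ℕ} {ρ : G →* lG k}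
    {F : Set (lG k)} (hF : MeasurableSet F) (hu : ∀ g, ∃! h, ρ h * g ∈ F)
    {f : lG k → ℝ≥0∞} (hf : Measurable f) :
    ∫⁻ g in F, ∑' h, f ((ρ h)⁻¹ * g) ∂(hmu k) = ∫⁻ g, f g ∂(hmu k) := by
  have e1 : ∀ h : G, ∫⁻ g in F, f ((ρ h)⁻¹ * g) ∂(hmu k) =
      ∫⁻ g, F.indicator (fun _ => 1) (ρ h * g) * f g ∂(hmu k) := by
    intro h
    rw [← lintegral_indicator hF]
    have := lintegral_mul_left_eq_self (μ := hmu k)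
      (fun g => F.indicator (fun g => f ((ρ h)⁻¹ * g)) g) (ρ h)
    rw [← this]
    refine lintegral_congr fun g => ?_
    by_cases hg : ρ h * g ∈ F
    · simp [hg]
    · simp [hg]
  have m : ∀ h : G, Measurable fun g : lG k => (ρ h)⁻¹ * g := fun h =>
    (continuous_const.mul continuous_id).measurable
  have m' : ∀ h : G, Measurable fun g : lG k => (ρ h) * g := fun h =>
    (continuous_const.mul continuous_id).measurable
  have mm : ∀ h : G, AEMeasurable (fun g : lG k => f ((ρ h)⁻¹ * g)) ((hmu k).restrict F) :=
    fun h => (hf.comp (m h)).aemeasurable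
  have mm' : ∀ h : G, AEMeasurable
      (fun g : lG k => F.indicator (fun _ => (1 : ℝ≥0∞)) (ρ h * g) * f g) (hmu k) :=
    fun h => (((measurable_const.indicator hF).comp (m' h)).mul hf).aemeasurable
  rw [lintegral_tsum mm]
  simp only [e1]
  rw [← lintegral_tsum mm']
  refine lintegral_congr fun g => ?_
  rw [ENNReal.tsum_mul_right]
  obtain ⟨h, hh, hh'⟩ := hu g
  rw [tsum_eq_single h, indicator_of_mem hh, one_mul]
  intro h' hne
  exact indicator_of_notMem (fun hm => hne (hh' _ hm)) _

/-! ### Telescoping -/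

section tele
variable {G : Type*} [Group G]

/-- deformed sum -/
def EE (w : Coc G → G → ℝ) (a : Coc G) (γ : G) : ℝ≥0∞ :=
  ∑' h, ‖a.a h (h * γ) + w a (h * γ) - w a h‖ₑ

/-- triangle sum -/
def TT (a : Coc G) (p : G × G) : ℝ≥0∞ := ∑' h, ‖a.tri h (h * p.1) (h * p.1 * p.2)‖ₑ

lemma EE_mul (w : Coc G → G → ℝ) (a : Coc G) (s γ : G) :
    EE w a (s * γ) ≤ TT a (s, γ) + EE w a s + EE w a γ := by
  have e : EE w a γ = ∑' h, ‖a.a (h * s) (h * s * γ) + w a (h * s * γ) - w a (h * s)‖ₑ :=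
    ((Equiv.mulRight s).tsum_eq (fun h => ‖a.a h (h * γ) + w a (h * γ) - w a h‖ₑ)).symm
  rw [e]
  unfold EE TT
  rw [← ENNReal.tsum_add, ← ENNReal.tsum_add]
  refine ENNReal.tsum_le_tsum fun h => ?_
  have : a.a h (h * (s * γ)) + w a (h * (s * γ)) - w a h =
      -(a.tri h (h * s) (h * s * γ)) + (a.a h (h * s) + w a (h * s) - w a h) +
      (a.a (h * s) (h * s * γ) + w a (h * s * γ) - w a (h * s)) := by
    unfold Coc.tri
    rw [a.anti (h * s * γ) h, mul_assoc]
    ring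
  rw [this]
  refine (enorm_add_le _ _).trans (add_le_add ((enorm_add_le _ _).trans ?_) le_rfl)
  rw [enorm_neg]

lemma sum_le_EE (w : Coc G → G → ℝ) (a : Coc G) (γ : G) :
    ∑' h, ‖a.a h (h * γ)‖ₑ ≤ EE w a γ + 2 * ∑' h, ‖w a h‖ₑ := by
  have e : ∑' h, ‖w a h‖ₑ = ∑' h, ‖w a (h * γ)‖ₑ :=
    ((Equiv.mulRight γ).tsum_eq (fun h => ‖w a h‖ₑ)).symm
  rw [two_mul]
  nth_rewrite 2 [e]
  unfold EE
  rw [← ENNReal.tsum_add, ← ENNReal.tsum_add]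
  refine ENNReal.tsum_le_tsum fun h => ?_
  have : a.a h (h * γ) = (a.a h (h * γ) + w a (h * γ) - w a h) + (w a h + - w a (h * γ)) := by
    ring
  calc ‖a.a h (h * γ)‖ₑ = ‖(a.a h (h * γ) + w a (h * γ) - w a h) + (w a h + - w a (h * γ))‖ₑ := by
        rw [← this]
    _ ≤ _ := (enorm_add_le _ _).trans (add_le_add le_rfl ((enorm_add_le _ _).trans ?_))
  rw [enorm_neg]

lemma tele {w : Coc G → G → ℝ} {S0 S : Finset G} {C : ℝ≥0}
    (h1 : ∀ s ∈ S0, ∀ a, EE w a s ≤ C * a.D S) (L : ℕ) :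
    ∀ γ ∈ (S0 : Set G) ^ (L + 1), ∃ P : List (G × G), P.length = L ∧
      ∀ a, EE w a γ ≤ (P.map (TT a)).sum + (L + 1) * (C * a.D S) := by
  induction L with
  | zero =>
    intro γ hγ
    refine ⟨[], rfl, fun a => ?_⟩
    simp only [zero_add, pow_one] at hγ
    simpa using h1 γ hγ a
  | succ L ih =>
    intro γ hγ
    rw [pow_succ'] at hγ
    obtain ⟨s, hs, γ', hγ', rfl⟩ := Set.mem_mul.1 hγ
    obtain ⟨P, hP, hb⟩ := ih γ' hγ'
    refine ⟨(s, γ') :: P, by simp [hP], fun a => ?_⟩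
    refine (EE_mul w a s γ').trans ?_
    simp only [List.map_cons, List.sum_cons]
    calc _ ≤ TT a (s, γ') + C * a.D S + ((P.map (TT a)).sum + (L + 1) * (C * a.D S)) := by
          gcongr
          · exact h1 s hs a
          · exact hb a
      _ = _ := by push_cast; ring

lemma tele_all {q : ℕ} (hq : 2 ≤ q) {A : G →* lG (q + 1)} (hA : IsLat A) (S0 : Finset G) :
    ∃ (C C' : ℝ≥0) (S S' : Finset G), ∀ L : ℕ, ∀ γ ∈ (S0 : Set G) ^ (L + 1),
      ∃ P : List (G × G), P.length = L ∧ ∀ a : Coc G, ∑' h, ‖a.a h (h * γ)‖ₑ ≤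
        (P.map (TT a)).sum + (L + 1) * (C * a.D S) + 2 * (C' * a.I S') := by
  classical
  obtain ⟨w, ⟨C', S', h1⟩, h2⟩ := rigid hq hA S0
  have h3 : ∀ s : G, ∃ (C : ℝ≥0) (S : Finset G), s ∈ S0 → ∀ a, EE w a s ≤ C * a.D S := by
    intro s
    by_cases hs : s ∈ S0
    · obtain ⟨C, S, h⟩ := h2 s hs
      exact ⟨C, S, fun _ => h⟩
    · exact ⟨0, ∅, fun h => absurd h hs⟩
  choose Cs Ss h4 using h3
  have h5 : ∀ s ∈ S0, ∀ a, EE w a s ≤ ((∑ s ∈ S0, Cs s : ℝ≥0) : ℝ≥0∞) * a.D (S0.biUnion Ss) := by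
    intro s hs a
    refine (h4 s hs a).trans (mul_le_mul' ?_ (a.D_mono (Finset.subset_biUnion_of_mem Ss hs)))
    exact ENNReal.coe_le_coe.2 (Finset.single_le_sum (f := Cs) (fun _ _ => zero_le) hs)
  refine ⟨∑ s ∈ S0, Cs s, C', S0.biUnion Ss, S', fun L γ hγ => ?_⟩
  obtain ⟨P, hP, hb⟩ := tele h5 L γ hγ
  refine ⟨P, hP, fun a => (sum_le_EE w a γ).trans ?_⟩
  gcongr
  · exact hb a
  · exact h1 a

end tele
end TV

namespace TV
open scoped ENNReal NNReal Pointwise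
open MeasureTheory

section orb
variable {G : Type*} [Group G] {k : ℕ}

/-- orbit cocycle sums -/
def oI (ρ : G →* lG (k + 1)) (p : LV (k + 1)) (s : G) (g : lG (k + 1)) : ℝ≥0∞ :=
  ∑' h, ‖ker (ρ h ⊙ p) (ρ (h * s) ⊙ p) g‖ₑ

/-- orbit triangle sums -/
def oT (ρ : G →* lG (k + 1)) (p : LV (k + 1)) (s : G × G) (g : lG (k + 1)) : ℝ≥0∞ :=
  ∑' h, ‖tdef (ρ h ⊙ p) (ρ (h * s.1) ⊙ p) (ρ (h * s.1 * s.2) ⊙ p) g‖ₑ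

variable {ρ : G →* lG (k + 1)} {p : LV (k + 1)}

lemma oI_eq (s : G) (g : lG (k + 1)) :
    oI ρ p s g = ∑' h, ‖ker p (ρ s ⊙ p) ((ρ h)⁻¹ * g)‖ₑ := by
  unfold oI
  refine tsum_congr fun h => ?_
  rw [← ker_act p (ρ s ⊙ p) (ρ h) ((ρ h)⁻¹ * g), mul_inv_cancel_left, map_mul, act_mul]

lemma oT_eq (s : G × G) (g : lG (k + 1)) :
    oT ρ p s g = ∑' h, ‖tdef p (ρ s.1 ⊙ p) (ρ (s.1 * s.2) ⊙ p) ((ρ h)⁻¹ * g)‖ₑ := by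
  unfold oT
  refine tsum_congr fun h => ?_
  rw [← tdef_act p (ρ s.1 ⊙ p) _ (ρ h) ((ρ h)⁻¹ * g), mul_inv_cancel_left, ← act_mul, ← act_mul,
    ← map_mul, ← map_mul, mul_assoc]

variable [Countable G]

lemma oI_meas (hp : p ∈ hyp (k + 1)) (s : G) : Measurable (oI ρ p s) := by
  unfold oI
  exact Measurable.tsum fun h =>
    (ker_cont (act_mem _ hp) (act_mem _ hp)).measurable.enorm

lemma oT_meas (hp : p ∈ hyp (k + 1)) (s : G × G) : Measurable (oT ρ p s) := by
  unfold oT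
  exact Measurable.tsum fun h =>
    (tdef_cont (act_mem _ hp) (act_mem _ hp) (act_mem _ hp)).measurable.enorm

lemma oI_int {F : Set (lG (k + 1))} (hF : MeasurableSet F) (hu : ∀ g, ∃! h, ρ h * g ∈ F)
    (hp : p ∈ hyp (k + 1))
    (s : G) : ∫⁻ g in F, oI ρ p s g ∂(hmu (k + 1)) =
    ∫⁻ g, ‖ker p (ρ s ⊙ p) g‖ₑ ∂(hmu (k + 1)) := by
  simp only [oI_eq]
  exact unfold hF hu (ker_cont hp (act_mem _ hp)).measurable.enorm

lemma oT_int {F : Set (lG (k + 1))} (hF : MeasurableSet F) (hu : ∀ g, ∃! h, ρ h * g ∈ F)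
    (hp : p ∈ hyp (k + 1))
    {K : ℝ≥0} (hK : ∀ x ∈ hyp (k + 1), ∀ y ∈ hyp (k + 1), ∀ z ∈ hyp (k + 1),
    ∫⁻ g, ‖tdef x y z g‖ₑ ∂(hmu (k + 1)) ≤ K) (s : G × G) :
    ∫⁻ g in F, oT ρ p s g ∂(hmu (k + 1)) ≤ K := by
  simp only [oT_eq]
  rw [unfold hF hu (tdef_cont hp (act_mem _ hp) (act_mem _ hp)).measurable.enorm]
  exact hK _ hp _ (act_mem _ hp) _ (act_mem _ hp)

lemma oT_list {F : Set (lG (k + 1))} (hF : MeasurableSet F) (hu : ∀ g, ∃! h, ρ h * g ∈ F)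
    (hp : p ∈ hyp (k + 1))
    {K : ℝ≥0} (hK : ∀ x ∈ hyp (k + 1), ∀ y ∈ hyp (k + 1), ∀ z ∈ hyp (k + 1),
    ∫⁻ g, ‖tdef x y z g‖ₑ ∂(hmu (k + 1)) ≤ K) (P : List (G × G)) :
    ∫⁻ g in F, (P.map fun s => oT ρ p s g).sum ∂(hmu (k + 1)) ≤ P.length * K := by
  induction P with
  | nil => simp
  | cons s P ih =>
    simp only [List.map_cons, List.sum_cons, List.length_cons]
    rw [lintegral_add_left (oT_meas hp s)]
    refine (add_le_add (oT_int hF hu hp hK s) ih).trans (le_of_eq ?_)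
    push_cast; ring

end orb

lemma word_bound {G : Type*} [Group G] {k : ℕ} {ρ : G →* lG (k + 1)} {p : LV (k + 1)}
    (hp : p ∈ hyp (k + 1)) {S0 : Finset G} {l : ℝ} (hl : 0 ≤ l)
    (h : ∀ s ∈ S0, Real.log (lB p (ρ s ⊙ p)) ≤ l) (N : ℕ) :
    ∀ γ ∈ (S0 : Set G) ^ N, Real.log (lB p (ρ γ ⊙ p)) ≤ N * (1 + l) := by
  induction N with
  | zero =>
    intro γ hγ
    simp only [pow_zero, Set.mem_one] at hγ
    subst hγ
    have : lB p p = 1 := hp.1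
    simp [act_one, this]
  | succ N ih =>
    intro γ hγ
    rw [pow_succ'] at hγ
    obtain ⟨s, hs, γ', hγ', rfl⟩ := Set.mem_mul.1 hγ
    have h1 := quasi_triangle hp (act_mem (ρ s) hp) (act_mem (ρ (s * γ')) hp)
    have h2 : lB (ρ s ⊙ p) (ρ (s * γ') ⊙ p) = lB p (ρ γ' ⊙ p) := by
      rw [map_mul, act_mul, lB_act]
    rw [h2] at h1
    have h3 := ih γ' hγ'
    have h4 := h s hs
    have p1 := one_le_lB hp (act_mem (ρ s) hp)
    have p2 := one_le_lB hp (act_mem (ρ γ') hp)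
    have p3 := one_le_lB hp (act_mem (ρ (s * γ')) hp)
    have h5 := Real.log_le_log (by linarith) h1
    rw [Real.log_mul (by positivity) (by positivity), Real.log_mul (by norm_num) (by positivity)] at h5
    have := Real.log_two_lt_d9
    push_cast
    linarith

theorem disp_upper {G : Type*} [Group G] {q : ℕ} (hq : 2 ≤ q) {A : G →* lG (q + 1)}
    (hA : IsLat A) (S0 : Finset G) (hgen : ∀ g, ∃ N, g ∈ (S0 : Set G) ^ N) (k : ℕ) :
    ∃ K1 K2 : ℝ≥0, ∀ ρ : G →* lG (k + 1), UDisc ρ → ∀ p ∈ hyp (k + 1), ∀ l : ℝ, 0 ≤ l →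
      (∀ s ∈ S0, Real.log (lB p (ρ s ⊙ p)) ≤ l) → ∀ L : ℕ, ∀ γ ∈ (S0 : Set G) ^ (L + 1),
      Real.log (lB p (ρ γ ⊙ p)) ≤ K1 * (1 + l) + K2 * (L + 1) := by
  classical
  haveI : Countable G := hA.countable
  obtain ⟨C, C', S, S', hT⟩ := tele_all hq hA S0
  obtain ⟨Ku, hKu⟩ := ker_upper k
  obtain ⟨Kt, hKt⟩ := tdef_bound k
  obtain ⟨Kl, hKl⟩ := ker_lower k
  choose N hN using hgen
  refine ⟨Kl + Kl * (2 * (C' * ∑ s ∈ S', Ku * (1 + N s))), Kl * (Kt + C * (S.card * (S.card * Kt))),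
    fun ρ hρ p hp l hl hs L γ hγ => ?_⟩
  obtain ⟨F, hF, hu⟩ := exists_fund hρ
  obtain ⟨P, hPL, hP⟩ := hT L γ hγ
  have hI : ∀ s, ∫⁻ g in F, oI ρ p s g ∂(hmu (k + 1)) ≤
      ((Ku * (1 + N s) : ℝ≥0) : ℝ≥0∞) * ENNReal.ofReal (1 + l) := by
    intro s
    rw [oI_int hF hu hp]
    refine (hKu _ hp _ (act_mem _ hp)).trans ?_
    push_cast
    rw [mul_assoc]
    gcongr
    have := word_bound hp hl hs (N s) s (hN s)
    calc (1 : ℝ≥0∞) + ENNReal.ofReal (Real.log (lB p (ρ s ⊙ p)))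
        ≤ 1 + ENNReal.ofReal (N s * (1 + l)) := by gcongr
      _ = 1 + N s * ENNReal.ofReal (1 + l) := by
          rw [ENNReal.ofReal_mul (by positivity)]; simp
      _ ≤ ENNReal.ofReal (1 + l) + N s * ENNReal.ofReal (1 + l) := by
          gcongr
          rw [ENNReal.one_le_ofReal]; linarith
      _ = _ := by ring
  have hfin : ∀ᵐ g ∂((hmu (k + 1)).restrict F), ∀ s, oI ρ p s g ≠ ⊤ := by
    rw [ae_all_iff]
    intro s
    have := ae_lt_top (oI_meas hp s) (ne_top_of_le_ne_top (by finiteness) (hI s))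
    exact this.mono fun g hg => hg.ne
  have hae : ∀ᵐ g ∂((hmu (k + 1)).restrict F), oI ρ p γ g ≤
      (P.map fun s => oT ρ p s g).sum + (L + 1) * (C * ∑ s ∈ S, ∑ t ∈ S, oT ρ p (s, t) g) +
      2 * (C' * ∑ s ∈ S', oI ρ p s g) := by
    filter_upwards [hfin] with g hg
    exact hP ⟨fun x y => ker (ρ x ⊙ p) (ρ y ⊙ p) g, fun x y => ker_anti _ _ _, hg⟩
  have mD : Measurable fun g => ∑ s ∈ S, ∑ t ∈ S, oT ρ p (s, t) g :=
    Finset.measurable_fun_sum _ fun s _ => Finset.measurable_fun_sum _ fun t _ => oT_meas hp _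
  have mI : Measurable fun g => ∑ s ∈ S', oI ρ p s g :=
    Finset.measurable_fun_sum _ fun s _ => oI_meas hp _
  have h1 : ∫⁻ g, ‖ker p (ρ γ ⊙ p) g‖ₑ ∂(hmu (k + 1)) ≤
      L * Kt + (L + 1) * (C * (S.card * (S.card * Kt))) +
      2 * (C' * ((∑ s ∈ S', Ku * (1 + N s) : ℝ≥0) * ENNReal.ofReal (1 + l))) := by
    rw [← oI_int hF hu hp]
    refine (lintegral_mono_ae hae).trans ?_
    rw [lintegral_add_right _ ((mI.const_mul _).const_mul _),
      lintegral_add_right _ ((mD.const_mul _).const_mul _),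
      lintegral_const_mul _ (mD.const_mul _), lintegral_const_mul _ mD,
      lintegral_const_mul _ (mI.const_mul _), lintegral_const_mul _ mI]
    refine add_le_add (add_le_add ?_ ?_) ?_
    · exact (oT_list hF hu hp hKt P).trans (by rw [hPL])
    · refine mul_le_mul' le_rfl (mul_le_mul' le_rfl ?_)
      rw [lintegral_finset_sum _ fun s _ => Finset.measurable_fun_sum _ fun t _ => oT_meas hp _]
      refine (Finset.sum_le_card_nsmul _ _ ((S.card : ℝ≥0∞) * (Kt : ℝ≥0∞)) fun s _ => ?_).trans
        (by rw [nsmul_eq_mul])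
      rw [lintegral_finset_sum _ fun t _ => oT_meas hp _]
      refine (Finset.sum_le_card_nsmul _ _ (Kt : ℝ≥0∞) fun t _ => ?_).trans (by rw [nsmul_eq_mul])
      exact oT_int hF hu hp hKt _
    · refine mul_le_mul' le_rfl (mul_le_mul' le_rfl ?_)
      rw [lintegral_finset_sum _ fun s _ => oI_meas hp _, ENNReal.coe_finset_sum, Finset.sum_mul]
      exact Finset.sum_le_sum fun s _ => hI s
  have h2 := (hKl p hp _ (act_mem (ρ γ) hp)).trans
    (mul_le_mul' le_rfl (add_le_add le_rfl h1))
  set Q := ∑ s ∈ S', Ku * (1 + (N s : ℝ≥0))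
  set c : ℝ≥0 := (S.card : ℝ≥0)
  have h3 : (Kl : ℝ≥0∞) * (1 + (L * Kt + (L + 1) * (C * (S.card * (S.card * Kt))) +
      2 * (C' * (Q * ENNReal.ofReal (1 + l))))) =
      ENNReal.ofReal (Kl * (1 + (L * Kt + (L + 1) * (C * (c * (c * Kt))) +
      2 * (C' * (Q * (1 + l)))))) := by
    obtain ⟨t, ht⟩ : ∃ t : ℝ≥0, (t : ℝ) = 1 + l := ⟨⟨1 + l, by positivity⟩, rfl⟩
    rw [← ht, ENNReal.ofReal_coe_nnreal]
    have e : (Kl * (1 + (L * Kt + (L + 1) * (C * (c * (c * Kt))) +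
      2 * (C' * (Q * t)))) : ℝ) = ((Kl * (1 + (L * Kt + (L + 1) * (C * (c * (c * Kt))) +
      2 * (C' * (Q * t)))) : ℝ≥0) : ℝ) := by push_cast; rfl
    rw [e, ENNReal.ofReal_coe_nnreal]
    push_cast
    simp [c]
  rw [h3, ENNReal.ofReal_le_ofReal_iff (by positivity)] at h2
  refine h2.trans ?_
  push_cast
  have e1 : (0 : ℝ) ≤ Kl * l := by positivity
  have e2 : (0 : ℝ) ≤ Kl * Kt := by positivity
  nlinarith

/-- midpoint argument -/
lemma mid_lower {G : Type*} [Group G] {k : ℕ} {ρ : G →* lG (k + 1)} {p0 : LV (k + 1)}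
    (hp0 : p0 ∈ hyp (k + 1)) {S0 : Finset G} (h1 : 1 ∈ S0) {m : ℝ} (hm : 1 ≤ m)
    (h : ∀ p ∈ hyp (k + 1), ∃ s ∈ S0, m ≤ lB p (ρ s ⊙ p)) (L : ℕ) :
    ∀ R : ℝ, ∀ p ∈ hyp (k + 1), (∀ γ ∈ (S0 : Set G) ^ L, lB (ρ γ ⊙ p0) p ≤ R) →
      Real.sqrt (m / 2) ^ L ≤ R := by
  induction L with
  | zero =>
    intro R p hp hR
    have := hR 1 (by simp)
    rw [map_one, act_one] at this
    simpa using (one_le_lB hp0 hp).trans this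
  | succ L ih =>
    intro R p hp hR
    obtain ⟨s, hs, hms⟩ := h p hp
    have hq := act_mem (ρ s)⁻¹ hp
    have e : lB p ((ρ s)⁻¹ ⊙ p) = lB p (ρ s ⊙ p) := by
      rw [lB_comm p ((ρ s)⁻¹ ⊙ p), lB_inv_act]
    have hpos : 0 < Real.sqrt (m / 2) := Real.sqrt_pos.2 (by linarith)
    have hle : Real.sqrt (m / 2) ≤ Real.sqrt ((1 + lB p ((ρ s)⁻¹ ⊙ p)) / 2) :=
      Real.sqrt_le_sqrt (by rw [e]; linarith)
    have hR0 : 0 ≤ R := by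
      have h2 := hR (1 * 1 ^ L) (by
        rw [pow_succ']; exact Set.mul_mem_mul h1 (Set.pow_mem_pow h1))
      have := one_le_lB (act_mem (ρ (1 * 1 ^ L)) hp0) hp
      linarith
    have := ih (R / Real.sqrt (m / 2)) (mid p ((ρ s)⁻¹ ⊙ p)) (mid_mem hp hq) fun γ hγ => by
      refine (lB_mid_le hp hq (M := R) ?_ ?_).trans ?_
      · refine hR γ ?_
        rw [pow_succ', ← one_mul γ]; exact Set.mul_mem_mul h1 hγ
      · rw [lB_comm, lB_inv_act, ← act_mul, ← map_mul, lB_comm]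
        refine hR _ ?_
        rw [pow_succ']; exact Set.mul_mem_mul hs hγ
      · gcongr
    rw [le_div_iff₀ hpos] at this
    rwa [pow_succ]

theorem disp_bound {G : Type*} [Group G] {q : ℕ} (hq : 2 ≤ q) {A : G →* lG (q + 1)}
    (hA : IsLat A) (S0 : Finset G) (h1 : 1 ∈ S0) (hgen : ∀ g, ∃ N, g ∈ (S0 : Set G) ^ N) (k : ℕ) :
    ∃ Λ : ℝ, ∀ ρ : G →* lG (k + 1), UDisc ρ → ∃ p ∈ hyp (k + 1), ∀ s ∈ S0,
      lB p (ρ s ⊙ p) ≤ Λ := by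
  obtain ⟨K1, K2, hK⟩ := disp_upper hq hA S0 hgen k
  obtain ⟨L, hL⟩ := exists_nat_ge (2 * (K1 : ℝ) + 2)
  refine ⟨2 * Real.exp (K1 * 2 + K2 * (L + 1) + (L + 1)), fun ρ hρ => ?_⟩
  have hne : S0.Nonempty := ⟨1, h1⟩
  let f : LV (k + 1) → ℝ := fun p => S0.sup' hne fun s => lB p (ρ s ⊙ p)
  have hf1 : ∀ p ∈ hyp (k + 1), 1 ≤ f p := fun p hp =>
    (one_le_lB hp (act_mem (ρ 1) hp)).trans (Finset.le_sup' (fun s => lB p (ρ s ⊙ p)) h1)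
  have hbd : BddBelow (f '' hyp (k + 1)) := ⟨1, by rintro _ ⟨p, hp, rfl⟩; exact hf1 p hp⟩
  have hnon : (f '' hyp (k + 1)).Nonempty := ⟨_, lo, lo_mem, rfl⟩
  set m := sInf (f '' hyp (k + 1)) with hm
  have hm1 : 1 ≤ m := le_csInf hnon (by rintro _ ⟨p, hp, rfl⟩; exact hf1 p hp)
  obtain ⟨_, ⟨p, hp, rfl⟩, hpm⟩ := exists_lt_of_csInf_lt hnon (show m < 2 * m by linarith)
  refine ⟨p, hp, fun s hs => ?_⟩
  refine (Finset.le_sup' (fun s => lB p (ρ s ⊙ p)) hs).trans (hpm.le.trans ?_)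
  have hmin : ∀ p ∈ hyp (k + 1), ∃ s ∈ S0, m ≤ lB p (ρ s ⊙ p) := by
    intro p hp
    obtain ⟨s, hs, e⟩ := S0.exists_mem_eq_sup' hne fun s => lB p (ρ s ⊙ p)
    exact ⟨s, hs, (csInf_le hbd ⟨p, hp, rfl⟩).trans (le_of_eq e)⟩
  have hlog : 0 ≤ Real.log (2 * m) := Real.log_nonneg (by linarith)
  have hup := hK ρ hρ p hp (Real.log (2 * m)) hlog (fun s hs => by
    refine Real.log_le_log ?_ ?_
    · have := one_le_lB hp (act_mem (ρ s) hp); linarith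
    · exact (Finset.le_sup' (fun s => lB p (ρ s ⊙ p)) hs).trans hpm.le) L
  have hlow := mid_lower hp h1 hm1 hmin (L + 1)
    (Real.exp (K1 * (1 + Real.log (2 * m)) + K2 * (L + 1))) p hp (fun γ hγ => by
      have h2 := hup γ hγ
      rw [lB_comm]
      have := one_le_lB hp (act_mem (ρ γ) hp)
      rwa [← Real.log_le_iff_le_exp (by linarith)])
  have h3 := Real.log_le_log (pow_pos (Real.sqrt_pos.2 (by linarith)) _) hlow
  rw [Real.log_exp, Real.log_pow, Real.log_sqrt (by linarith), Real.log_div (by linarith) (by norm_num),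
    Real.log_mul (by norm_num) (by linarith)] at h3
  have hl2 := Real.log_two_lt_d9
  have hl2' := Real.log_two_gt_d9
  have hlm : 0 ≤ Real.log m := Real.log_nonneg hm1
  gcongr
  rw [← Real.log_le_iff_le_exp (by linarith)]
  push_cast at h3
  have hK0 : (0 : ℝ) ≤ K1 := K1.2
  have h4 : Real.log m ≤ ((L + 1) / 2 - K1) * Real.log m := by
    refine le_mul_of_one_le_left hlm ?_
    linarith
  have h5 : (K1 : ℝ) * Real.log 2 ≤ K1 * 1 := by gcongr; linarith
  have h6 : ((L : ℝ) + 1) * Real.log 2 ≤ (L + 1) * 1 := by gcongr; linarith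
  nlinarith

end TV

namespace TV
open scoped ENNReal NNReal Pointwise

section zass
variable {k : ℕ}

/-- distance to the identity -/
def nrm (A : lG k) : ℝ := max ‖opr A - 1‖ ‖opr A⁻¹ - 1‖

lemma nrm_cont : Continuous (nrm : lG k → ℝ) :=
  ((continuous_opr.sub continuous_const).norm).max
    (((continuous_opr.comp continuous_inv).sub continuous_const).norm)

lemma nrm_one : nrm (1 : lG k) = 0 := by simp [nrm, opr_one]

lemma nrm_nonneg (A : lG k) : 0 ≤ nrm A := (norm_nonneg _).trans (le_max_left _ _)

lemma nrm_inv (A : lG k) : nrm A⁻¹ = nrm A := by simp [nrm, max_comm]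

lemma norm_opr_inv_le (A : lG k) : ‖opr A⁻¹‖ ≤ 1 + nrm A := by
  have h1 : opr A⁻¹ = 1 + (opr A⁻¹ - 1) := by abel
  have h2 : ‖(1 : LV k →L[ℝ] LV k)‖ ≤ 1 := ContinuousLinearMap.norm_id_le
  calc ‖opr A⁻¹‖ = ‖1 + (opr A⁻¹ - 1)‖ := by rw [← h1]
    _ ≤ ‖(1 : LV k →L[ℝ] LV k)‖ + ‖opr A⁻¹ - 1‖ := norm_add_le _ _
    _ ≤ 1 + nrm A := add_le_add h2 (le_max_right _ _)

lemma comm_bound (A B : lG k) :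
    ‖opr (A * B * A⁻¹ * B⁻¹) - 1‖ ≤ 2 * nrm A * nrm B * (1 + nrm A) * (1 + nrm B) := by
  have e : opr (A * B * A⁻¹ * B⁻¹) - 1 =
      ((opr A - 1) * (opr B - 1) - (opr B - 1) * (opr A - 1)) * (opr A⁻¹ * opr B⁻¹) := by
    have h1 : opr A * opr B * (opr A⁻¹ * opr B⁻¹) = opr (A * B * A⁻¹ * B⁻¹) := by
      rw [← opr_mul, ← opr_mul, ← opr_mul, mul_assoc (A * B)]
    have h2 : opr B * opr A * (opr A⁻¹ * opr B⁻¹) = 1 := by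
      rw [← opr_mul, ← opr_mul, ← opr_mul]
      have h0 : B * A * (A⁻¹ * B⁻¹) = 1 := by group
      rw [h0, opr_one]
    have h3 : (opr A - 1) * (opr B - 1) - (opr B - 1) * (opr A - 1) =
        opr A * opr B - opr B * opr A := by
      simp only [sub_mul, mul_sub, one_mul, mul_one]; abel
    rw [h3, sub_mul, h1, h2]
  have a1 : ‖opr A - 1‖ ≤ nrm A := le_max_left _ _
  have b1 : ‖opr B - 1‖ ≤ nrm B := le_max_left _ _
  have a0 := nrm_nonneg A
  have b0 := nrm_nonneg B
  rw [e]
  refine (norm_mul_le _ _).trans ?_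
  have h4 : ‖(opr A - 1) * (opr B - 1) - (opr B - 1) * (opr A - 1)‖ ≤ 2 * nrm A * nrm B := by
    refine (norm_sub_le _ _).trans ?_
    have h5 := (norm_mul_le (opr A - 1) (opr B - 1)).trans
      (mul_le_mul a1 b1 (norm_nonneg _) a0)
    have h6 := (norm_mul_le (opr B - 1) (opr A - 1)).trans
      (mul_le_mul b1 a1 (norm_nonneg _) b0)
    linarith
  have h7 : ‖opr A⁻¹ * opr B⁻¹‖ ≤ (1 + nrm A) * (1 + nrm B) :=
    (norm_mul_le _ _).trans (mul_le_mul (norm_opr_inv_le A) (norm_opr_inv_le B) (norm_nonneg _)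
      (by positivity))
  calc _ ≤ (2 * nrm A * nrm B) * ((1 + nrm A) * (1 + nrm B)) :=
        mul_le_mul h4 h7 (norm_nonneg _) (by positivity)
    _ = _ := by ring

lemma comm_half {A B : lG k} (hA : nrm A < 1/16) (hB : nrm B < 1/16) :
    nrm (A * B * A⁻¹ * B⁻¹) ≤ nrm B / 2 := by
  have a0 := nrm_nonneg A
  have b0 := nrm_nonneg B
  have key : 2 * nrm A * nrm B * (1 + nrm A) * (1 + nrm B) ≤ nrm B / 2 := by
    have h1 : (1 + nrm A) * (1 + nrm B) ≤ 2 * 2 := by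
      apply mul_le_mul <;> linarith
    have h2 : 2 * nrm A * nrm B ≤ nrm B / 8 := by nlinarith
    calc 2 * nrm A * nrm B * (1 + nrm A) * (1 + nrm B)
        = 2 * nrm A * nrm B * ((1 + nrm A) * (1 + nrm B)) := by ring
      _ ≤ (nrm B / 8) * (2 * 2) := mul_le_mul h2 h1 (by positivity) (by positivity)
      _ = _ := by ring
  refine max_le ((comm_bound A B).trans key) ?_
  have e : (A * B * A⁻¹ * B⁻¹)⁻¹ = B * A * B⁻¹ * A⁻¹ := by group
  rw [e]
  refine (comm_bound B A).trans (le_trans (le_of_eq ?_) key)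
  ring

lemma zass {G : Type*} [Group G] {q : ℕ} {A : G →* lG q} (hA : IsLat A) {σ : G →* lG k}
    (hσ : UDisc σ) {g h : G} (hg : g ≠ 1) (h1 : nrm (σ g) < 1/16) (h2 : nrm (σ h) < 1/16) :
    g * h = h * g := by
  let c : ℕ → G := fun j => (fun x => g * x * g⁻¹ * x⁻¹)^[j] h
  have c0 : c 0 = h := rfl
  have cs : ∀ j, c (j + 1) = g * c j * g⁻¹ * (c j)⁻¹ := fun j =>
    Function.iterate_succ_apply' _ _ _
  have hb : ∀ j, nrm (σ (c j)) ≤ 1/16 * (1/2) ^ j ∧ nrm (σ (c j)) < 1/16 := by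
    intro j
    induction j with
    | zero => rw [c0]; exact ⟨by linarith, h2⟩
    | succ j ih =>
      have e : σ (c (j + 1)) = σ g * σ (c j) * (σ g)⁻¹ * (σ (c j))⁻¹ := by
        rw [cs]; simp only [map_mul, map_inv]
      have := comm_half h1 ih.2
      rw [← e] at this
      have h0 := nrm_nonneg (σ (c j))
      refine ⟨?_, by linarith [ih.2]⟩
      rw [pow_succ]; linarith [ih.1]
  have ht : Tendsto (fun j => σ (c j)) atTop (𝓝 1) := by
    rw [isEmbedding_opr.tendsto_nhds_iff]
    rw [tendsto_iff_norm_sub_tendsto_zero]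
    refine squeeze_zero (fun _ => norm_nonneg _) (fun j => (le_max_left _ _).trans (hb j).1) ?_
    have := (tendsto_pow_atTop_nhds_zero_of_lt_one (r := (1/2 : ℝ)) (by norm_num)
      (by norm_num)).const_mul (1/16 : ℝ)
    simpa using this
  obtain ⟨U, hU, hU1⟩ := hσ
  obtain ⟨J, hJ⟩ := (ht.eventually_mem hU).exists
  have hJ1 : c J = 1 := hU1 _ hJ
  have desc : ∀ j, g * c j = c j * g → g * h = h * g := by
    intro j
    induction j with
    | zero => exact fun e => e
    | succ j ih =>
      intro e
      refine ih ?_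
      rw [cs] at e
      refine (hA.csa hg ?_).symm
      have hc : Commute g (c j * g⁻¹ * (c j)⁻¹) := by
        have e1 : Commute g (g * c j * g⁻¹ * (c j)⁻¹) := e
        have e2 := ((Commute.refl g).inv_right).mul_right e1
        have e4 : g⁻¹ * (g * c j * g⁻¹ * (c j)⁻¹) = c j * g⁻¹ * (c j)⁻¹ := by group
        rwa [e4] at e2
      have hc2 := hc.inv_right
      have e3 : (c j * g⁻¹ * (c j)⁻¹)⁻¹ = c j * g * (c j)⁻¹ := by group
      rw [e3] at hc2
      exact hc2
  exact desc J (by rw [hJ1]; simp)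

lemma udisc_closed {G : Type*} [Group G] {q : ℕ} (hq : 2 ≤ q) {A : G →* lG q} (hA : IsLat A)
    {S0 : Finset G} (h1 : 1 ∈ S0) (hgen : Subgroup.closure (S0 : Set G) = ⊤)
    {X : Type*} [TopologicalSpace X] (Φ : X → (G →* lG k))
    (hΦ : ∀ g, Continuous fun x => Φ x g) : IsClosed {x | UDisc (Φ x)} := by
  rw [← isOpen_compl_iff, isOpen_iff_mem_nhds]
  intro x hx
  have hx' : ¬ UDisc (Φ x) := hx
  let V : Set (lG k) := ⋂ s ∈ S0, {B | nrm (Φ x s * B * (Φ x s)⁻¹) < 1/16}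
  have hV : V ∈ 𝓝 (1 : lG k) := by
    refine IsOpen.mem_nhds (isOpen_biInter_finset fun s _ => ?_) ?_
    · exact isOpen_lt (nrm_cont.comp (by fun_prop)) continuous_const
    · simp only [V, mem_iInter, Set.mem_ofPred_eq]
      intro s _
      rw [mul_one, mul_inv_cancel, nrm_one]; norm_num
  have : ∃ g, Φ x g ∈ V ∧ g ≠ 1 := by
    by_contra hcon
    push Not at hcon
    exact hx' ⟨V, hV, hcon⟩
  obtain ⟨g, hgV, hg⟩ := this
  have hgs : ∀ s ∈ S0, nrm (Φ x (s * g * s⁻¹)) < 1/16 := by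
    intro s hs
    have : nrm (Φ x s * Φ x g * (Φ x s)⁻¹) < 1/16 := mem_iInter₂.1 hgV s hs
    rwa [map_mul, map_mul, map_inv]
  have hO : IsOpen (⋂ s ∈ S0, {y | nrm (Φ y (s * g * s⁻¹)) < 1/16}) :=
    isOpen_biInter_finset fun s _ => isOpen_lt (nrm_cont.comp (hΦ _)) continuous_const
  refine mem_of_superset (hO.mem_nhds (mem_iInter₂.2 hgs)) ?_
  intro y hy hyU
  have hy' : ∀ s ∈ S0, nrm (Φ y (s * g * s⁻¹)) < 1/16 := fun s hs => mem_iInter₂.1 hy s hs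
  have hgy : nrm (Φ y g) < 1/16 := by simpa using hy' 1 h1
  have hcom : ∀ s ∈ S0, s * g = g * s := fun s hs =>
    hA.csa hg (zass hA hyU hg hgy (hy' s hs))
  refine hg (hA.center hq fun h => ?_)
  have hc : (S0 : Set G) ⊆ Subgroup.centralizer {g} := by
    intro s hs
    rw [SetLike.mem_coe, Subgroup.mem_centralizer_iff]
    rintro _ rfl
    exact (hcom s hs).symm
  have hle := (Subgroup.closure_le _).2 hc
  rw [hgen] at hle
  have := hle (Subgroup.mem_top h)
  rw [Subgroup.mem_centralizer_iff] at this
  exact (this g rfl).symm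
end zass

lemma udisc_conj {G : Type*} [Group G] {k : ℕ} {σ τ : G →* lG k} (H : lG k)
    (h : ∀ g, τ g = H * σ g * H⁻¹) (hσ : UDisc σ) : UDisc τ := by
  obtain ⟨U, hU, h1⟩ := hσ
  have hc : Continuous fun B : lG k => H⁻¹ * B * H := by fun_prop
  refine ⟨(fun B => H⁻¹ * B * H) ⁻¹' U, hc.continuousAt (by simpa using hU), fun g hg => ?_⟩
  apply h1
  simp only [mem_preimage, h] at hg
  convert hg using 1; group

section rep
variable {G : Type*} [Group G] {n : ℕ}

/-- the Lorentz representation attached to a Möbius representation -/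
def Phi (ρ : MobRepSp G (n + 1)) : G →* lG (n + 1 + 1) :=
  mobEquiv.symm.toMonoidHom.comp
    (ρ.1.codRestrict (MobiusGrp (n + 1)) ρ.2)

lemma Psi_Phi (ρ : MobRepSp G (n + 1)) (g : G) : Psi (Phi ρ g) = ρ.1 g := by
  rw [← mobEquiv_coe]
  show ((mobEquiv (mobEquiv.symm ⟨ρ.1 g, ρ.2 g⟩) : MobiusGrp (n + 1)) :
    Sph (n + 1) ≃ₜ Sph (n + 1)) = _
  rw [MulEquiv.apply_symm_apply]

lemma Phi_cont (g : G) : Continuous fun ρ : MobRepSp G (n + 1) => Phi ρ g := by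
  rw [continuous_iff_continuousAt]
  intro ρ
  refine tendsto_of_pointwise fun x => ?_
  simp only [← Psi_apply, Psi_Phi]
  have h1 : Continuous fun ρ : MobRepSp G (n + 1) => ρ.1 g :=
    (continuous_apply g).comp continuous_induced_dom
  have h2 : Continuous fun f : Sph (n + 1) ≃ₜ Sph (n + 1) =>
      ((⟨f, f.continuous⟩ : C(Sph (n + 1), Sph (n + 1))),
        (⟨f.symm, f.symm.continuous⟩ : C(Sph (n + 1), Sph (n + 1)))) := continuous_induced_dom
  have h3 : Continuous fun f : Sph (n + 1) ≃ₜ Sph (n + 1) => f x :=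
    (continuous_eval_const (F := C(Sph (n + 1), Sph (n + 1))) x).comp (continuous_fst.comp h2)
  exact (h3.comp h1).tendsto ρ

/-- faithful and discrete -/
def DF (ρ : MobRepSp G (n + 1)) : Prop :=
  Function.Injective ρ.1 ∧ IsDiscreteSubgroup ρ.1.range

lemma DF_iff (ρ : MobRepSp G (n + 1)) : DF ρ ↔ UDisc (Phi ρ) := by
  have hs : ∀ (A : lG (n + 1 + 1)) x, Psi A x = psi A x := Psi_apply
  constructor
  · rintro ⟨h1, h2⟩
    have hinj : Function.Injective (Phi ρ) := fun g h e => h1 (by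
      rw [← Psi_Phi, ← Psi_Phi, e])
    refine udisc_of_finite hinj ?_
    by_contra! hcon
    obtain ⟨u, hu, hu2⟩ := exists_inj_seq (Phi ρ) 1 hcon
    refine h2 ⟨fun j => ⟨ρ.1 (u j), u j, rfl⟩, fun i j e => hu (h1 (congrArg Subtype.val e)), fun x => ?_⟩
    have h3 : Continuous fun A : lG (n + 1 + 1) => psi A x :=
      psi_continuous.comp (continuous_id.prodMk continuous_const)
    have := (h3.tendsto 1).comp hu2
    rw [psi_one] at this
    refine Tendsto.congr (fun j => ?_) this
    show psi (Phi ρ (u j)) x = ρ.1 (u j) x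
    rw [← Psi_Phi, hs]
  · rintro ⟨U, hU, h1⟩
    have hinj : Function.Injective ρ.1 := by
      rw [injective_iff_map_eq_one]
      intro g hg
      apply h1
      have : Phi ρ g = 1 := Psi_injective (by rw [Psi_Phi, hg, map_one])
      rw [this]; exact mem_of_mem_nhds hU
    refine ⟨hinj, ?_⟩
    rintro ⟨u, hu, hu2⟩
    choose v hv using fun j => (u j).2
    have ht : Tendsto (fun j => Phi ρ (v j)) atTop (𝓝 1) := by
      refine tendsto_of_pointwise fun x => ?_
      have e : ∀ j, psi (Phi ρ (v j)) x = (u j : Sph (n + 1) ≃ₜ Sph (n + 1)) x := fun j => by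
        rw [← hs, Psi_Phi, hv]
      simp only [e]
      rw [← hs, map_one]
      exact hu2 x
    obtain ⟨N, hN⟩ := eventually_atTop.1 (ht.eventually_mem hU)
    have e1 := h1 _ (hN N le_rfl)
    have e2 := h1 _ (hN (N + 1) (by omega))
    have : u N = u (N + 1) := Subtype.ext (by rw [← hv, ← hv, e1, e2])
    have := hu this
    omega

lemma DF_conj {ρ σ : MobRepSp G (n + 1)} (h : conjRel G (n + 1) ρ σ) : DF ρ ↔ DF σ := by
  obtain ⟨f, hf, h⟩ := h
  let H : lG (n + 1 + 1) := mobEquiv.symm ⟨f, hf⟩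
  have hH : Psi H = f := by rw [← mobEquiv_coe]; simp [H]
  have h1 : ∀ g, Phi σ g = H * Phi ρ g * H⁻¹ := fun g => Psi_injective (by
    rw [Psi_Phi, map_mul, map_mul, map_inv, hH, Psi_Phi, h])
  rw [DF_iff, DF_iff]
  refine ⟨udisc_conj H h1, udisc_conj H⁻¹ fun g => ?_⟩
  rw [h1]; group

lemma Hyp_preimage :
    (Quot.mk (conjRel G (n + 1))) ⁻¹' (HypVariety G (n + 1)) = {ρ | DF ρ} := by
  ext ρ
  constructor
  · rintro ⟨σ, e, h⟩
    have := congrArg (Quot.lift DF fun a b hab => propext (DF_conj hab)) e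
    exact (show DF σ = DF ρ from this).mp h
  · intro h
    exact ⟨ρ, rfl, h⟩

/-- the representation attached to a function -/
def Theta (f : {f : G → lG (n + 1 + 1) // ∀ g h, f (g * h) = f g * f h}) : MobRepSp G (n + 1) :=
  ⟨Psi.comp (MonoidHom.mk' f.1 f.2), fun g => Psi_mem _⟩

lemma Theta_cont : Continuous (Theta : _ → MobRepSp G (n + 1)) := by
  refine continuous_induced_rng.2 (continuous_pi fun g => ?_)
  exact Psi_continuous.comp ((continuous_apply g).comp continuous_subtype_val)

lemma compact_homs {k : ℕ} {S0 : Finset G} (hgen : ∀ g, ∃ N, g ∈ (S0 : Set G) ^ N) (Λ : ℝ) :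
    IsCompact {f : {f : G → lG (k + 1) // ∀ g h, f (g * h) = f g * f h} |
      ∀ s ∈ S0, (f.1 s ⊙ (lo : LV (k + 1))).2 ≤ Λ} := by
  refine Subtype.isCompact_iff.2 ?_
  choose N hN using hgen
  let l := max 0 (Real.log Λ)
  have hK := isCompact_univ_pi fun g : G => isCompact_ball (k := k + 1) (Real.exp (N g * (1 + l)))
  have e : (Subtype.val '' {f : {f : G → lG (k + 1) // ∀ g h, f (g * h) = f g * f h} |
      ∀ s ∈ S0, (f.1 s ⊙ (lo : LV (k + 1))).2 ≤ Λ}) = {f : G → lG (k + 1) |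
        (∀ g h, f (g * h) = f g * f h) ∧ ∀ s ∈ S0, (f s ⊙ (lo : LV (k + 1))).2 ≤ Λ} := by
    ext f
    constructor
    · rintro ⟨f, hf, rfl⟩; exact ⟨f.2, hf⟩
    · rintro ⟨h1, h2⟩; exact ⟨⟨f, h1⟩, h2, rfl⟩
  rw [e]
  refine hK.of_isClosed_subset ?_ ?_
  · refine IsClosed.and ?_ ?_
    · simp only [Set.setOf_forall]
      refine isClosed_iInter fun g => isClosed_iInter fun h => isClosed_eq ?_ ?_
      · exact continuous_apply _
      · exact (continuous_apply _).mul (continuous_apply _)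
    · simp only [Set.setOf_forall]
      refine isClosed_iInter fun s => isClosed_iInter fun _ => isClosed_le ?_ continuous_const
      exact continuous_snd.comp ((continuous_act_left lo).comp (continuous_apply s))
  · rintro f ⟨h1, h2⟩ g -
    have := word_bound (ρ := MonoidHom.mk' f h1) (lo_mem (k := k + 1)) (S0 := S0) (l := l)
      (le_max_left _ _) (fun s hs => by
        rw [lB_lo']
        have h3 := one_le_snd (act_mem (f s) (lo_mem (k := k + 1)))
        exact (Real.log_le_log (by simpa using by linarith) (h2 s hs)).trans (le_max_right _ _))
      (N g) g (hN g)
    rw [lB_lo'] at this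
    have h3 := one_le_snd (act_mem (f g) (lo_mem (k := k + 1)))
    have h4 : Real.log (f g ⊙ (lo : LV (k + 1))).2 ≤ N g * (1 + l) := this
    exact (Real.log_le_iff_le_exp (by linarith)).1 h4

end rep

lemma exists_gen {G : Type*} [Group G] {S : Finset G} (hS : Subgroup.closure (S : Set G) = ⊤) :
    ∃ S0 : Finset G, 1 ∈ S0 ∧ Subgroup.closure (S0 : Set G) = ⊤ ∧
      ∀ g, ∃ N, g ∈ (S0 : Set G) ^ N := by
  classical
  let S0 : Finset G := insert 1 (S ∪ S.image (·⁻¹))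
  have hsub : (S : Set G) ⊆ S0 := fun s hs => by
    simp only [S0, Finset.coe_insert, Finset.coe_union]
    exact Or.inr (Or.inl hs)
  have hinv : (S0 : Set G)⁻¹ = S0 := by
    ext s
    simp only [S0, Finset.coe_insert, Finset.coe_union, Finset.coe_image, Set.mem_inv,
      Set.mem_insert_iff, Set.mem_union, Set.mem_image, inv_eq_one, SetLike.mem_coe]
    constructor
    · rintro (h | h | ⟨x, hx, h⟩)
      · exact Or.inl h
      · exact Or.inr (Or.inr ⟨_, h, by simp⟩)
      · exact Or.inr (Or.inl (by rwa [← inv_injective h]))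
    · rintro (h | h | ⟨x, hx, rfl⟩)
      · exact Or.inl h
      · exact Or.inr (Or.inr ⟨_, h, rfl⟩)
      · exact Or.inr (Or.inl (by rwa [inv_inv]))
  refine ⟨S0, by simp [S0], ?_, fun g => ?_⟩
  · rw [eq_top_iff, ← hS]; exact Subgroup.closure_mono hsub
  · have hg : g ∈ Subgroup.closure (S : Set G) := by rw [hS]; trivial
    induction hg using Subgroup.closure_induction with
    | mem x hx => exact ⟨1, by rw [pow_one]; exact hsub hx⟩
    | one => exact ⟨0, by simp⟩
    | mul x y _ _ hx hy =>
      obtain ⟨a, ha⟩ := hx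
      obtain ⟨b, hb⟩ := hy
      exact ⟨a + b, by rw [pow_add]; exact Set.mul_mem_mul ha hb⟩
    | inv x _ hx =>
      obtain ⟨a, ha⟩ := hx
      exact ⟨a, by rw [← hinv, inv_pow]; exact Set.inv_mem_inv.2 ha⟩

theorem main {G : Type*} [Group G] {q : ℕ} (hq : 2 ≤ q) {A : G →* lG (q + 1)} (hA : IsLat A)
    (n : ℕ) : IsCompact (HypVariety G (n + 1)) ∧ IsClosed (HypVariety G (n + 1)) := by
  obtain ⟨S, hS⟩ := hA.fg
  obtain ⟨S0, h1, hgen, hpow⟩ := exists_gen hS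
  obtain ⟨Λ, hΛ⟩ := disp_bound hq hA S0 h1 hpow (n + 1)
  have hcl : IsClosed {ρ : MobRepSp G (n + 1) | DF ρ} := by
    simp only [DF_iff]
    exact udisc_closed (by omega) hA h1 hgen Phi Phi_cont
  constructor
  · have hK := ((compact_homs (k := n + 1) hpow Λ).image Theta_cont).inter_right hcl
    have hK2 := hK.image (continuous_quot_mk (r := conjRel G (n + 1)))
    refine (congrArg IsCompact (Set.ext fun c => ?_)).mpr hK2
    constructor
    · rintro ⟨ρ, rfl, hρ⟩
      have hD : DF ρ := hρ
      obtain ⟨p, hp, hpL⟩ := hΛ (Phi ρ) ((DF_iff ρ).1 hD)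
      obtain ⟨h, hh⟩ := exists_transl hp
      let f : {f : G → lG (n + 1 + 1) // ∀ g h, f (g * h) = f g * f h} :=
        ⟨fun g => h * Phi ρ g * h⁻¹, fun a b => by
          show h * Phi ρ (a * b) * h⁻¹ = h * Phi ρ a * h⁻¹ * (h * Phi ρ b * h⁻¹)
          rw [map_mul]; group⟩
      have hr : conjRel G (n + 1) ρ (Theta f) := ⟨Psi h, Psi_mem h, fun g => by
        rw [← Psi_Phi ρ, ← map_mul, ← map_inv, ← map_mul]; rfl⟩
      refine ⟨Theta f, ⟨⟨f, fun s hs => ?_, rfl⟩, (DF_conj hr).1 hD⟩, (Quot.sound hr).symm⟩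
      have e : (f.1 s ⊙ (lo : LV (n + 1 + 1))).2 = lB p (Phi ρ s ⊙ p) := by
        rw [← lB_lo']
        have : f.1 s = h * Phi ρ s * h⁻¹ := rfl
        rw [this, ← hh, mul_assoc, act_mul, lB_act, act_mul, inv_act_act]
      rw [e]; exact hpL s hs
    · rintro ⟨ρ, ⟨-, hρ⟩, rfl⟩
      exact ⟨ρ, rfl, hρ⟩
  · have := (isQuotientMap_quot_mk (r := conjRel G (n + 1))).isClosed_preimage
      (s := HypVariety G (n + 1))
    refine this.1 ?_
    rw [Hyp_preimage]; exact hcl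

theorem final (m : ℕ) (hm : 3 ≤ m)
    (Γ : UniformHypLattice m)
    (hfree : ∀ g ∈ Γ.grp, g ≠ 1 → ∀ x : ↥(CBall m), ‖(x : Euc m)‖ < 1 →
      (g : ↥(CBall m) ≃ₜ ↥(CBall m)) x ≠ x)
    (d : ℕ) (hd : m ≤ d + 1) :
    IsCompact (HypVariety ↥Γ.grp d) ∧
    closure (TeichVariety ↥Γ.grp d) ⊆ HypVariety ↥Γ.grp d ∧
    IsCompact (closure (TeichVariety ↥Γ.grp d)) := by
  obtain ⟨n, rfl⟩ : ∃ n, m = n + 1 + 1 := ⟨m - 2, by omega⟩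
  obtain ⟨e, rfl⟩ : ∃ e, d = e + 1 := ⟨d - 1, by omega⟩
  obtain ⟨h1, h2⟩ := main (q := n + 1) (by omega) (latHom_isLat Γ hfree) e
  have h3 : closure (TeichVariety ↥Γ.grp (e + 1)) ⊆ HypVariety ↥Γ.grp (e + 1) := by
    refine closure_minimal ?_ h2
    rintro c ⟨ρ, e1, e2, e3, -⟩
    exact ⟨ρ, e1, e2, e3⟩
  exact ⟨h1, h3, h1.of_isClosed_subset isClosed_closure h3⟩

end TV

/-- **Theorem 2.1.** Let `M` be a closed oriented hyperbolic `m`-manifold, `m ≥ 3`, with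
`π₁(M) ≅ Γ ⊂ SO°(m,1)` a (torsion-free) uniform hyperbolic lattice.  Then for any
`n ≥ m` (here `n = d + 1`, so representations go into `SO°(n,1) ≅ Möb(S^{n-1}) = Möb(d)`),
the Teichmüller variety `𝒯^{n-1}(Γ)` has a natural compactification — its closure in the
representation variety — each point of which corresponds to a faithful discrete
representation `ρ : Γ → SO°(n,1)` belonging to the compact variety `ℋⁿ(Γ)`. -/
theorem teichmuller_variety_compactification (m : ℕ) (hm : 3 ≤ m)
    (Γ : UniformHypLattice m)
    (hfree : ∀ g ∈ Γ.grp, g ≠ 1 → ∀ x : ↥(CBall m), ‖(x : Euc m)‖ < 1 →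
      (g : ↥(CBall m) ≃ₜ ↥(CBall m)) x ≠ x)
    (d : ℕ) (hd : m ≤ d + 1) :
    IsCompact (HypVariety ↥Γ.grp d) ∧
    closure (TeichVariety ↥Γ.grp d) ⊆ HypVariety ↥Γ.grp d ∧
    IsCompact (closure (TeichVariety ↥Γ.grp d)) := by
  exact TV.final m hm Γ hfree d hd
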